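/- arXiv:2405.09741 — 3 statements merged into one kernel-verified Lean document; each statement's English description precedes it below -/
import Mathlib

section
/- Assume that E(s^{X_0^*}) < ∞ for every real s with 0 ≤ s < m (and P(X_0^* ≥ 2) > 0). Then for every integer k ≥ 0 and every p ∈ [0,1], the k-th derivative of the free energy satisfies F_∞^{(k)}(p) = lim_{n→∞} (d^k/dp^k)( E(X_n)/m^n ). -/
open Filter

noncomputable section

/-- One step of the Derrida–Retaux recursion on probability mass functions on ℕ. -/
def drStep (m : ℕ) (μ : ℕ → ℝ) : ℕ → ℝ :=
  fun j => ∑' x : Fin m → ℕ, if (∑ i, x i) - 1 = j then ∏ i, μ (x i) else 0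

/-- The mass function of `X_0`, namely `(1 - p)·δ_0 + p·ν`. -/
def mix (ν : ℕ → ℝ) (p : ℝ) : ℕ → ℝ :=
  fun k => (1 - p) * (if k = 0 then 1 else 0) + p * ν k

/-- The mass function of `X_n`. -/
def drLaw (m : ℕ) (ν : ℕ → ℝ) (p : ℝ) (n : ℕ) : ℕ → ℝ :=
  (drStep m)^[n] (mix ν p)

/-- `E(X_n)` expressed by the closed formula
`E(X_n) = m^n E(X_0) - (m^n - 1)/(m - 1) + ∑_{i<n} m^{n-i-1} P(X_i = 0)^m`,
a polynomial function of `p` (here `E(X_0) = p · E(X_0^*)`). -/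
def drE (m : ℕ) (ν : ℕ → ℝ) (p : ℝ) (n : ℕ) : ℝ :=
  (m : ℝ) ^ n * (p * ∑' j : ℕ, (j : ℝ) * ν j) - ((m : ℝ) ^ n - 1) / ((m : ℝ) - 1) +
    ∑ i ∈ Finset.range n, (m : ℝ) ^ (n - i - 1) * (drLaw m ν p i 0) ^ m

section helpers
open Polynomial



/-! ### Basic finite machinery -/

/-- Linear functional `f ↦ ∑ coeff x * w x`. -/
def pr {R : Type*} [CommRing R] (w : ℕ → R) : R[X] →ₗ[R] R :=
  Polynomial.lsum (fun x => LinearMap.toSpanSingleton R R (w x))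

/-- Pushforward of a (signed) mass function along `φ`. -/
def push {R : Type*} [CommRing R] (φ : ℕ → ℕ) : R[X] →ₗ[R] R[X] :=
  Polynomial.lsum (fun x => Polynomial.monomial (φ x))

section basics
variable {R : Type*} [CommRing R]

@[simp] lemma pr_monomial (w : ℕ → R) (x : ℕ) (a : R) : pr w (monomial x a) = a * w x := by
  simp [pr, Polynomial.lsum_apply, Polynomial.sum_monomial_index]

@[simp] lemma push_monomial (φ : ℕ → ℕ) (x : ℕ) (a : R) :
    push φ (monomial x a) = monomial (φ x) a := by
  simp [push, Polynomial.lsum_apply, Polynomial.sum_monomial_index]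

@[simp] lemma pr_C (w : ℕ → R) (a : R) : pr w (C a) = a * w 0 := by
  rw [← monomial_zero_left, pr_monomial]

lemma pr_push (w : ℕ → R) (φ : ℕ → ℕ) (f : R[X]) : pr w (push φ f) = pr (fun x => w (φ x)) f := by
  induction f using Polynomial.induction_on' with
  | add p q hp hq => simp [hp, hq]
  | monomial n a => simp

lemma pr_eq_sum (w : ℕ → R) (f : R[X]) (N : ℕ) (hN : f.natDegree < N) :
    pr w f = ∑ x ∈ Finset.range N, f.coeff x * w x := by
  simp only [pr, Polynomial.lsum_apply]
  rw [Polynomial.sum_over_range' _ (by simp) N hN]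
  simp

lemma pr_eq_sum' (w : ℕ → R) (f : R[X]) :
    pr w f = ∑ x ∈ Finset.range (f.natDegree + 1), f.coeff x * w x :=
  pr_eq_sum w f _ (Nat.lt_succ_self _)

lemma pr_pow_eq_eval (t : R) (f : R[X]) : pr (fun x => t ^ x) f = f.eval t := by
  rw [pr_eq_sum', Polynomial.eval_eq_sum_range]

lemma pr_add_w (w w' : ℕ → R) (f : R[X]) : pr (fun x => w x + w' x) f = pr w f + pr w' f := by
  simp only [pr_eq_sum', mul_add, Finset.sum_add_distrib]

lemma pr_sub_w (w w' : ℕ → R) (f : R[X]) : pr (fun x => w x - w' x) f = pr w f - pr w' f := by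
  simp only [pr_eq_sum', mul_sub, Finset.sum_sub_distrib]

lemma pr_smul_w (c : R) (w : ℕ → R) (f : R[X]) : pr (fun x => c * w x) f = c * pr w f := by
  simp only [pr_eq_sum', Finset.mul_sum]
  exact Finset.sum_congr rfl fun x _ => by ring

lemma pr_delta (y : ℕ) (f : R[X]) : pr (fun x => if x = y then 1 else 0) f = f.coeff y := by
  induction f using Polynomial.induction_on' with
  | add p q hp hq => simp [hp, hq]
  | monomial n a => simp [coeff_monomial]

lemma coeff_push (φ : ℕ → ℕ) (f : R[X]) (y : ℕ) :
    (push φ f).coeff y = pr (fun x => if φ x = y then 1 else 0) f := by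
  rw [← pr_delta, pr_push]

lemma eval_one_push (φ : ℕ → ℕ) (f : R[X]) : (push φ f).eval 1 = f.eval 1 := by
  rw [← pr_pow_eq_eval, ← pr_pow_eq_eval, pr_push]; simp

lemma map_push {S : Type*} [CommRing S] (g : R →+* S) (φ : ℕ → ℕ) (f : R[X]) :
    (push φ f).map g = push φ (f.map g) := by
  induction f using Polynomial.induction_on' with
  | add p q hp hq => simp [hp, hq]
  | monomial n a => simp

/-- Capped Derrida–Retaux step. -/
def cstep (m c : ℕ) (f : R[X]) : R[X] := push (fun S => min (S - 1) (c - 1)) (f ^ m)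

/-- Capped initial law. -/
def L0 (u : ℕ → R) (n : ℕ) (p : R) : R[X] :=
  C (1 - p) + C p * (∑ x ∈ Finset.range (n + 1), monomial x (u x)
    + monomial (n + 1) (1 - ∑ x ∈ Finset.range (n + 1), u x))

/-- Capped law at time `j` with horizon `n`. -/
def LL (m : ℕ) (u : ℕ → R) (n : ℕ) (p : R) : ℕ → R[X]
  | 0 => L0 u n p
  | j + 1 => cstep m (n + 1 - j) (LL m u n p j)

lemma map_cstep {S : Type*} [CommRing S] (g : R →+* S) (m c : ℕ) (f : R[X]) :
    (cstep m c f).map g = cstep m c (f.map g) := by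
  simp [cstep, map_push]

lemma map_LL {S : Type*} [CommRing S] (g : R →+* S) (m : ℕ) (u : ℕ → R) (n : ℕ) (p : R) (j : ℕ) :
    (LL m u n p j).map g = LL m (fun x => g (u x)) n (g p) j := by
  induction j with
  | zero => simp [LL, L0, Polynomial.map_sum]
  | succ j ih => simp only [LL, map_cstep, ih]

lemma eval_one_cstep (m c : ℕ) (f : R[X]) : (cstep m c f).eval 1 = (f.eval 1) ^ m := by
  simp [cstep, eval_one_push]

lemma eval_one_LL (m : ℕ) (u : ℕ → R) (n : ℕ) (p : R) (j : ℕ) : (LL m u n p j).eval 1 = 1 := by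
  induction j with
  | zero => simp [LL, L0, eval_finsetSum]
  | succ j ih => simp [LL, eval_one_cstep, ih]

lemma coeff_cstep_of_ge (m c : ℕ) (f : R[X]) (y : ℕ) (hy : c ≤ y) (hc : 1 ≤ c) :
    (cstep m c f).coeff y = 0 := by
  rw [cstep, coeff_push, pr_eq_sum']
  refine Finset.sum_eq_zero fun x _ => ?_
  rw [if_neg, mul_zero]
  omega

lemma coeff_LL_of_gt (m : ℕ) (u : ℕ → R) (n : ℕ) (p : R) (j : ℕ) (hj : j ≤ n) (y : ℕ)
    (hy : n + 1 - j < y) : (LL m u n p j).coeff y = 0 := by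
  cases j with
  | zero =>
    have h1 : y ≠ 0 := by omega
    have h2 : ¬ y ≤ n := by omega
    have h3 : n + 1 ≠ y := by omega
    simp only [LL, L0, coeff_add, coeff_C_mul, finsetSum_coeff, coeff_monomial, coeff_C, h1, h3,
      if_false]
    simp
    intro hh; omega
  | succ j => exact coeff_cstep_of_ge _ _ _ _ (by omega) (by omega)

lemma coeff_L0 (u : ℕ → R) (n : ℕ) (p : R) (x : ℕ) (hx : x ≤ n) :
    (L0 u n p).coeff x = (1 - p) * (if x = 0 then 1 else 0) + p * u x := by
  have h3 : n + 1 ≠ x := by omega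
  have h2 : x < n + 1 := by omega
  simp only [L0, coeff_add, coeff_C_mul, finsetSum_coeff, coeff_monomial, coeff_C, h3,
      if_false]
  simp [h2]

lemma pr_pow_expand (w : ℕ → R) (f : R[X]) (D m : ℕ) (hD : f.natDegree < D) :
    pr w (f ^ m) = ∑ x ∈ Fintype.piFinset (fun _ : Fin m => Finset.range D),
      (∏ i, f.coeff (x i)) * w (∑ i, x i) := by
  have h : f ^ m = ∏ _i : Fin m, ∑ x ∈ Finset.range D, monomial x (f.coeff x) := by
    rw [← Polynomial.as_sum_range' f D hD]; simp
  have hprod : ∀ (s : Finset (Fin m)) (x : Fin m → ℕ), ∏ i ∈ s, monomial (x i) (f.coeff (x i))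
      = monomial (∑ i ∈ s, x i) (∏ i ∈ s, f.coeff (x i)) := by
    intro s x
    induction s using Finset.induction_on with
    | empty => simp
    | insert a s ha ih => rw [Finset.prod_insert ha, Finset.prod_insert ha, Finset.sum_insert ha,
        ih, monomial_mul_monomial]
  rw [h, Finset.prod_univ_sum, map_sum]
  refine Finset.sum_congr rfl fun x _ => ?_
  rw [hprod, pr_monomial]

end basics

lemma coeff_cstep_eq_drStep (m c : ℕ) (f : ℝ[X]) (μ : ℕ → ℝ) (y : ℕ) (hy : y + 1 < c)
    (hμ : ∀ x ≤ y + 1, f.coeff x = μ x) : (cstep m c f).coeff y = drStep m μ y := by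
  rw [cstep, coeff_push, pr_pow_expand _ f (f.natDegree + y + 2) m (by omega), drStep,
    tsum_eq_sum (s := Fintype.piFinset (fun _ : Fin m => Finset.range (f.natDegree + y + 2)))]
  · refine Finset.sum_congr rfl fun x _ => ?_
    by_cases h : (∑ i, x i) - 1 = y
    · have h1 : min ((∑ i, x i) - 1) (c - 1) = y := by omega
      rw [if_pos h, if_pos h1, mul_one]
      refine Finset.prod_congr rfl fun i _ => hμ _ ?_
      have := Finset.single_le_sum (f := x) (fun i _ => Nat.zero_le _) (Finset.mem_univ i)
      omega
    · have h1 : ¬ min ((∑ i, x i) - 1) (c - 1) = y := by omega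
      rw [if_neg h, if_neg h1, mul_zero]
  · intro x hx
    rw [if_neg]
    simp only [Fintype.mem_piFinset, Finset.mem_range, not_forall] at hx
    obtain ⟨i, hi⟩ := hx
    have := Finset.single_le_sum (f := x) (fun i _ => Nat.zero_le _) (Finset.mem_univ i)
    omega

lemma coeff_LL_eq_drLaw (m : ℕ) (ν : ℕ → ℝ) (n : ℕ) (p : ℝ) (j : ℕ) (hj : j ≤ n) :
    ∀ x, x + j ≤ n → (LL m ν n p j).coeff x = drLaw m ν p j x := by
  induction j with
  | zero => intro x hx; simp only [LL]; rw [coeff_L0 _ _ _ _ (by omega)]; simp [drLaw, mix]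
  | succ j ih =>
    intro x hx
    simp only [LL]
    rw [drLaw, Function.iterate_succ_apply']
    exact coeff_cstep_eq_drStep _ _ _ _ _ (by omega) (fun y hy => ih (by omega) y (by omega))



/-! ### Nonnegativity and domination -/

/-- Nonnegative coefficients. -/
def NN (f : ℝ[X]) : Prop := ∀ x, 0 ≤ f.coeff x

lemma pr_le_pr {f g : ℝ[X]} {w w' : ℕ → ℝ} (h : ∀ x, f.coeff x * w x ≤ g.coeff x * w' x) :
    pr w f ≤ pr w' g := by
  rw [pr_eq_sum w f (f.natDegree + g.natDegree + 1) (by omega),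
    pr_eq_sum w' g (f.natDegree + g.natDegree + 1) (by omega)]
  exact Finset.sum_le_sum fun x _ => h x

lemma NN.pr_mono {f : ℝ[X]} (hf : NN f) {w w' : ℕ → ℝ} (h : ∀ x, w x ≤ w' x) :
    pr w f ≤ pr w' f := pr_le_pr fun x => mul_le_mul_of_nonneg_left (h x) (hf x)

lemma NN.pr_nonneg {f : ℝ[X]} (hf : NN f) {w : ℕ → ℝ} (h : ∀ x, 0 ≤ w x) :
    0 ≤ pr w f := by
  rw [pr_eq_sum']
  exact Finset.sum_nonneg fun x _ => mul_nonneg (hf x) (h x)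

lemma NN.add {f g : ℝ[X]} (hf : NN f) (hg : NN g) : NN (f + g) := fun x => by
  rw [coeff_add]; exact add_nonneg (hf x) (hg x)

lemma NN.mul {f g : ℝ[X]} (hf : NN f) (hg : NN g) : NN (f * g) := fun x => by
  rw [coeff_mul]; exact Finset.sum_nonneg fun y _ => mul_nonneg (hf _) (hg _)

lemma NN.pow {f : ℝ[X]} (hf : NN f) (m : ℕ) : NN (f ^ m) := by
  induction m with
  | zero => intro x; rw [pow_zero, coeff_one]; split_ifs <;> norm_num
  | succ m ih => rw [pow_succ]; exact ih.mul hf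

lemma NN.push {f : ℝ[X]} (hf : NN f) (φ : ℕ → ℕ) : NN (push φ f) := fun x => by
  rw [coeff_push]; exact hf.pr_nonneg fun y => by split_ifs <;> norm_num

lemma NN.cstep {f : ℝ[X]} (hf : NN f) (m c : ℕ) : NN (cstep m c f) := (hf.pow m).push _

lemma NN_monomial (x : ℕ) {a : ℝ} (ha : 0 ≤ a) : NN (monomial x a) := fun y => by
  rw [coeff_monomial]; split_ifs <;> simp [ha]

lemma NN_C {a : ℝ} (ha : 0 ≤ a) : NN (C a) := NN_monomial 0 ha

lemma NN_sum {ι : Type*} (s : Finset ι) (f : ι → ℝ[X]) (h : ∀ i ∈ s, NN (f i)) :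
    NN (∑ i ∈ s, f i) := fun x => by
  rw [finsetSum_coeff]; exact Finset.sum_nonneg fun i hi => h i hi x

lemma NN_L0 {u : ℕ → ℝ} (hu : ∀ x, 0 ≤ u x) (n : ℕ) (hs : ∑ x ∈ Finset.range (n + 1), u x ≤ 1)
    {p : ℝ} (h0 : 0 ≤ p) (h1 : p ≤ 1) : NN (L0 u n p) :=
  (NN_C (by linarith)).add ((NN_C h0).mul ((NN_sum _ _ fun i _ => NN_monomial i (hu i)).add
    (NN_monomial _ (by linarith))))

lemma NN_LL (m : ℕ) {u : ℕ → ℝ} (hu : ∀ x, 0 ≤ u x) (n : ℕ)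
    (hs : ∑ x ∈ Finset.range (n + 1), u x ≤ 1)
    {p : ℝ} (h0 : 0 ≤ p) (h1 : p ≤ 1) (j : ℕ) : NN (LL m u n p j) := by
  induction j with
  | zero => exact NN_L0 hu n hs h0 h1
  | succ j ih => exact ih.cstep _ _

lemma pr_mul {R : Type*} [CommRing R] (w : ℕ → R) (f g : R[X]) :
    pr w (f * g) = pr (fun x => pr (fun y => w (x + y)) g) f := by
  induction f using Polynomial.induction_on' with
  | add p q hp hq => simp [add_mul, hp, hq]
  | monomial n a =>
    rw [pr_monomial]
    induction g using Polynomial.induction_on' with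
    | add p q hp hq => simp [mul_add, hp, hq]
    | monomial k b => simp [monomial_mul_monomial]; ring

lemma pr_mul_le {f g : ℝ[X]} (hf : NN f) (hg : NN g) {w : ℕ → ℝ}
    (hw : ∀ x y, w (x + y) ≤ w x * w y) : pr w (f * g) ≤ pr w f * pr w g := by
  rw [pr_mul, mul_comm (pr w f), ← pr_smul_w]
  refine hf.pr_mono fun x => ?_
  rw [mul_comm, ← pr_smul_w]
  exact hg.pr_mono fun y => hw x y

lemma pr_pow_le {f : ℝ[X]} (hf : NN f) {w : ℕ → ℝ} (hw1 : w 0 ≤ 1) (hw0 : ∀ x, 0 ≤ w x)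
    (hw : ∀ x y, w (x + y) ≤ w x * w y) (m : ℕ) : pr w (f ^ m) ≤ (pr w f) ^ m := by
  induction m with
  | zero => rw [pow_zero, pow_zero, ← C_1, pr_C]; linarith
  | succ m ih =>
    rw [pow_succ, pow_succ]
    refine (pr_mul_le (hf.pow m) hf hw).trans ?_
    exact mul_le_mul_of_nonneg_right ih (hf.pr_nonneg hw0)

/-- Coefficientwise domination. -/
def Dom (f : ℂ[X]) (g : ℝ[X]) : Prop := ∀ x, ‖f.coeff x‖ ≤ g.coeff x

lemma Dom.nn {f : ℂ[X]} {g : ℝ[X]} (h : Dom f g) : NN g := fun x => (norm_nonneg _).trans (h x)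

lemma Dom.add {f f' : ℂ[X]} {g g' : ℝ[X]} (h : Dom f g) (h' : Dom f' g') :
    Dom (f + f') (g + g') := fun x => by
  rw [coeff_add, coeff_add]; exact (norm_add_le _ _).trans (add_le_add (h x) (h' x))

lemma Dom.mul {f f' : ℂ[X]} {g g' : ℝ[X]} (h : Dom f g) (h' : Dom f' g') :
    Dom (f * f') (g * g') := fun x => by
  rw [coeff_mul, coeff_mul]
  refine (norm_sum_le _ _).trans (Finset.sum_le_sum fun y _ => ?_)
  rw [norm_mul]
  exact mul_le_mul (h _) (h' _) (norm_nonneg _) (h.nn _)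

lemma Dom_one : Dom 1 1 := fun x => by
  rw [coeff_one, coeff_one]; split_ifs <;> simp

lemma Dom_zero : Dom 0 0 := fun x => by simp

lemma Dom.pow {f : ℂ[X]} {g : ℝ[X]} (h : Dom f g) (m : ℕ) : Dom (f ^ m) (g ^ m) := by
  induction m with
  | zero => simpa using Dom_one
  | succ m ih => rw [pow_succ, pow_succ]; exact ih.mul h

lemma Dom.norm_pr_le {f : ℂ[X]} {g : ℝ[X]} (h : Dom f g) {w : ℕ → ℂ} {w' : ℕ → ℝ}
    (hw : ∀ x, ‖w x‖ ≤ w' x) : ‖pr w f‖ ≤ pr w' g := by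
  rw [pr_eq_sum w f (f.natDegree + g.natDegree + 1) (by omega),
    pr_eq_sum w' g (f.natDegree + g.natDegree + 1) (by omega)]
  refine (norm_sum_le _ _).trans (Finset.sum_le_sum fun y _ => ?_)
  rw [norm_mul]
  exact mul_le_mul (h _) (hw _) (norm_nonneg _) (h.nn _)

lemma Dom.push {f : ℂ[X]} {g : ℝ[X]} (h : Dom f g) (φ : ℕ → ℕ) : Dom (push φ f) (push φ g) :=
  fun x => by
  rw [coeff_push, coeff_push]
  exact h.norm_pr_le fun y => by split_ifs <;> simp

lemma Dom.pow_sub_pow {f d : ℂ[X]} {g e : ℝ[X]} (h : Dom f g) (hde : Dom d e) (m : ℕ) :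
    Dom ((f + d) ^ m - f ^ m) ((g + e) ^ m - g ^ m) := by
  induction m with
  | zero => simpa using Dom_zero
  | succ m ih =>
    have e1 : (f + d) ^ (m + 1) - f ^ (m + 1) = ((f + d) ^ m - f ^ m) * (f + d) + f ^ m * d := by
      ring
    have e2 : (g + e) ^ (m + 1) - g ^ (m + 1) = ((g + e) ^ m - g ^ m) * (g + e) + g ^ m * e := by
      ring
    rw [e1, e2]
    exact (ih.mul (h.add hde)).add ((h.pow m).mul hde)

/-- Polynomial of the norms of the coefficients. -/
def absP (f : ℂ[X]) : ℝ[X] := ∑ x ∈ Finset.range (f.natDegree + 1), monomial x ‖f.coeff x‖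

lemma coeff_absP (f : ℂ[X]) (x : ℕ) : (absP f).coeff x = ‖f.coeff x‖ := by
  simp only [absP, finsetSum_coeff, coeff_monomial]
  rw [Finset.sum_ite_eq']
  split_ifs with h
  · rfl
  · rw [Finset.mem_range, not_lt] at h
    rw [coeff_eq_zero_of_natDegree_lt (by omega), norm_zero]

lemma dom_absP (f : ℂ[X]) : Dom f (absP f) := fun x => by rw [coeff_absP]

lemma NN_absP (f : ℂ[X]) : NN (absP f) := (dom_absP f).nn

lemma Dom.absP_pr_le {f : ℂ[X]} {g : ℝ[X]} (h : Dom f g) {w : ℕ → ℝ} (hw : ∀ x, 0 ≤ w x) :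
    pr w (absP f) ≤ pr w g :=
  pr_le_pr fun x => by
    rw [coeff_absP]; exact mul_le_mul_of_nonneg_right (h x) (hw x)

lemma dom_map {g : ℝ[X]} (hg : NN g) : Dom (g.map Complex.ofRealHom) g := fun x => by
  simp [abs_of_nonneg (hg x)]

/-- One absolute step. -/
lemma absP_cstep_pr_le (m c : ℕ) (f : ℂ[X]) {w : ℕ → ℝ} (hw : ∀ x, 0 ≤ w x) :
    pr w (absP (cstep m c f)) ≤ pr (fun S => w (min (S - 1) (c - 1))) ((absP f) ^ m) := by
  have h : Dom (cstep m c f) (push (fun S => min (S - 1) (c - 1)) ((absP f) ^ m)) :=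
    ((dom_absP f).pow m).push _
  refine (h.absP_pr_le hw).trans ?_
  rw [pr_push]

lemma absP_cstep_sub_pr_le (m c : ℕ) {f : ℝ[X]} (hf : NN f) (d : ℂ[X]) {w : ℕ → ℝ}
    (hw : ∀ x, 0 ≤ w x) :
    pr w (absP (cstep m c (f.map Complex.ofRealHom + d) - (cstep m c f).map Complex.ofRealHom)) ≤
      pr (fun S => w (min (S - 1) (c - 1))) ((f + absP d) ^ m - f ^ m) := by
  have e : cstep m c (f.map Complex.ofRealHom + d) - (cstep m c f).map Complex.ofRealHom
     = push (fun S => min (S - 1) (c - 1))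
        ((f.map Complex.ofRealHom + d) ^ m - (f.map Complex.ofRealHom) ^ m) := by
    rw [map_cstep, map_sub]; rfl
  rw [e]
  have h := ((dom_map hf).pow_sub_pow (dom_absP d) m).push (fun S => min (S - 1) (c - 1))
  refine (h.absP_pr_le hw).trans ?_
  rw [pr_push]

lemma eval_one_eq_pr {R : Type*} [CommRing R] (f : R[X]) : f.eval 1 = pr (fun _ => 1) f := by
  rw [← pr_pow_eq_eval]; simp

lemma absP_cstep_eval_one (m c : ℕ) (f : ℂ[X]) :
    (absP (cstep m c f)).eval 1 ≤ ((absP f).eval 1) ^ m := by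
  rw [eval_one_eq_pr]
  refine (absP_cstep_pr_le m c f fun _ => zero_le_one).trans ?_
  rw [← eval_one_eq_pr, eval_pow]



/-! ### The functional `ps` -/

/-- Weight `((m-1)x-1) t^x`. -/
def wps (m : ℕ) (t : ℝ) (x : ℕ) : ℝ := (((m : ℝ) - 1) * x - 1) * t ^ x

/-- The functional `(m-1) t f'(t) - f(t)`. -/
def ps (m : ℕ) (t : ℝ) (f : ℝ[X]) : ℝ := pr (wps m t) f

lemma pr_x_pow (t : ℝ) (f : ℝ[X]) : pr (fun x => (x : ℝ) * t ^ x) f = t * f.derivative.eval t := by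
  induction f using Polynomial.induction_on' with
  | add p q hp hq => simp [hp, hq, mul_add]
  | monomial n a =>
    rw [derivative_monomial, pr_monomial, eval_monomial]
    cases n with
    | zero => simp
    | succ n => simp [pow_succ]; ring

lemma ps_eq (m : ℕ) (t : ℝ) (f : ℝ[X]) :
    ps m t f = ((m : ℝ) - 1) * (t * f.derivative.eval t) - f.eval t := by
  rw [← pr_x_pow, ← pr_pow_eq_eval, ← pr_smul_w, ← pr_sub_w, ps]
  congr 2; ext x; simp only [wps]; ring

lemma ps_pow (m : ℕ) (hm : 1 ≤ m) (t : ℝ) (f : ℝ[X]) :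
    pr (fun S => (((m : ℝ) - 1) * S - m) * t ^ S) (f ^ m) = m * f.eval t ^ (m - 1) * ps m t f := by
  have : (fun S : ℕ => (((m : ℝ) - 1) * S - m) * t ^ S)
      = fun S : ℕ => ((m : ℝ) - 1) * ((S : ℝ) * t ^ S) - m * t ^ S := by
    ext S; ring
  rw [this, pr_sub_w, pr_smul_w, pr_smul_w, pr_x_pow, pr_pow_eq_eval, ps_eq, derivative_pow]
  obtain ⟨k, rfl⟩ : ∃ k, m = k + 1 := ⟨m - 1, by omega⟩
  simp [pow_succ]
  ring

lemma coeff_zero_pow (f : ℝ[X]) (m : ℕ) : (f ^ m).coeff 0 = f.coeff 0 ^ m := by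
  rw [coeff_zero_eq_eval_zero, coeff_zero_eq_eval_zero, eval_pow]

lemma ps_cstep (m c : ℕ) (t : ℝ) (f : ℝ[X]) :
    t * ps m t (cstep m c f) = pr (fun S => t * wps m t (min (S - 1) (c - 1))) (f ^ m) := by
  rw [ps, cstep, pr_push, pr_smul_w]

lemma wps_shift_le (m : ℕ) (hm : 2 ≤ m) (c : ℕ) (hc : 1 ≤ c) (t : ℝ) (ht : 1 ≤ t) (S : ℕ) :
    t * wps m t (min (S - 1) (c - 1)) ≤
      (((m : ℝ) - 1) * S - m) * t ^ S + (m - t) * (if S = 0 then 1 else 0) := by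
  have hm' : (2 : ℝ) ≤ m := by exact_mod_cast hm
  rcases Nat.eq_zero_or_pos S with h | h
  · subst h; simp [wps]
  · rw [if_neg (by omega), mul_zero, add_zero]
    rcases le_or_gt S c with h2 | h2
    · obtain ⟨k, rfl⟩ : ∃ k, S = k + 1 := ⟨S - 1, by omega⟩
      have : min (k + 1 - 1) (c - 1) = k := by omega
      rw [this, wps]; push_cast; rw [pow_succ]; apply le_of_eq; ring
    · obtain ⟨k, rfl⟩ : ∃ k, c = k + 1 := ⟨c - 1, by omega⟩
      have : min (S - 1) (k + 1 - 1) = k := by omega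
      rw [this, wps]
      have e : t * ((((m : ℝ) - 1) * k - 1) * t ^ k)
         = (((m : ℝ) - 1) * (k + 1) - m) * t ^ (k + 1) := by rw [pow_succ]; ring
      rw [e]
      have hS : (k : ℝ) + 2 ≤ S := by exact_mod_cast h2
      have h3 : 0 ≤ ((m : ℝ) - 1) * S - m := by nlinarith [(Nat.cast_nonneg k : (0:ℝ) ≤ k)]
      have h4 : ((m : ℝ) - 1) * (k + 1) - m ≤ ((m : ℝ) - 1) * S - m := by nlinarith
      calc _ ≤ (((m : ℝ) - 1) * S - m) * t ^ (k + 1) :=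
            mul_le_mul_of_nonneg_right h4 (by positivity)
        _ ≤ _ := mul_le_mul_of_nonneg_left (pow_le_pow_right₀ ht (by omega)) h3

lemma wps_shift_ge (m : ℕ) (hm : 2 ≤ m) (c : ℕ) (hc : 1 ≤ c) (t : ℝ) (ht : 1 ≤ t)
    (q t2 Cq : ℝ) (hq0 : 0 ≤ q) (hq1 : q ≤ 1) (ht2 : 0 ≤ t2) (hC : 0 ≤ Cq)
    (hb : ∀ S : ℕ, m * S * t ^ S ≤ Cq * (q ^ S * t2 ^ S)) (S : ℕ) :
      (((m : ℝ) - 1) * S - m) * t ^ S + (m - t) * (if S = 0 then 1 else 0) - Cq * q ^ c * t2 ^ S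
      ≤ t * wps m t (min (S - 1) (c - 1)) := by
  have hm' : (2 : ℝ) ≤ m := by exact_mod_cast hm
  have hE : 0 ≤ Cq * q ^ c * t2 ^ S := by positivity
  rcases Nat.eq_zero_or_pos S with h | h
  · subst h; simp [wps] at hE ⊢; linarith
  · rw [if_neg (by omega), mul_zero, add_zero]
    rcases le_or_gt S c with h2 | h2
    · obtain ⟨k, rfl⟩ : ∃ k, S = k + 1 := ⟨S - 1, by omega⟩
      have : min (k + 1 - 1) (c - 1) = k := by omega
      rw [this, wps]
      have : (((m : ℝ) - 1) * ((k + 1 : ℕ) : ℝ) - m) * t ^ (k + 1)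
        = t * ((((m : ℝ) - 1) * k - 1) * t ^ k) := by push_cast; rw [pow_succ]; ring
      linarith
    · obtain ⟨k, rfl⟩ : ∃ k, c = k + 1 := ⟨c - 1, by omega⟩
      have : min (S - 1) (k + 1 - 1) = k := by omega
      rw [this, wps]
      have e : t * ((((m : ℝ) - 1) * k - 1) * t ^ k)
         = (((m : ℝ) - 1) * (k + 1) - m) * t ^ (k + 1) := by rw [pow_succ]; ring
      rw [e]
      have h5 : t ^ (k + 1) ≤ t ^ S := pow_le_pow_right₀ ht (by omega)
      have h6 : q ^ S ≤ q ^ (k + 1) := pow_le_pow_of_le_one hq0 hq1 (by omega)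
      have h7 : Cq * (q ^ S * t2 ^ S) ≤ Cq * q ^ (k + 1) * t2 ^ S := by
        rw [mul_assoc]
        exact mul_le_mul_of_nonneg_left (mul_le_mul_of_nonneg_right h6 (by positivity)) hC
      have h8 := hb S
      have h9 : 0 ≤ ((m : ℝ) - 1) * (k + 1) * t ^ (k + 1) := by
        have : 0 ≤ (m : ℝ) - 1 := by linarith
        positivity
      have h10 : 0 ≤ (S : ℝ) * t ^ S := by positivity
      nlinarith

lemma pr_shift (m : ℕ) (hm : 2 ≤ m) (t : ℝ) (f : ℝ[X]) :
    pr (fun S => (((m : ℝ) - 1) * S - m) * t ^ S + (m - t) * (if S = 0 then 1 else 0)) (f ^ m)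
     = m * f.eval t ^ (m - 1) * ps m t f + (m - t) * f.coeff 0 ^ m := by
  rw [pr_add_w, ps_pow m (by omega), pr_smul_w, pr_delta, coeff_zero_pow]

lemma ps_cstep_le (m : ℕ) (hm : 2 ≤ m) (c : ℕ) (hc : 1 ≤ c) (t : ℝ) (ht : 1 ≤ t) {f : ℝ[X]}
    (hf : NN f) : t * ps m t (cstep m c f)
      ≤ m * f.eval t ^ (m - 1) * ps m t f + (m - t) * f.coeff 0 ^ m := by
  rw [ps_cstep, ← pr_shift m hm]
  exact (hf.pow m).pr_mono fun S => wps_shift_le m hm c hc t ht S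

lemma ps_cstep_ge (m : ℕ) (hm : 2 ≤ m) (c : ℕ) (hc : 1 ≤ c) (t : ℝ) (ht : 1 ≤ t)
    (q t2 Cq : ℝ) (hq0 : 0 ≤ q) (hq1 : q ≤ 1) (ht2 : 0 ≤ t2) (hC : 0 ≤ Cq)
    (hb : ∀ S : ℕ, m * S * t ^ S ≤ Cq * (q ^ S * t2 ^ S)) {f : ℝ[X]}
    (hf : NN f) :
      m * f.eval t ^ (m - 1) * ps m t f + (m - t) * f.coeff 0 ^ m - Cq * q ^ c * f.eval t2 ^ m
      ≤ t * ps m t (cstep m c f) := by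
  rw [ps_cstep, ← pr_shift m hm, ← eval_pow, ← pr_pow_eq_eval t2, ← pr_smul_w, ← pr_sub_w]
  exact (hf.pow m).pr_mono fun S => wps_shift_ge m hm c hc t ht q t2 Cq hq0 hq1 ht2 hC hb S

/-- constant -/
def cm (m : ℕ) : ℝ := 1 / (4 * (m : ℝ) ^ 2)

lemma cm_pos (m : ℕ) (hm : 2 ≤ m) : 0 < cm m := by
  have : (0 : ℝ) < m := by exact_mod_cast (by omega : 0 < m)
  unfold cm; positivity

lemma cm_bound (m : ℕ) (hm : 2 ≤ m) : cm m * (m - 1) * m ≤ 1 / 4 := by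
  have hm' : (2 : ℝ) ≤ m := by exact_mod_cast hm
  unfold cm
  rw [div_mul_eq_mul_div, div_mul_eq_mul_div, div_le_div_iff₀ (by positivity) (by norm_num)]
  nlinarith

lemma growth_aux (m : ℕ) (hm : 2 ≤ m) (t : ℝ) (ht : (m : ℝ) - 1 / 4 ≤ t) (htm : t ≤ m) (x : ℕ)
    (hx : 1 ≤ x) : ((m : ℝ) - 1) * x ≤ t ^ x * (1 - cm m * (m - 1)) := by
  have hm' : (2 : ℝ) ≤ m := by exact_mod_cast hm
  have hc := cm_bound m hm
  have hc0 := cm_pos m hm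
  have h1 : t - 1 / 4 ≤ t * (1 - cm m * (m - 1)) := by
    have : 0 ≤ cm m * (m - 1) := mul_nonneg hc0.le (by linarith)
    nlinarith
  have h2 : ∀ k : ℕ, ((m : ℝ) - 1) * (k + 2 : ℕ) ≤ t ^ (k + 2) * (1 - cm m * (m - 1)) := by
    intro k
    induction k with
    | zero => push_cast; rw [pow_two, mul_assoc]; nlinarith
    | succ k ih =>
      push_cast at ih ⊢
      have hk : (0 : ℝ) ≤ k := Nat.cast_nonneg k
      calc ((m : ℝ) - 1) * ((k : ℝ) + 1 + 2) ≤ t * (((m : ℝ) - 1) * (k + 2)) := by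
            have : (k : ℝ) + 1 + 2 ≤ t * (k + 2) := by nlinarith
            have h0 : 0 ≤ (m : ℝ) - 1 := by linarith
            nlinarith
        _ ≤ t * (t ^ (k + 2) * (1 - cm m * (m - 1))) :=
            mul_le_mul_of_nonneg_left ih (by linarith)
        _ = _ := by rw [show k + 1 + 2 = (k + 2) + 1 from rfl, pow_succ t (k + 2)]; ring
  rcases Nat.lt_or_ge x 2 with h | h
  · have : x = 1 := by omega
    subst this; rw [pow_one]; push_cast; linarith
  · obtain ⟨k, rfl⟩ : ∃ k, x = k + 2 := ⟨x - 2, by omega⟩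
    exact h2 k

lemma tangent_aux (m : ℕ) (hm : 2 ≤ m) (t : ℝ) (ht : (m : ℝ) - 1 / 4 ≤ t) (htm : t ≤ m)
    (z : ℝ) (hz : 0 ≤ z) (x : ℕ) (hx : 1 ≤ x) :
    wps m t x * ((2 * z + 3 * cm m * z ^ 2) - (z ^ 2 + 2 * cm m * z ^ 3) * x)
      ≤ ((m : ℝ) - 1) * (t ^ x - 1) := by
  have hm' : (2 : ℝ) ≤ m := by exact_mod_cast hm
  have hx' : (1 : ℝ) ≤ x := by exact_mod_cast hx
  have hg := growth_aux m hm t ht htm x hx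
  have hc0 := cm_pos m hm
  set c := cm m with hcdef
  have htx : 0 < t ^ x := by
    have : 0 < t := by linarith
    positivity
  have hw : 0 ≤ wps m t x := by
    unfold wps
    have : 0 ≤ ((m : ℝ) - 1) * x - 1 := by nlinarith
    positivity
  have h1 : wps m t x * (x + c) ≤ ((m : ℝ) - 1) * (t ^ x - 1) * x ^ 2 := by
    unfold wps
    have e : ((m : ℝ) - 1) * (t ^ x - 1) * x ^ 2 - (((m : ℝ) - 1) * x - 1) * t ^ x * (x + c)
      = x * (t ^ x * (1 - c * (m - 1)) - (m - 1) * x) + c * t ^ x := by ring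
    have : 0 ≤ x * (t ^ x * (1 - c * (m - 1)) - (m - 1) * x) :=
      mul_nonneg (by linarith) (by linarith)
    have : 0 ≤ c * t ^ x := by positivity
    linarith
  -- tangent line
  have h2 : ((2 * z + 3 * c * z ^ 2) - (z ^ 2 + 2 * c * z ^ 3) * x) * x ^ 2 ≤ x + c := by
    set w := z * x with hwdef
    have hw0 : 0 ≤ w := by positivity
    have e : x + c - ((2 * z + 3 * c * z ^ 2) - (z ^ 2 + 2 * c * z ^ 3) * x) * x ^ 2
      = x * (1 - w) ^ 2 + c * (1 - w) ^ 2 * (1 + 2 * w) := by rw [hwdef]; ring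
    have : 0 ≤ x * (1 - w) ^ 2 + c * (1 - w) ^ 2 * (1 + 2 * w) := by positivity
    linarith
  have hxx : (0 : ℝ) < (x : ℝ) ^ 2 := by positivity
  refine le_of_mul_le_mul_right ?_ hxx
  calc _ = wps m t x * (((2 * z + 3 * c * z ^ 2) - (z ^ 2 + 2 * c * z ^ 3) * x) * x ^ 2) := by ring
    _ ≤ wps m t x * (x + c) := mul_le_mul_of_nonneg_left h2 hw
    _ ≤ _ := h1

/-- `V` functional. -/
def Vf (m : ℕ) (t : ℝ) (f : ℝ[X]) : ℝ := pr (fun x => (x : ℝ) * wps m t x) f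

lemma Q_eq (m : ℕ) (t : ℝ) (f : ℝ[X]) :
    ps m t f + f.coeff 0 = pr (fun x => if x = 0 then 0 else wps m t x) f := by
  rw [ps, ← pr_delta 0 f, ← pr_add_w]
  congr 2; ext x
  by_cases h : x = 0
  · subst h; simp [wps]
  · simp [h]

lemma wps_nonneg (m : ℕ) (hm : 2 ≤ m) (t : ℝ) (ht : 0 ≤ t) (x : ℕ) (hx : 1 ≤ x) :
    0 ≤ wps m t x := by
  have hm' : (2 : ℝ) ≤ m := by exact_mod_cast hm
  have hx' : (1 : ℝ) ≤ x := by exact_mod_cast hx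
  unfold wps
  have : 0 ≤ ((m : ℝ) - 1) * x - 1 := by nlinarith
  positivity

lemma Q_le_V (m : ℕ) (hm : 2 ≤ m) (t : ℝ) (ht : 0 ≤ t) {f : ℝ[X]} (hf : NN f) :
    ps m t f + f.coeff 0 ≤ Vf m t f := by
  rw [Q_eq]
  refine hf.pr_mono fun x => ?_
  split_ifs with h
  · simp [h]
  · have := wps_nonneg m hm t ht x (by omega)
    have hx' : (1 : ℝ) ≤ x := by exact_mod_cast (by omega : 1 ≤ x)
    nlinarith

lemma jensen (m : ℕ) (hm : 2 ≤ m) (t : ℝ) (ht : (m : ℝ) - 1 / 4 ≤ t) (htm : t ≤ m)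
    {f : ℝ[X]} (hf : NN f) (h1 : f.eval 1 = 1) (Q z : ℝ) (hz : 0 ≤ z)
    (hQ : Q = ps m t f + f.coeff 0) (hzV : z * Vf m t f = Q) :
    Q * (z + cm m * z ^ 2) ≤ (m - 1) * (f.eval t - 1) := by
  have key : pr (fun x => (2 * z + 3 * cm m * z ^ 2) * (if x = 0 then 0 else wps m t x)
      - (z ^ 2 + 2 * cm m * z ^ 3) * ((x : ℝ) * wps m t x)) f
      ≤ pr (fun x => ((m : ℝ) - 1) * (t ^ x - (1 : ℝ) ^ x)) f := by
    refine hf.pr_mono fun x => ?_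
    split_ifs with h
    · subst h; simp
    · have := tangent_aux m hm t ht htm z hz x (by omega)
      rw [one_pow]; linarith
  rw [pr_sub_w, pr_smul_w, pr_smul_w, pr_smul_w, pr_sub_w, pr_pow_eq_eval, pr_pow_eq_eval, h1,
    ← Q_eq, ← hQ] at key
  change _ - _ * Vf m t f ≤ _ at key
  have e : (z ^ 2 + 2 * cm m * z ^ 3) * Vf m t f = (z + 2 * cm m * z ^ 2) * Q := by
    rw [← hzV]; ring
  rw [e] at key
  linarith

lemma ps_convex (m : ℕ) (hm : 2 ≤ m) (t κ : ℝ) (ht : 0 ≤ t) (hκ : 0 ≤ κ)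
    {f : ℝ[X]} (hf : NN f) : ps m t f + κ * Vf m t f ≤ ps m (t * (1 + κ)) f := by
  rw [ps, ps, Vf, ← pr_smul_w, ← pr_add_w]
  refine hf.pr_mono fun x => ?_
  rcases Nat.eq_zero_or_pos x with h | h
  · subst h; simp [wps]
  · have hm' : (2 : ℝ) ≤ m := by exact_mod_cast hm
    have hx' : (1 : ℝ) ≤ x := by exact_mod_cast h
    unfold wps
    have h3 : 0 ≤ ((m : ℝ) - 1) * x - 1 := by nlinarith
    have hb : 1 + x * κ ≤ (1 + κ) ^ x := one_add_mul_le_pow (by linarith) x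
    rw [mul_pow]
    have : 0 ≤ (((m : ℝ) - 1) * x - 1) * t ^ x := by positivity
    nlinarith



/-! ### One-step estimates -/

lemma NN.pr_ge_single {f : ℝ[X]} (hf : NN f) {w : ℕ → ℝ} (h : ∀ x, 0 ≤ w x) (x0 : ℕ) :
    f.coeff x0 * w x0 ≤ pr w f := by
  have : pr (fun x => w x0 * (if x = x0 then 1 else 0)) f ≤ pr w f := by
    refine hf.pr_mono fun x => ?_
    split_ifs with hx
    · rw [hx, mul_one]
    · rw [mul_zero]; exact h x
  rwa [pr_smul_w, pr_delta, mul_comm] at this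

lemma NN.coeff_le_eval_one {f : ℝ[X]} (hf : NN f) (x : ℕ) : f.coeff x ≤ f.eval 1 := by
  rw [eval_one_eq_pr]
  simpa using hf.pr_ge_single (w := fun _ => (1 : ℝ)) (fun _ => zero_le_one) x

lemma NN.eval_mono {f : ℝ[X]} (hf : NN f) {s t : ℝ} (hs : 0 ≤ s) (h : s ≤ t) :
    f.eval s ≤ f.eval t := by
  rw [← pr_pow_eq_eval, ← pr_pow_eq_eval]
  exact hf.pr_mono fun x => pow_le_pow_left₀ hs h x

/-- growth factor -/
def lam (m : ℕ) (η t : ℝ) (f : ℝ[X]) : ℝ := (1 + η) * f.eval t ^ (m - 1)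

lemma y_step_basic (m : ℕ) (hm : 2 ≤ m) (c : ℕ) (hc : 1 ≤ c) (t η : ℝ) (ht : 1 ≤ t)
    (htm : t * (1 + η) = m) {f : ℝ[X]} (hf : NN f) :
    lam m η t f * (-ps m t f) - η * f.coeff 0 ^ m ≤ -ps m t (cstep m c f) := by
  have h := ps_cstep_le m hm c hc t ht hf
  rw [← htm] at h
  have e : t * (1 + η) * f.eval t ^ (m - 1) * ps m t f + (t * (1 + η) - t) * f.coeff 0 ^ m
    = t * (lam m η t f * ps m t f + η * f.coeff 0 ^ m) := by unfold lam; ring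
  rw [e] at h
  have := le_of_mul_le_mul_left h (by linarith)
  linarith

lemma one_le_lam (m : ℕ) (hm : 2 ≤ m) (t η : ℝ) (ht : 1 ≤ t) (hη : 0 ≤ η)
    {f : ℝ[X]} (hf : NN f) (h1 : f.eval 1 = 1) :
    1 + ((m : ℝ) - 1) * (f.eval t - 1) ≤ lam m η t f ∧ 1 ≤ lam m η t f := by
  have h2 : 1 ≤ f.eval t := h1 ▸ hf.eval_mono zero_le_one ht
  have h3 := one_add_mul_le_pow (a := f.eval t - 1) (by linarith) (m - 1)
  rw [Nat.cast_sub (by omega)] at h3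
  have h4 : 1 + (f.eval t - 1) = f.eval t := by ring
  rw [h4] at h3
  push_cast at h3
  have hm' : (2 : ℝ) ≤ m := by exact_mod_cast hm
  have h5 : 1 ≤ f.eval t ^ (m - 1) := one_le_pow₀ h2
  unfold lam
  constructor <;> nlinarith

lemma incr_arith (y a V G lm yp κ η θ K c0 ε cc am : ℝ)
    (hη : 0 < η) (hθ0 : 0 ≤ θ) (hθ : θ ≤ 1 / 2) (hθε : θ ≤ ε / 4) (hK : 0 < K) (hc0 : 0 < c0)
    (hKc : 2 * (K * η) ≤ c0) (hKε : 2 * (K * η) ≤ ε / 4) (hε : ε = cc * c0 ^ 3 / (32 * K))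
    (hκ : κ = (1 - θ) * η) (ha : c0 ≤ a) (ha1 : a ≤ 1) (hy : y ≤ K * η) (hcc : 0 < cc)
    (hκV : κ * V ≤ y) (hQV : a - y ≤ V) (hl : 1 + G ≤ lm) (hb : lm * y - η * am ≤ yp)
    (ham : am ≤ a ^ 2)
    (hj : ∀ z, 0 ≤ z → z * V = a - y → (a - y) * (z + cc * z ^ 2) ≤ G) :
    y + η * (ε / 2) ≤ yp := by
  have hκ2 : η / 2 ≤ κ := by rw [hκ]; nlinarith
  obtain ⟨Q, hQ⟩ : ∃ Q, Q = a - y := ⟨_, rfl⟩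
  rw [← hQ] at hQV hj
  have hQ2 : c0 / 2 ≤ Q := by rw [hQ]; linarith
  have hQ0 : 0 < Q := by linarith
  have hV0 : 0 < V := by linarith
  have hκ0 : 0 < κ := by linarith
  have hy0 : 0 < y := lt_of_lt_of_le (mul_pos hκ0 hV0) hκV
  obtain ⟨z, hz0, hzV⟩ : ∃ z, 0 < z ∧ z * V = Q := ⟨Q / V, by positivity, by field_simp⟩
  have hj := hj z hz0.le hzV
  have hA : κ * Q ≤ z * y := by
    calc κ * Q = z * (κ * V) := by rw [← hzV]; ring
      _ ≤ z * y := mul_le_mul_of_nonneg_left hκV hz0.le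
  have hB : η * Q ^ 2 / (4 * K) ≤ z ^ 2 * y := by
    rw [div_le_iff₀ (by positivity)]
    have h2 : (η / 2 * Q) ^ 2 ≤ (z * y) ^ 2 :=
      pow_le_pow_left₀ (by positivity)
        ((mul_le_mul_of_nonneg_right hκ2 hQ0.le).trans hA) 2
    have h3 : (z * y) ^ 2 ≤ z ^ 2 * y * (K * η) := by
      calc (z * y) ^ 2 = z ^ 2 * y * y := by ring
        _ ≤ _ := mul_le_mul_of_nonneg_left hy (by positivity)
    refine le_of_mul_le_mul_left (a := η) ?_ hη
    calc η * (η * Q ^ 2) = 4 * (η / 2 * Q) ^ 2 := by ring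
      _ ≤ 4 * (z ^ 2 * y * (K * η)) := by linarith
      _ = _ := by ring
  have hC : η * ε ≤ cc * Q * (z ^ 2 * y) := by
    have h4 : cc * Q * (η * Q ^ 2 / (4 * K)) ≤ cc * Q * (z ^ 2 * y) :=
      mul_le_mul_of_nonneg_left hB (by positivity)
    refine le_trans ?_ h4
    have h5 : (c0 / 2) ^ 3 ≤ Q ^ 3 := pow_le_pow_left₀ (by positivity) hQ2 3
    have e1 : cc * Q * (η * Q ^ 2 / (4 * K)) = (cc * η / (4 * K)) * Q ^ 3 := by ring
    have e2 : η * ε = (cc * η / (4 * K)) * (c0 / 2) ^ 3 := by rw [hε]; field_simp; ring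
    rw [e1, e2]
    exact mul_le_mul_of_nonneg_left h5 (by positivity)
  have hD : η * a ^ 2 - η * (θ + 2 * y) ≤ κ * Q ^ 2 := by
    have e : κ * Q ^ 2 = η * ((1 - θ) * (a - y) ^ 2) := by rw [hκ, hQ]; ring
    rw [e, ← mul_sub]
    refine mul_le_mul_of_nonneg_left ?_ hη.le
    have h5 : a ^ 2 ≤ 1 := by nlinarith
    have h6 : θ * a ^ 2 ≤ θ := by nlinarith
    have h7 : a * y ≤ y := by nlinarith
    have h8 : 0 ≤ (1 - θ) * y ^ 2 := mul_nonneg (by linarith) (sq_nonneg y)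
    have h9 : 0 ≤ θ * (a * y) := mul_nonneg hθ0 (mul_nonneg (by linarith) hy0.le)
    have e2 : (1 - θ) * (a - y) ^ 2
      = a ^ 2 - θ * a ^ 2 - 2 * (a * y) + 2 * (θ * (a * y)) + (1 - θ) * y ^ 2 := by ring
    rw [e2]; linarith
  have hE : κ * Q ^ 2 + cc * Q * (z ^ 2 * y) ≤ G * y := by
    have h10 := mul_le_mul_of_nonneg_right hj hy0.le
    have h11 : κ * Q ^ 2 ≤ Q * (z * y) := by
      calc κ * Q ^ 2 = Q * (κ * Q) := by ring
        _ ≤ _ := mul_le_mul_of_nonneg_left hA hQ0.le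
    calc _ ≤ Q * (z * y) + cc * Q * (z ^ 2 * y) := by linarith
      _ = Q * (z + cc * z ^ 2) * y := by ring
      _ ≤ _ := h10
  have hF : (1 + G) * y ≤ lm * y := mul_le_mul_of_nonneg_right hl hy0.le
  have hH : η * am ≤ η * a ^ 2 := mul_le_mul_of_nonneg_left ham hη.le
  have hI : η * (θ + 2 * y) ≤ η * (ε / 2) := mul_le_mul_of_nonneg_left (by linarith) hη.le
  have e3 : η * ε = η * (ε / 2) + η * (ε / 2) := by ring
  have e4 : (1 + G) * y = y + G * y := by ring
  linarith

/-- Main one-step increase. -/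
lemma y_step_incr (m : ℕ) (hm : 2 ≤ m) (c : ℕ) (hc : 1 ≤ c) (t η θ K c0 ε : ℝ)
    (ht : (m : ℝ) - 1 / 4 ≤ t) (hη : 0 < η)
    (htm : t * (1 + η) = m) {f : ℝ[X]} (hf : NN f) (h1 : f.eval 1 = 1)
    (hθ0 : 0 ≤ θ) (hθ : θ ≤ 1 / 2) (hθε : θ ≤ ε / 4) (hK : 0 < K) (hc0 : 0 < c0)
    (hKc : 2 * (K * η) ≤ c0) (hKε : 2 * (K * η) ≤ ε / 4) (hε : ε = cm m * c0 ^ 3 / (32 * K))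
    (hs : ps m (t * (1 + (1 - θ) * η)) f ≤ 0) (ha : c0 ≤ f.coeff 0)
    (hy : -ps m t f ≤ K * η) :
    -ps m t f + η * (ε / 2) ≤ -ps m t (cstep m c f) := by
  have hm' : (2 : ℝ) ≤ m := by exact_mod_cast hm
  have ht1 : 1 ≤ t := by linarith
  have htm' : t ≤ m := by nlinarith
  have hb := y_step_basic m hm c hc t η ht1 htm hf
  obtain ⟨hl, -⟩ := one_le_lam m hm t η ht1 hη.le hf h1
  have hconv := ps_convex m hm t ((1 - θ) * η) (by linarith) (by nlinarith) hf
  have hQV := Q_le_V m hm t (by linarith) hf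
  have ha1 : f.coeff 0 ≤ 1 := h1 ▸ hf.coeff_le_eval_one 0
  have hG : f.coeff 0 ^ m ≤ f.coeff 0 ^ 2 := pow_le_pow_of_le_one (by linarith) ha1 hm
  refine incr_arith (-ps m t f) (f.coeff 0) (Vf m t f) (((m : ℝ) - 1) * (f.eval t - 1))
    (lam m η t f) _ ((1 - θ) * η) η θ K c0 ε (cm m) _ hη hθ0 hθ hθε hK hc0 hKc hKε hε rfl ha ha1
    hy (cm_pos m hm) (by linarith) (by linarith) hl hb hG ?_
  intro z hz hzV
  exact jensen m hm t ht htm' hf h1 _ z hz (by ring) hzV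

lemma y_bounds (m : ℕ) (hm : 2 ≤ m) (t κ : ℝ) (ht : 1 ≤ t) (hκ : 0 < κ)
    {f : ℝ[X]} (hf : NN f) (h1 : f.eval 1 = 1)
    (hs : ps m (t * (1 + κ)) f ≤ 0) :
    κ * f.coeff 0 / (1 + κ) ≤ -ps m t f ∧ -ps m t f ≤ 1 := by
  have hconv := ps_convex m hm t κ (by linarith) hκ.le hf
  have hQV := Q_le_V m hm t (by linarith) hf
  have ha1 : f.coeff 0 ≤ 1 := h1 ▸ hf.coeff_le_eval_one 0
  have hQ0 : 0 ≤ ps m t f + f.coeff 0 := by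
    rw [Q_eq]
    refine hf.pr_nonneg fun x => ?_
    split_ifs with h
    · exact le_rfl
    · exact wps_nonneg m hm t (by linarith) x (by omega)
  constructor
  · rw [div_le_iff₀ (by linarith)]; nlinarith
  · linarith

/-- Product bound for an abstract orbit. -/
lemma prod_bound (J : ℕ) (y lm : ℕ → ℝ) (K η ε ymin : ℝ) (hK : 1 < K) (hη : 0 < η) (hε : 0 < ε)
    (hymin : 0 < ymin) (j0 : ℕ) (hj0 : K - 1 ≤ j0 * (ε / 2))
    (hy : ∀ j ≤ J, ymin ≤ y j ∧ y j ≤ 1)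
    (hlm : ∀ j < J, 1 ≤ lm j)
    (hstep : ∀ j < J, lm j * y j - η ≤ y (j + 1))
    (hincr : ∀ j < J, y j ≤ K * η → y j + η * (ε / 2) ≤ y (j + 1)) :
    ∏ j ∈ Finset.range J, lm j ≤
      (1 / ymin) * (1 + η / ymin) ^ j0 * (1 + 1 / (K - 1)) ^ J := by
  have hlow : ∀ j ≤ J, (j : ℝ) * (ε / 2) * η ≤ y j ∨ (K - 1) * η ≤ y j := by
    intro j
    induction j with
    | zero => intro h; left; simp; linarith [(hy 0 h).1]
    | succ j ih =>
      intro h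
      rcases le_or_gt (y j) (K * η) with h1 | h1
      · have := hincr j (by omega) h1
        rcases ih (by omega) with h2 | h2
        · left; push_cast; nlinarith
        · right; nlinarith
      · right
        have := hstep j (by omega)
        have h3 := hlm j (by omega)
        have h4 := (hy j (by omega)).1
        nlinarith
  have hA : 1 ≤ 1 + η / ymin := by have : 0 ≤ η / ymin := by positivity
                                   linarith
  have hB : 1 ≤ 1 + 1 / (K - 1) := by
    have : 0 ≤ 1 / (K - 1) := by
      have : 0 < K - 1 := by linarith
      positivity
    linarith
  have main : ∀ j ≤ J, (∏ i ∈ Finset.range j, lm i) * y 0 ≤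
      y j * ((1 + η / ymin) ^ (min j j0) * (1 + 1 / (K - 1)) ^ j) := by
    intro j
    induction j with
    | zero => intro h; simp
    | succ j ih =>
      intro h
      rw [Finset.prod_range_succ]
      set G := (1 + η / ymin) ^ (min j j0) * (1 + 1 / (K - 1)) ^ j with hG
      have hG0 : 0 < G := by positivity
      have h1 := hstep j (by omega)
      have h3 := hlm j (by omega)
      have h4 := hy (j + 1) h
      have h5 : lm j * y j ≤ y (j + 1) * (1 + η / y (j + 1)) := by
        have : 0 < y (j + 1) := by linarith
        have e : y (j + 1) * (1 + η / y (j + 1)) = y (j + 1) + η := by field_simp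
        rw [e]; linarith
      have hyp : 0 < y (j + 1) := by linarith
      have h6 : (1 + η / y (j + 1)) * G ≤
          (1 + η / ymin) ^ (min (j + 1) j0) * (1 + 1 / (K - 1)) ^ (j + 1) := by
        rcases Nat.lt_or_ge j j0 with hj | hj
        · have e1 : min (j + 1) j0 = min j j0 + 1 := by omega
          rw [e1, pow_succ, pow_succ]
          have h7 : 1 + η / y (j + 1) ≤ 1 + η / ymin := by
            have := div_le_div_of_nonneg_left hη.le hymin h4.1
            linarith
          calc (1 + η / y (j + 1)) * G ≤ (1 + η / ymin) * G :=
                mul_le_mul_of_nonneg_right h7 hG0.le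
            _ ≤ (1 + η / ymin) * G * (1 + 1 / (K - 1)) :=
                le_mul_of_one_le_right (by positivity) hB
            _ = _ := by rw [hG]; ring
        · have e1 : min (j + 1) j0 = min j j0 := by omega
          rw [e1, pow_succ]
          have h7 : (K - 1) * η ≤ y (j + 1) := by
            rcases hlow (j + 1) h with h8 | h8
            · refine le_trans ?_ h8
              refine mul_le_mul_of_nonneg_right (hj0.trans ?_) hη.le
              refine mul_le_mul_of_nonneg_right ?_ (by positivity)
              exact_mod_cast (by omega : j0 ≤ j + 1)
            · exact h8
          have h9 : η / y (j + 1) ≤ 1 / (K - 1) := by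
            rw [div_le_div_iff₀ hyp (by linarith)]; linarith
          calc (1 + η / y (j + 1)) * G ≤ (1 + 1 / (K - 1)) * G :=
                mul_le_mul_of_nonneg_right (by linarith) hG0.le
            _ = _ := by rw [hG]; ring
      calc (∏ i ∈ Finset.range j, lm i) * lm j * y 0
          = ((∏ i ∈ Finset.range j, lm i) * y 0) * lm j := by ring
        _ ≤ (y j * G) * lm j := mul_le_mul_of_nonneg_right (ih (by omega)) (by linarith)
        _ = (lm j * y j) * G := by ring
        _ ≤ (y (j + 1) * (1 + η / y (j + 1))) * G := mul_le_mul_of_nonneg_right h5 hG0.le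
        _ = y (j + 1) * ((1 + η / y (j + 1)) * G) := by ring
        _ ≤ _ := mul_le_mul_of_nonneg_left h6 hyp.le
  have hfin := main J le_rfl
  have hP : 0 ≤ ∏ i ∈ Finset.range J, lm i :=
    Finset.prod_nonneg fun i hi => by linarith [hlm i (Finset.mem_range.mp hi)]
  have h10 : (1 + η / ymin) ^ (min J j0) ≤ (1 + η / ymin) ^ j0 :=
    pow_le_pow_right₀ hA (by omega)
  have h11 : (∏ i ∈ Finset.range J, lm i) * ymin ≤
      (1 + η / ymin) ^ j0 * (1 + 1 / (K - 1)) ^ J := by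
    calc _ ≤ (∏ i ∈ Finset.range J, lm i) * y 0 :=
          mul_le_mul_of_nonneg_left (hy 0 (by omega)).1 hP
      _ ≤ _ := hfin
      _ ≤ 1 * ((1 + η / ymin) ^ (min J j0) * (1 + 1 / (K - 1)) ^ J) :=
          mul_le_mul_of_nonneg_right (hy J le_rfl).2 (by positivity)
      _ = (1 + η / ymin) ^ (min J j0) * (1 + 1 / (K - 1)) ^ J := one_mul _
      _ ≤ _ := mul_le_mul_of_nonneg_right h10 (by positivity)
  rw [mul_assoc, one_div_mul_eq_div, le_div_iff₀ hymin]
  exact h11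

/-! ### Lower bound for the mass at zero -/

lemma coeff_one_pow' (f : ℝ[X]) (m : ℕ) :
    (f ^ m).coeff 1 = m * f.coeff 0 ^ (m - 1) * f.coeff 1 := by
  have h : ∀ g : ℝ[X], g.coeff 1 = g.derivative.eval 0 := by
    intro g; rw [← coeff_zero_eq_eval_zero, coeff_derivative]; simp
  rw [h, h, derivative_pow, coeff_zero_eq_eval_zero]; simp

lemma coeff_zero_cstep (m c : ℕ) (hc : 2 ≤ c) (f : ℝ[X]) :
    (cstep m c f).coeff 0 = f.coeff 0 ^ m + m * f.coeff 0 ^ (m - 1) * f.coeff 1 := by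
  rw [← coeff_one_pow', ← coeff_zero_pow, cstep, coeff_push, ← pr_delta 0 (f ^ m),
    ← pr_delta 1 (f ^ m), ← pr_add_w]
  congr 2; ext x
  rcases Nat.lt_or_ge x 2 with h | h
  · interval_cases x <;> simp
  · have h1 : ¬ min (x - 1) (c - 1) = 0 := by omega
    rw [if_neg h1, if_neg (by omega), if_neg (by omega), add_zero]

lemma a_step (m : ℕ) (hm : 2 ≤ m) (c : ℕ) (hc : 2 ≤ c) (s c0 : ℝ) (hs : 7 / 4 ≤ s)
    {f : ℝ[X]} (hf : NN f) (h1 : f.eval 1 = 1) (hps : ps m s f ≤ 0) (hc0 : c0 ≤ f.coeff 0)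
    (hc8 : c0 ≤ 1 / 8) (hcm : c0 ≤ (1 / 2) ^ m) (hc00 : 0 < c0) :
    c0 ≤ (cstep m c f).coeff 0 := by
  rw [coeff_zero_cstep m c hc]
  have hf1 := hf 1
  have ha1 : f.coeff 0 ≤ 1 := h1 ▸ hf.coeff_le_eval_one 0
  have hQ := Q_eq m s f
  rcases Nat.lt_or_ge 2 m with h | h
  · have hm' : (3 : ℝ) ≤ m := by exact_mod_cast h
    have h2 : pr (fun x => (1 : ℝ) - (if x = 0 then 1 else 0)) f
        ≤ pr (fun x => if x = 0 then 0 else wps m s x) f := by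
      refine hf.pr_mono fun x => ?_
      split_ifs with hx
      · simp
      · have hx' : (1 : ℝ) ≤ x := by exact_mod_cast (by omega : 1 ≤ x)
        have h4 : 1 ≤ s ^ x := one_le_pow₀ (by linarith)
        unfold wps
        have : 1 ≤ ((m : ℝ) - 1) * x - 1 := by nlinarith
        nlinarith
    rw [pr_sub_w, pr_delta, ← eval_one_eq_pr, h1, ← hQ] at h2
    have h3 : 1 / 2 ≤ f.coeff 0 := by linarith
    have h4 : (1 / 2 : ℝ) ^ m ≤ f.coeff 0 ^ m := pow_le_pow_left₀ (by norm_num) h3 m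
    have h5 : 0 ≤ m * f.coeff 0 ^ (m - 1) * f.coeff 1 := by
      have := hf 0
      positivity
    linarith
  · have hm2 : m = 2 := by omega
    subst hm2
    have h2 : pr (fun x => 3 * ((1 : ℝ) - (if x = 0 then 1 else 0) - (if x = 1 then 1 else 0))) f
        ≤ pr (fun x => if x = 0 then 0 else wps 2 s x) f := by
      refine hf.pr_mono fun x => ?_
      rcases Nat.lt_or_ge x 2 with hx | hx
      · interval_cases x
        · simp
        · simp [wps]; norm_num
      · rw [if_neg (by omega), if_neg (by omega), if_neg (by omega)]
        have hx' : (2 : ℝ) ≤ x := by exact_mod_cast hx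
        have h4 : s ^ 2 ≤ s ^ x := pow_le_pow_right₀ (by linarith) hx
        unfold wps
        push_cast
        nlinarith
    rw [pr_smul_w, pr_sub_w, pr_sub_w, pr_delta, pr_delta, ← eval_one_eq_pr, h1, ← hQ] at h2
    have h3 : f.coeff 1 ≥ 1 - 4 / 3 * f.coeff 0 := by linarith
    norm_num
    set a := f.coeff 0
    have h6 : a * (2 - 5 / 3 * a) ≤ a ^ 2 + 2 * a * f.coeff 1 := by nlinarith
    refine le_trans ?_ h6
    rcases le_or_gt a (1 / 2) with h7 | h7 <;> nlinarith

/-- Seed at time zero. -/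
lemma seed_zero (m : ℕ) (hm : 2 ≤ m) {ν : ℕ → ℝ} (hν0 : ν 0 = 0) (hν : ∀ x, 0 ≤ ν x) (n : ℕ)
    (hs1 : ∑ x ∈ Finset.range (n + 1), ν x ≤ 1) {p : ℝ} (hp0 : 0 ≤ p) (hp1 : p ≤ 1)
    (x0 : ℕ) (hx0 : 2 ≤ x0) (hx0n : x0 ≤ n) (s c0 : ℝ) (hs : 1 ≤ s)
    (hc0 : c0 * (2 + ν x0) ≤ ν x0) (ha : (L0 ν n p).coeff 0 < c0) :
    c0 ≤ ps m s (L0 ν n p) := by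
  have hf := NN_L0 hν n hs1 hp0 hp1
  have hQ := Q_eq m s (L0 ν n p)
  have h1 := hf.pr_ge_single (w := fun x => if x = 0 then 0 else wps m s x) (fun x => by
    split_ifs with h
    · exact le_rfl
    · exact wps_nonneg m hm s (by linarith) x (by omega)) x0
  rw [← hQ, coeff_L0 _ _ _ _ hx0n] at h1
  have ha' : (L0 ν n p).coeff 0 = 1 - p := by
    rw [coeff_L0 _ _ _ _ (Nat.zero_le _)]; simp [hν0]
  have hne : x0 ≠ 0 := by omega
  simp only [hne, if_false, mul_zero, zero_add] at h1
  rw [ha'] at ha h1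
  have hm' : (2 : ℝ) ≤ m := by exact_mod_cast hm
  have hw : 1 ≤ wps m s x0 := by
    have hx' : (2 : ℝ) ≤ x0 := by exact_mod_cast hx0
    have h4 : 1 ≤ s ^ x0 := one_le_pow₀ hs
    unfold wps
    have : 1 ≤ ((m : ℝ) - 1) * x0 - 1 := by nlinarith
    nlinarith
  have hv := hν x0
  have : p * ν x0 ≤ p * ν x0 * wps m s x0 := le_mul_of_one_le_right (by positivity) hw
  nlinarith



/-! ### Case A: real orbit estimates -/

/-- Tail mass. -/
def tl (x : ℕ) (f : ℝ[X]) : ℝ := pr (fun y => if x ≤ y then 1 else 0) f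

lemma coeff_le_tl {f : ℝ[X]} (hf : NN f) {x y : ℕ} (h : x ≤ y) : f.coeff y ≤ tl x f := by
  have := hf.pr_ge_single (w := fun y => if x ≤ y then (1 : ℝ) else 0)
    (fun x => by split_ifs <;> norm_num) y
  simpa [h, tl] using this

lemma eval_le_of_coeff {f : ℝ[X]} {t1 t2 B : ℝ} (ht2 : 0 ≤ t2) (h12 : t2 < t1) (hB : 0 ≤ B)
    (h : ∀ x, f.coeff x * t1 ^ x ≤ B) : f.eval t2 ≤ B / (1 - t2 / t1) := by
  have ht1 : 0 < t1 := by linarith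
  have hr0 : 0 ≤ t2 / t1 := by positivity
  have hr1 : t2 / t1 < 1 := (div_lt_one ht1).2 h12
  rw [eval_eq_sum_range, div_eq_mul_inv, ← tsum_geometric_of_lt_one hr0 hr1]
  calc _ ≤ ∑ i ∈ Finset.range (f.natDegree + 1), B * (t2 / t1) ^ i := by
        refine Finset.sum_le_sum fun i _ => ?_
        have e : f.coeff i * t2 ^ i = f.coeff i * t1 ^ i * (t2 / t1) ^ i := by
          rw [div_pow]; field_simp
        rw [e]
        exact mul_le_mul_of_nonneg_right (h i) (by positivity)
    _ = B * ∑ i ∈ Finset.range (f.natDegree + 1), (t2 / t1) ^ i := by rw [Finset.mul_sum]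
    _ ≤ _ := mul_le_mul_of_nonneg_left
        ((summable_geometric_of_lt_one hr0 hr1).sum_le_tsum _ fun i _ => by positivity) hB

/-- Tail bound below `h` transfers to all coefficients. -/
lemma coeff_bound {f : ℝ[X]} (hf : NN f) (h1 : f.eval 1 = 1) (m : ℕ) (B t1 : ℝ)
    (ht1 : 1 ≤ t1) (htm : t1 < m) (hB : (m : ℝ) ≤ B) (h b R : ℕ) (hR : (m : ℝ) ≤ (m / t1) ^ R)
    (hR2 : 2 ≤ R) (hh : R * (b + 1) ≤ h) (hdeg : ∀ x, h + b + 1 < x → f.coeff x = 0)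
    (htl : ∀ x, 2 ≤ x → x ≤ h → tl x f < B / (m : ℝ) ^ x) (x : ℕ) :
    f.coeff x * t1 ^ x ≤ B := by
  have hm0 : (1 : ℝ) < m := by linarith
  have hB0 : 0 ≤ B := by linarith
  rcases Nat.lt_or_ge x 2 with hx | hx
  · have h2 : f.coeff x ≤ 1 := h1 ▸ hf.coeff_le_eval_one x
    have h3 : t1 ^ x ≤ t1 ^ 1 := pow_le_pow_right₀ ht1 (by omega)
    have h4 : 0 ≤ t1 ^ x := by positivity
    nlinarith [hf x]
  rcases le_or_gt x h with hxh | hxh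
  · have h2 : f.coeff x ≤ B / (m : ℝ) ^ x := (coeff_le_tl hf le_rfl).trans (htl x hx hxh).le
    calc f.coeff x * t1 ^ x ≤ B / (m : ℝ) ^ x * (m : ℝ) ^ x :=
          mul_le_mul h2 (pow_le_pow_left₀ (by linarith) htm.le x) (by positivity) (by positivity)
      _ = B := by field_simp
  rcases Nat.lt_or_ge (h + b + 1) x with hx3 | hx3
  · rw [hdeg x hx3, zero_mul]; exact hB0
  · have hh2 : 2 ≤ h := by nlinarith
    have h2 : f.coeff x ≤ B / (m : ℝ) ^ h := (coeff_le_tl hf hxh.le).trans (htl h hh2 le_rfl).le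
    have h3 : t1 ^ x ≤ (m : ℝ) ^ h := by
      calc t1 ^ x ≤ t1 ^ (h + (b + 1)) := pow_le_pow_right₀ ht1 (by omega)
        _ = t1 ^ h * t1 ^ (b + 1) := pow_add _ _ _
        _ ≤ t1 ^ h * (m : ℝ) ^ (b + 1) := by gcongr
        _ ≤ t1 ^ h * ((m / t1) ^ R) ^ (b + 1) := by gcongr
        _ = t1 ^ h * (m / t1) ^ (R * (b + 1)) := by rw [← pow_mul]
        _ ≤ t1 ^ h * (m / t1) ^ h := by
            have : 1 ≤ (m : ℝ) / t1 := (one_le_div (by linarith)).2 htm.le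
            gcongr
        _ = (m : ℝ) ^ h := by rw [div_pow]; field_simp
    calc f.coeff x * t1 ^ x ≤ B / (m : ℝ) ^ h * (m : ℝ) ^ h :=
          mul_le_mul h2 h3 (by positivity) (by positivity)
      _ = B := by field_simp

/-- Sign and mass control along the orbit. -/
lemma orbit_A (m : ℕ) (hm : 2 ≤ m) (f : ℕ → ℝ[X]) (c : ℕ → ℕ) (J kB : ℕ)
    (hstep : ∀ j, f (j + 1) = cstep m (c j) (f j)) (hf : ∀ j, NN (f j))
    (h1 : ∀ j, (f j).eval 1 = 1) (hc : ∀ j ≤ J, 2 ≤ c j)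
    (s q t2 Cq C2 c0 c1 : ℝ) (hs : 7 / 4 ≤ s) (hsm : s < m) (hq0 : 0 ≤ q) (hq1 : q ≤ 1)
    (ht2 : 0 ≤ t2) (hCq : 0 ≤ Cq) (hb : ∀ S : ℕ, m * S * s ^ S ≤ Cq * (q ^ S * t2 ^ S))
    (hC2 : ∀ j ≤ J, (f j).eval t2 ≤ C2)
    (hc00 : 0 < c0) (hc8 : c0 ≤ 1 / 8) (hcm : c0 ≤ (1 / 2) ^ m)
    (hc1 : c1 = (m - s) * c0 ^ m / (2 * m))
    (hE : ∀ j ≤ J, Cq * q ^ c j * C2 ^ m ≤ (m - s) / 2 * c1)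
    (hkB : Cq * C2 < ((m + s) / (2 * s)) ^ kB * c1)
    (hz : (f 0).coeff 0 < c0 → c0 ≤ ps m s (f 0)) :
    ∀ j, j + kB + 1 ≤ J → c0 ≤ (f j).coeff 0 ∧ ps m s (f j) ≤ 0 := by
  have hm' : (2 : ℝ) ≤ m := by exact_mod_cast hm
  have hms : 0 < (m : ℝ) - s := by linarith
  have hc0m : c0 ^ m ≤ c0 := by
    calc c0 ^ m ≤ c0 ^ 1 := pow_le_pow_of_le_one hc00.le (by linarith) (by omega)
      _ = c0 := pow_one _
  have hc0m0 : 0 < c0 ^ m := by positivity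
  have hc1' : c1 ≤ c0 ^ m := by
    rw [hc1, div_le_iff₀ (by linarith)]; nlinarith
  have hc1pos : 0 < c1 := by rw [hc1]; positivity
  have hC20 : ∀ j, 0 ≤ (f j).eval t2 := fun j => by
    rw [← pr_pow_eq_eval]; exact (hf j).pr_nonneg fun x => by positivity
  have hge : ∀ j ≤ J, m * ps m s (f j) * (f j).eval s ^ (m - 1) + (m - s) * (f j).coeff 0 ^ m
      - (m - s) / 2 * c1 ≤ s * ps m s (f (j + 1)) := by
    intro j hj
    have h := ps_cstep_ge m hm (c j) (by have := hc j hj; omega) s (by linarith) q t2 Cq hq0 hq1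
      ht2 hCq hb (hf j)
    rw [hstep]
    have h2 : Cq * q ^ c j * (f j).eval t2 ^ m ≤ Cq * q ^ c j * C2 ^ m := by
      have := hC20 j
      have := hC2 j hj
      gcongr
    have h3 := hE j hj
    have e : m * ps m s (f j) * (f j).eval s ^ (m - 1) = m * (f j).eval s ^ (m - 1) * ps m s (f j)
      := by ring
    rw [e]; linarith
  have hev : ∀ j, 1 ≤ (f j).eval s ^ (m - 1) := fun j => one_le_pow₀
    (by rw [← h1 j]; exact (hf j).eval_mono zero_le_one (by linarith))
  have hps_le : ∀ j ≤ J, ps m s (f j) ≤ Cq * C2 := by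
    intro j hj
    calc ps m s (f j) ≤ pr (fun x => Cq * t2 ^ x) (f j) := by
          refine (hf j).pr_mono fun x => ?_
          have h3 := hb x
          have h4 : q ^ x ≤ 1 := pow_le_one₀ hq0 hq1
          have h5 : Cq * (q ^ x * t2 ^ x) ≤ Cq * t2 ^ x :=
            mul_le_mul_of_nonneg_left (mul_le_of_le_one_left (by positivity) h4) hCq
          refine le_trans ?_ (h3.trans h5)
          unfold wps
          have h6 : 0 ≤ s ^ x := by positivity
          have h7 : (0 : ℝ) ≤ x := Nat.cast_nonneg x
          exact mul_le_mul_of_nonneg_right (by nlinarith) h6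
      _ = Cq * (f j).eval t2 := by rw [pr_smul_w, pr_pow_eq_eval]
      _ ≤ _ := mul_le_mul_of_nonneg_left (hC2 j hj) hCq
  have hρ : 1 ≤ (m + s) / (2 * s) := by rw [le_div_iff₀ (by linarith)]; linarith
  have hgrow : ∀ i, c1 ≤ ps m s (f i) → ∀ k, i + k ≤ J →
      ((m + s) / (2 * s)) ^ k * c1 ≤ ps m s (f (i + k)) := by
    intro i hi k
    induction k with
    | zero => intro _; simpa using hi
    | succ k ih =>
      intro hk
      have h2 := ih (by omega)
      have h3 := hge (i + k) (by omega)
      have h4 : c1 ≤ ps m s (f (i + k)) := le_trans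
        (le_mul_of_one_le_left hc1pos.le (one_le_pow₀ hρ)) h2
      have h5 := hev (i + k)
      have h6 : 0 ≤ (f (i + k)).coeff 0 ^ m := pow_nonneg (hf _ 0) _
      have h7 : (m + s) / 2 * ps m s (f (i + k)) ≤ s * ps m s (f (i + k + 1)) := by
        have h8 : m * ps m s (f (i + k)) ≤ m * ps m s (f (i + k)) * (f (i + k)).eval s ^ (m - 1) :=
          le_mul_of_one_le_right (mul_nonneg (by linarith) (by linarith)) h5
        have h9 : 0 ≤ (m - s) * (f (i + k)).coeff 0 ^ m := mul_nonneg hms.le h6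
        nlinarith
      have h8 : (m + s) / (2 * s) * ps m s (f (i + k)) ≤ ps m s (f (i + k + 1)) := by
        have e : (m + s) / (2 * s) * ps m s (f (i + k)) = ((m + s) / 2 * ps m s (f (i + k))) / s := by
          have : s ≠ 0 := by linarith
          field_simp
        rw [e, div_le_iff₀ (by linarith)]; linarith
      calc ((m + s) / (2 * s)) ^ (k + 1) * c1
          = (m + s) / (2 * s) * (((m + s) / (2 * s)) ^ k * c1) := by ring
        _ ≤ (m + s) / (2 * s) * ps m s (f (i + k)) :=
            mul_le_mul_of_nonneg_left h2 (by linarith)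
        _ ≤ _ := h8
  have hno : ∀ i, i + kB ≤ J → ps m s (f i) < c1 := by
    intro i hi
    by_contra hcon
    push Not at hcon
    have h2 := hgrow i hcon kB hi
    have h3 := hps_le (i + kB) hi
    linarith
  have hneg : ∀ j, j + kB + 1 ≤ J → c0 ≤ (f j).coeff 0 → ps m s (f j) ≤ 0 := by
    intro j hj ha
    by_contra hcon
    push Not at hcon
    have h2 := hno (j + 1) (by omega)
    have h3 := hge j (by omega)
    have h4 : c0 ^ m ≤ (f j).coeff 0 ^ m := pow_le_pow_left₀ hc00.le ha m
    have h5 : 0 ≤ m * ps m s (f j) * (f j).eval s ^ (m - 1) :=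
      mul_nonneg (mul_nonneg (by linarith) hcon.le) (by linarith [hev j])
    have h6 : (m - s) * c0 ^ m ≤ (m - s) * (f j).coeff 0 ^ m :=
      mul_le_mul_of_nonneg_left h4 hms.le
    have h7 : (m - s) / 2 * c1 ≤ (m - s) / 2 * c0 ^ m :=
      mul_le_mul_of_nonneg_left hc1' (by linarith)
    have h8 : (m - s) / 2 * c0 ^ m ≤ s * ps m s (f (j + 1)) := by linarith
    have h9 : s * ps m s (f (j + 1)) < s * c1 := mul_lt_mul_of_pos_left h2 (by linarith)
    have h10 : s * c1 ≤ m * c1 := mul_le_mul_of_nonneg_right hsm.le hc1pos.le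
    have h11 : m * c1 = (m - s) / 2 * c0 ^ m := by
      rw [hc1]
      have : (m : ℝ) ≠ 0 := by linarith
      field_simp
    linarith
  intro j
  induction j with
  | zero =>
    intro hj
    have ha : c0 ≤ (f 0).coeff 0 := by
      by_contra hcon
      push Not at hcon
      have h2 := hz hcon
      have h3 := hno 0 (by omega)
      linarith
    exact ⟨ha, hneg 0 hj ha⟩
  | succ j ih =>
    intro hj
    obtain ⟨h2, h3⟩ := ih (by omega)
    have ha : c0 ≤ (f (j + 1)).coeff 0 := by
      rw [hstep]
      exact a_step m hm (c j) (hc j (by omega)) s c0 hs (hf j) (h1 j) h3 h2 hc8 hcm hc00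
    exact ⟨ha, hneg _ hj ha⟩

lemma exists_bound_mul_pow (r : ℝ) (h0 : 0 ≤ r) (h1 : r < 1) :
    ∃ Cb : ℝ, 0 ≤ Cb ∧ ∀ S : ℕ, (S : ℝ) * r ^ S ≤ Cb := by
  have h := tendsto_self_mul_const_pow_of_lt_one h0 h1
  obtain ⟨Cb, hC⟩ := h.bddAbove_range
  exact ⟨max Cb 0, le_max_right _ _, fun S => (hC ⟨S, rfl⟩).trans (le_max_left _ _)⟩

set_option maxHeartbeats 1000000 in
/-- Case A, real part: product of the growth factors is subexponential. -/
lemma caseA_real (m : ℕ) (hm : 2 ≤ m) {ν : ℕ → ℝ} (hν0 : ν 0 = 0) (hν : ∀ x, 0 ≤ ν x)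
    (hs1 : ∀ n, ∑ x ∈ Finset.range (n + 1), ν x ≤ 1) (x0 : ℕ) (hx0 : 2 ≤ x0) (hv : 0 < ν x0)
    (ω : ℝ) (hω : 1 < ω) (A : ℕ) (hA : 2 ≤ A) (B : ℝ) (hB : (m : ℝ) ≤ B) :
    ∃ (C0 η t : ℝ) (kB A2 n0 : ℕ), 0 < C0 ∧ 0 < η ∧ t * (1 + η) = m ∧ (m : ℝ) - 1 / 4 ≤ t ∧
      t < m ∧ 1 ≤ A2 ∧
      ∀ n ≥ n0, kB + 1 ≤ n - n / A ∧ ∀ p : ℝ, 0 ≤ p → p ≤ 1 →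
        (∀ j ≤ n - n / A, ∀ x, 2 ≤ x → x + j ≤ n - n / A2 →
          tl x (LL m ν n p j) < B / (m : ℝ) ^ x) →
        ∏ j ∈ Finset.range (n - n / A - kB - 1), lam m η t (LL m ν n p j) ≤ C0 * ω ^ n := by
  have hm' : (2 : ℝ) ≤ m := by exact_mod_cast hm
  set v := ν x0 with hvdef
  -- constants
  obtain ⟨K, hK1, hKω⟩ : ∃ K : ℝ, 1 < K ∧ 1 / (K - 1) = ω - 1 := by
    have : 0 < ω - 1 := by linarith
    refine ⟨1 + 1 / (ω - 1), ?_, ?_⟩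
    · have : 0 < 1 / (ω - 1) := by positivity
      linarith
    · rw [add_sub_cancel_left]; simp
  obtain ⟨c0, hc00, hc8, hcm, hcv⟩ : ∃ c0 : ℝ, 0 < c0 ∧ c0 ≤ 1 / 8 ∧ c0 ≤ (1 / 2) ^ m ∧
      c0 * (2 + v) ≤ v := by
    refine ⟨min (min (1 / 8) ((1 / 2) ^ m)) (v / (2 + v)), ?_, ?_, ?_, ?_⟩
    · have : 0 < v / (2 + v) := by positivity
      have : (0 : ℝ) < (1 / 2) ^ m := by positivity
      refine lt_min (lt_min (by norm_num) this) (by assumption)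
    · exact (min_le_left _ _).trans (min_le_left _ _)
    · exact (min_le_left _ _).trans (min_le_right _ _)
    · rw [← le_div_iff₀ (by linarith)]; exact min_le_right _ _
  obtain ⟨ε, hε⟩ : ∃ ε, ε = cm m * c0 ^ 3 / (32 * K) := ⟨_, rfl⟩
  have hK0 : 0 < K := by linarith
  have hε0 : 0 < ε := by
    have := cm_pos m hm
    rw [hε]; positivity
  obtain ⟨η, hη, hη1, hη2, hη3⟩ : ∃ η : ℝ, 0 < η ∧ 2 * (K * η) ≤ c0 ∧ 2 * (K * η) ≤ ε / 4 ∧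
      m * η ≤ 1 / 4 := by
    have hm0 : (0 : ℝ) < m := by linarith
    refine ⟨min (min (c0 / (2 * K)) (ε / (8 * K))) (1 / (4 * m)), ?_, ?_, ?_, ?_⟩
    · refine lt_min (lt_min ?_ ?_) ?_ <;> positivity
    · have h : min (min (c0 / (2 * K)) (ε / (8 * K))) (1 / (4 * m)) ≤ c0 / (2 * K) :=
        (min_le_left _ _).trans (min_le_left _ _)
      rw [le_div_iff₀ (by positivity)] at h
      linarith
    · have h : min (min (c0 / (2 * K)) (ε / (8 * K))) (1 / (4 * m)) ≤ ε / (8 * K) :=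
        (min_le_left _ _).trans (min_le_right _ _)
      rw [le_div_iff₀ (by positivity)] at h
      linarith
    · have h : min (min (c0 / (2 * K)) (ε / (8 * K))) (1 / (4 * m)) ≤ 1 / (4 * (m : ℝ)) :=
        min_le_right _ _
      rw [le_div_iff₀ (by positivity)] at h
      linarith
  obtain ⟨θ, hθ0, hθ2, hθε⟩ : ∃ θ : ℝ, 0 < θ ∧ θ ≤ 1 / 2 ∧ θ ≤ ε / 4 :=
    ⟨min (1 / 2) (ε / 4), lt_min (by norm_num) (by positivity), min_le_left _ _, min_le_right _ _⟩
  obtain ⟨t, ht0, htη⟩ : ∃ t : ℝ, 0 < t ∧ t * (1 + η) = m :=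
    ⟨m / (1 + η), div_pos (by linarith) (by linarith), by field_simp⟩
  have htη0 : 0 < t * η := mul_pos ht0 hη
  have htm : t < m := by linarith
  have htη1 : t * η ≤ m * η := mul_le_mul_of_nonneg_right htm.le hη.le
  have ht4 : (m : ℝ) - 1 / 4 ≤ t := by linarith
  obtain ⟨κ, hκ⟩ : ∃ κ, κ = (1 - θ) * η := ⟨_, rfl⟩
  have hκ0 : 0 < κ := by rw [hκ]; exact mul_pos (by linarith) hη
  have hκη : κ < η := by rw [hκ]; linarith [mul_pos hθ0 hη]
  obtain ⟨s, hs⟩ : ∃ s, s = t * (1 + κ) := ⟨_, rfl⟩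
  have hst : t < s := by rw [hs]; linarith [mul_pos ht0 hκ0]
  have hsm : s < m := by rw [hs, ← htη]; linarith [mul_lt_mul_of_pos_left hκη ht0]
  have hs74 : 7 / 4 ≤ s := by linarith
  obtain ⟨t2, hst2, ht2m⟩ : ∃ t2, s < t2 ∧ t2 < m := exists_between hsm
  obtain ⟨t1, ht21, ht1m⟩ : ∃ t1, t2 < t1 ∧ t1 < m := exists_between ht2m
  obtain ⟨s', hss', hs't2⟩ : ∃ s', s < s' ∧ s' < t2 := exists_between hst2
  obtain ⟨q, hq⟩ : ∃ q, q = s' / t2 := ⟨_, rfl⟩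
  have hq0 : 0 < q := by rw [hq]; exact div_pos (by linarith) (by linarith)
  have hq1 : q < 1 := by rw [hq]; exact (div_lt_one (by linarith)).2 hs't2
  obtain ⟨Cb, hCb0, hCb⟩ := exists_bound_mul_pow (s / s') (by
    apply div_nonneg <;> linarith) ((div_lt_one (by linarith)).2 hss')
  obtain ⟨Cq, hCqd⟩ : ∃ Cq, Cq = m * Cb := ⟨_, rfl⟩
  have hCq : 0 ≤ Cq := by rw [hCqd]; positivity
  have hb : ∀ S : ℕ, m * S * s ^ S ≤ Cq * (q ^ S * t2 ^ S) := by
    intro S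
    have e : q ^ S * t2 ^ S = s' ^ S := by
      rw [← mul_pow, hq, div_mul_cancel₀ _ (by linarith)]
    rw [e, hCqd]
    have h := hCb S
    have hs'0 : 0 < s' ^ S := by
      have : 0 < s' := by linarith
      positivity
    rw [div_pow, mul_div_assoc', div_le_iff₀ hs'0] at h
    have h2 := mul_le_mul_of_nonneg_left h (by linarith : (0 : ℝ) ≤ m)
    linarith
  obtain ⟨C2, hC2⟩ : ∃ C2, C2 = B / (1 - t2 / t1) := ⟨_, rfl⟩
  have hr1 : t2 / t1 < 1 := (div_lt_one (by linarith)).2 ht21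
  have hC20 : 0 < C2 := by rw [hC2]; exact div_pos (by linarith) (by linarith)
  obtain ⟨c1, hc1⟩ : ∃ c1, c1 = (m - s) * c0 ^ m / (2 * m) := ⟨_, rfl⟩
  have hc1pos : 0 < c1 := by
    have : 0 < (m : ℝ) - s := by linarith
    rw [hc1]; positivity
  obtain ⟨kB, hkB⟩ : ∃ kB : ℕ, Cq * C2 < ((m + s) / (2 * s)) ^ kB * c1 := by
    obtain ⟨k, hk⟩ := pow_unbounded_of_one_lt (Cq * C2 / c1)
      (show 1 < (m + s) / (2 * s) by rw [lt_div_iff₀ (by linarith)]; linarith)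
    exact ⟨k, by rwa [div_lt_iff₀ hc1pos] at hk⟩
  obtain ⟨NE, hNE⟩ : ∃ NE : ℕ, Cq * q ^ NE * C2 ^ m ≤ (m - s) / 2 * c1 := by
    have hpos : 0 < (m - s) / 2 * c1 / (Cq * C2 ^ m + 1) := by
      have : 0 < (m : ℝ) - s := by linarith
      positivity
    obtain ⟨k, hk⟩ := exists_pow_lt_of_lt_one hpos hq1
    refine ⟨k, ?_⟩
    rw [lt_div_iff₀ (by positivity)] at hk
    have : 0 ≤ q ^ k := by positivity
    linarith
  obtain ⟨R, hR2, hR⟩ : ∃ R : ℕ, 2 ≤ R ∧ (m : ℝ) ≤ (m / t1) ^ R := by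
    have h1 : 1 < (m : ℝ) / t1 := (one_lt_div (by linarith)).2 ht1m
    obtain ⟨k, hk⟩ := pow_unbounded_of_one_lt (m : ℝ) h1
    exact ⟨k + 2, by omega, hk.le.trans (pow_le_pow_right₀ h1.le (by omega))⟩
  obtain ⟨j0, hj0⟩ : ∃ j0 : ℕ, K - 1 ≤ j0 * (ε / 2) := by
    obtain ⟨k, hk⟩ := exists_nat_ge ((K - 1) / (ε / 2))
    exact ⟨k, by rwa [div_le_iff₀ (by positivity)] at hk⟩
  obtain ⟨ymin, hymin⟩ : ∃ y, y = κ * c0 / (1 + κ) := ⟨_, rfl⟩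
  have hymin0 : 0 < ymin := by rw [hymin]; positivity
  refine ⟨(1 / ymin) * (1 + η / ymin) ^ j0, η, t, kB, A * (2 * (R + 1)),
    A * (2 * (NE + 2 * R + kB + 2)) + x0, by positivity, hη, htη, ht4, htm,
    Nat.mul_pos (by omega) (by omega), ?_⟩
  intro n hn
  have hnA : 2 * (NE + 2 * R + kB + 2) ≤ n / A := by
    rw [Nat.le_div_iff_mul_le (by omega), mul_comm]; omega
  have hnA2 : n / (A * (2 * (R + 1))) = n / A / (2 * (R + 1)) := by rw [Nat.div_div_eq_div_mul]
  obtain ⟨b, hbd⟩ : ∃ b, b = n / (A * (2 * (R + 1))) := ⟨_, rfl⟩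
  have hb2 : b * (2 * (R + 1)) ≤ n / A := by
    rw [hbd, hnA2]; exact Nat.div_mul_le_self _ _
  have hnAn : n / A ≤ n := Nat.div_le_self _ _
  have hn2 : n / A ≤ n / 2 := Nat.div_le_div_left hA (by norm_num)
  refine ⟨by omega, ?_⟩
  intro p hp0 hp1 htl
  rw [← hbd] at htl
  have hNN : ∀ j, NN (LL m ν n p j) := NN_LL m hν n (hs1 n) hp0 hp1
  have h1 : ∀ j, (LL m ν n p j).eval 1 = 1 := eval_one_LL m ν n p
  have hbR : R * (b + 1) + b ≤ n / A := by
    have e1 : b * (2 * (R + 1)) = 2 * (b * (R + 1)) := by ring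
    have e2 : R * (b + 1) + b = b * (R + 1) + R := by ring
    rw [e1] at hb2
    rw [e2]
    omega
  have hev : ∀ j ≤ n - n / A, (LL m ν n p j).eval t2 ≤ C2 := by
    intro j hj
    rw [hC2]
    refine eval_le_of_coeff (by linarith) ht21 (by linarith) fun x => ?_
    refine coeff_bound (hNN j) (h1 j) m B t1 (by linarith) ht1m hB (n - b - j) b R hR hR2
      (by omega) ?_ ?_ x
    · intro x hx
      exact coeff_LL_of_gt m ν n p j (by omega) x (by omega)
    · intro x hx hxh
      exact htl j hj x hx (by omega)
  have horb := orbit_A m hm (LL m ν n p) (fun j => n + 1 - j) (n - n / A) kB (fun j => rfl) hNN h1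
    (fun j hj => by omega) s q t2 Cq C2 c0 c1 hs74 hsm hq0.le hq1.le (by linarith) hCq hb hev hc00
    hc8 hcm hc1 (fun j hj => by
      refine le_trans ?_ hNE
      have : q ^ (n + 1 - j) ≤ q ^ NE := pow_le_pow_of_le_one hq0.le hq1.le (by omega)
      gcongr) hkB
    (fun ha => seed_zero m hm hν0 hν n (hs1 n) hp0 hp1 x0 hx0 (by omega) s c0 (by linarith) hcv ha)
  have hpb := prod_bound (n - n / A - kB - 1) (fun j => -ps m t (LL m ν n p j))
    (fun j => lam m η t (LL m ν n p j)) K η ε ymin hK1 hη hε0 hymin0 j0 hj0 ?_ ?_ ?_ ?_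
  · refine hpb.trans ?_
    refine mul_le_mul_of_nonneg_left ?_ (by positivity)
    rw [hKω, add_sub_cancel]
    exact pow_le_pow_right₀ hω.le (by omega)
  · intro j hj
    obtain ⟨h2, h3⟩ := horb j (by omega)
    rw [hs] at h3
    obtain ⟨h4, h5⟩ := y_bounds m hm t κ (by linarith) hκ0 (hNN j) (h1 j) h3
    refine ⟨le_trans ?_ h4, h5⟩
    rw [hymin]
    gcongr
  · intro j hj
    exact (one_le_lam m hm t η (by linarith) hη.le (hNN j) (h1 j)).2
  · intro j hj
    have h2 := y_step_basic m hm (n + 1 - j) (by omega) t η (by linarith) htη (hNN j)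
    have h3 : (LL m ν n p j).coeff 0 ^ m ≤ 1 :=
      pow_le_one₀ (hNN j 0) (h1 j ▸ (hNN j).coeff_le_eval_one 0)
    have h4 : η * (LL m ν n p j).coeff 0 ^ m ≤ η := mul_le_of_le_one_right hη.le h3
    change _ ≤ -ps m t (cstep m (n + 1 - j) (LL m ν n p j))
    linarith
  · intro j hj hyK
    obtain ⟨h2, h3⟩ := horb j (by omega)
    rw [hs, hκ] at h3
    exact y_step_incr m hm (n + 1 - j) (by omega) t η θ K c0 ε ht4 hη htη (hNN j) (h1 j) hθ0.le
      hθ2 hθε hK0 hc00 hη1 hη2 hε h3 h2 hyK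



/-! ### Case A: complex perturbation -/

/-- Weight `t^x` on `x ≥ 1`. -/
def wD (t : ℝ) (x : ℕ) : ℝ := if x = 0 then 0 else t ^ x

lemma wD_nonneg {t : ℝ} (ht : 0 ≤ t) (x : ℕ) : 0 ≤ wD t x := by
  unfold wD; split_ifs <;> positivity

lemma pr_wD (t : ℝ) (f : ℝ[X]) : pr (wD t) f = f.eval t - f.coeff 0 := by
  rw [← pr_pow_eq_eval, ← pr_delta 0 f, ← pr_sub_w]
  congr 2; ext x
  by_cases h : x = 0 <;> simp [wD, h]

/-- Size of the perturbation. -/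
def Dd (t : ℝ) (d : ℂ[X]) : ℝ := pr (wD t) (absP d)

lemma Dd_nonneg {t : ℝ} (ht : 0 ≤ t) (d : ℂ[X]) : 0 ≤ Dd t d :=
  (NN_absP d).pr_nonneg (wD_nonneg ht)

lemma norm_coeff_zero_le {t : ℝ} (ht : 1 ≤ t) (d : ℂ[X]) (hd : d.eval 1 = 0) :
    ‖d.coeff 0‖ ≤ Dd t d := by
  have h : pr (fun x => if x = 0 then (0 : ℂ) else 1) d = - d.coeff 0 := by
    rw [← pr_delta 0 d]
    have e : (fun x : ℕ => if x = 0 then (0 : ℂ) else 1)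
      = fun x => (1 : ℂ) - (if x = 0 then 1 else 0) := by
      ext x; split_ifs <;> simp
    rw [e, pr_sub_w, ← eval_one_eq_pr, hd, zero_sub]
  rw [← norm_neg, ← h]
  refine (dom_absP d).norm_pr_le fun x => ?_
  unfold wD
  split_ifs
  · simp
  · simpa using one_le_pow₀ ht

lemma wD_shift {t : ℝ} (ht : 1 ≤ t) (c S : ℕ) :
    wD t (min (S - 1) (c - 1)) ≤ (1 / t) * wD t S := by
  rcases Nat.eq_zero_or_pos S with h | h
  · subst h; simp [wD]
  · obtain ⟨k, rfl⟩ : ∃ k, S = k + 1 := ⟨S - 1, by omega⟩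
    have e : (1 / t) * wD t (k + 1) = t ^ k := by
      unfold wD; rw [if_neg (by omega), pow_succ]
      have : t ≠ 0 := by linarith
      field_simp
    rw [e]
    unfold wD
    split_ifs
    · positivity
    · exact pow_le_pow_right₀ ht (by omega)

lemma pow_sub_pow_le (F u : ℝ) (hF : 0 ≤ F) (hu : 0 ≤ u) (m : ℕ) :
    (F + u) ^ m - F ^ m ≤ m * u * (F + u) ^ (m - 1) := by
  induction m with
  | zero => simp
  | succ k ih =>
    have h1 : (F + u) ^ (k + 1) - F ^ (k + 1) = ((F + u) ^ k - F ^ k) * F + (F + u) ^ k * u := by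
      ring
    rw [h1]
    simp only [Nat.add_sub_cancel]
    rcases Nat.eq_zero_or_pos k with h | h
    · subst h; simp
    · obtain ⟨l, rfl⟩ : ∃ l, k = l + 1 := ⟨k - 1, by omega⟩
      simp only [Nat.add_sub_cancel] at ih
      have h2 : ((F + u) ^ (l + 1) - F ^ (l + 1)) * F ≤ ((l + 1 : ℕ) : ℝ) * u * (F + u) ^ (l + 1) := by
        calc _ ≤ (((l + 1 : ℕ) : ℝ) * u * (F + u) ^ l) * F := mul_le_mul_of_nonneg_right ih hF
          _ ≤ (((l + 1 : ℕ) : ℝ) * u * (F + u) ^ l) * (F + u) := by gcongr; linarith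
          _ = _ := by ring
      push_cast at h2 ⊢
      linarith

lemma le_pow_sub_pow (a d : ℝ) (ha : 0 ≤ a) (hd : 0 ≤ d) (m : ℕ) :
    m * d * a ^ (m - 1) ≤ (a + d) ^ m - a ^ m := by
  induction m with
  | zero => simp
  | succ k ih =>
    have h1 : (a + d) ^ (k + 1) - a ^ (k + 1) = ((a + d) ^ k - a ^ k) * (a + d) + a ^ k * d := by
      ring
    rw [h1]
    simp only [Nat.add_sub_cancel]
    rcases Nat.eq_zero_or_pos k with h | h
    · subst h; simp
    · obtain ⟨l, rfl⟩ : ∃ l, k = l + 1 := ⟨k - 1, by omega⟩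
      simp only [Nat.add_sub_cancel] at ih
      have h0 : 0 ≤ (a + d) ^ (l + 1) - a ^ (l + 1) := le_trans (by positivity) ih
      have h2 : ((l + 1 : ℕ) : ℝ) * d * a ^ (l + 1) ≤ ((a + d) ^ (l + 1) - a ^ (l + 1)) * (a + d) := by
        calc _ = (((l + 1 : ℕ) : ℝ) * d * a ^ l) * a := by ring
          _ ≤ ((a + d) ^ (l + 1) - a ^ (l + 1)) * a := mul_le_mul_of_nonneg_right ih ha
          _ ≤ _ := mul_le_mul_of_nonneg_left (by linarith) h0
      push_cast at h2 ⊢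
      linarith

lemma coeff_zero_add_pow (f e : ℝ[X]) (m : ℕ) :
    ((f + e) ^ m - f ^ m).coeff 0 = (f.coeff 0 + e.coeff 0) ^ m - f.coeff 0 ^ m := by
  rw [coeff_sub, coeff_zero_pow, coeff_zero_pow, coeff_add]

lemma D_step (m : ℕ) (hm : 2 ≤ m) (c : ℕ) (t η : ℝ) (ht : 3 / 2 ≤ t) (hη : 0 ≤ η)
    (htm : t * (1 + η) = m) {f : ℝ[X]} (hf : NN f) (h1 : f.eval 1 = 1) (d : ℂ[X])
    (hd : d.eval 1 = 0) :
    Dd t (cstep m c (f.map Complex.ofRealHom + d) - (cstep m c f).map Complex.ofRealHom) ≤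
      lam m η t f ^ 4 * (1 + 2 * Dd t d) ^ (4 * m) * Dd t d := by
  have ht1 : 1 ≤ t := by linarith
  have hm' : (2 : ℝ) ≤ m := by exact_mod_cast hm
  have hD0 := Dd_nonneg (by linarith : 0 ≤ t) d
  have hdD := norm_coeff_zero_le ht1 d hd
  have hNN : NN ((f + absP d) ^ m - f ^ m) := ((dom_map hf).pow_sub_pow (dom_absP d) m).nn
  have hstep : Dd t (cstep m c (f.map Complex.ofRealHom + d) - (cstep m c f).map Complex.ofRealHom)
      ≤ (1 / t) * pr (wD t) ((f + absP d) ^ m - f ^ m) := by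
    refine (absP_cstep_sub_pr_le m c hf d (wD_nonneg (by linarith))).trans ?_
    rw [← pr_smul_w]
    exact hNN.pr_mono fun S => wD_shift ht1 c S
  rw [pr_wD, coeff_zero_add_pow, coeff_absP] at hstep
  have hee : (absP d).eval t = ‖d.coeff 0‖ + Dd t d := by
    rw [Dd, pr_wD, coeff_absP]; ring
  simp only [eval_sub, eval_pow, eval_add, hee] at hstep
  refine hstep.trans ?_
  have hF1 : 1 ≤ f.eval t := h1 ▸ hf.eval_mono zero_le_one ht1
  have ha0 := hf 0
  have ha1 : f.coeff 0 ≤ 1 := h1 ▸ hf.coeff_le_eval_one 0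
  have hga : 1 - f.coeff 0 ≤ 2 * (f.eval t - 1) := by
    have h : pr (fun x => (1 : ℝ) ^ x - (if x = 0 then 1 else 0)) f
        ≤ pr (fun x => 2 * (t ^ x - 1 ^ x)) f := by
      refine hf.pr_mono fun x => ?_
      rw [one_pow]
      split_ifs with hx
      · subst hx; simp
      · have : t ^ 1 ≤ t ^ x := pow_le_pow_right₀ ht1 (by omega)
        linarith
    rwa [pr_smul_w, pr_sub_w, pr_sub_w, pr_delta, pr_pow_eq_eval, pr_pow_eq_eval, h1] at h
  set a := f.coeff 0
  set D := Dd t d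
  set dd := ‖d.coeff 0‖
  set F0 := f.eval t with hF0
  have hdd : 0 ≤ dd := norm_nonneg _
  have hA := pow_sub_pow_le F0 (dd + D) (by linarith) (by linarith) m
  have hB := le_pow_sub_pow a dd ha0 hdd m
  set G := (F0 + 2 * D) ^ (m - 1) with hG
  have hG1 : (F0 + (dd + D)) ^ (m - 1) ≤ G := pow_le_pow_left₀ (by linarith) (by linarith) _
  have hmc : ((m - 1 : ℕ) : ℝ) = m - 1 := by rw [Nat.cast_sub (by omega)]; simp
  have hG2 : 1 + ((m : ℝ) - 1) * (F0 - 1) ≤ G := by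
    have h3 := one_add_mul_le_pow (a := F0 - 1) (by linarith) (m - 1)
    rw [hmc, add_sub_cancel] at h3
    exact h3.trans (pow_le_pow_left₀ (by linarith) (by linarith) _)
  have hG3 : 1 - ((m : ℝ) - 1) * (1 - a) ≤ a ^ (m - 1) := by
    have h3 := one_add_mul_le_pow (a := a - 1) (by linarith) (m - 1)
    rw [hmc, add_sub_cancel] at h3
    linarith
  have hG4 : a ^ (m - 1) ≤ G := pow_le_pow_left₀ ha0 (by linarith) _
  have hG5 : 3 - 2 * G ≤ a ^ (m - 1) := by
    have : ((m : ℝ) - 1) * (1 - a) ≤ ((m : ℝ) - 1) * (2 * (F0 - 1)) :=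
      mul_le_mul_of_nonneg_left hga (by linarith)
    linarith
  have hGone : 1 ≤ G := one_le_pow₀ (by linarith)
  have hC : (F0 + (dd + D)) ^ m - F0 ^ m - ((a + dd) ^ m - a ^ m) ≤ m * (D * (4 * G - 3)) := by
    have h2 : m * (dd + D) * (F0 + (dd + D)) ^ (m - 1) ≤ m * (dd + D) * G :=
      mul_le_mul_of_nonneg_left hG1 (by positivity)
    have h3 : dd * (G - a ^ (m - 1)) ≤ D * (G - a ^ (m - 1)) :=
      mul_le_mul_of_nonneg_right hdD (by linarith)
    have h4 : D * (2 * G - a ^ (m - 1)) ≤ D * (4 * G - 3) :=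
      mul_le_mul_of_nonneg_left (by linarith) hD0
    have h5 : m * ((dd + D) * G - dd * a ^ (m - 1)) ≤ m * (D * (4 * G - 3)) :=
      mul_le_mul_of_nonneg_left (by linarith) (by linarith)
    linarith
  have hD : 4 * G - 3 ≤ G ^ 4 := by
    have h3 := one_add_mul_le_pow (a := G - 1) (by linarith) 4
    rw [add_sub_cancel] at h3
    push_cast at h3
    linarith
  have hE : G ≤ F0 ^ (m - 1) * (1 + 2 * D) ^ m := by
    calc G ≤ (F0 * (1 + 2 * D)) ^ (m - 1) := by
          refine pow_le_pow_left₀ (by linarith) ?_ _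
          nlinarith
      _ = F0 ^ (m - 1) * (1 + 2 * D) ^ (m - 1) := mul_pow _ _ _
      _ ≤ _ := by
          refine mul_le_mul_of_nonneg_left ?_ (by positivity)
          exact pow_le_pow_right₀ (by linarith) (by omega)
  have ht0 : 0 < t := by linarith
  have hη4 : 1 + η ≤ (1 + η) ^ 4 := le_self_pow₀ (by linarith) (by norm_num)
  calc (1 / t) * ((F0 + (dd + D)) ^ m - F0 ^ m - ((a + dd) ^ m - a ^ m))
      ≤ (1 / t) * (m * (D * G ^ 4)) := by
        refine mul_le_mul_of_nonneg_left (hC.trans ?_) (by positivity)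
        refine mul_le_mul_of_nonneg_left ?_ (by positivity)
        exact mul_le_mul_of_nonneg_left hD hD0
    _ = (1 + η) * (D * G ^ 4) := by rw [← htm]; field_simp
    _ ≤ (1 + η) ^ 4 * (D * (F0 ^ (m - 1) * (1 + 2 * D) ^ m) ^ 4) := by gcongr
    _ = _ := by rw [lam, ← hF0]; ring

/-- Bootstrap for the perturbation recursion. -/
lemma bootstrap (J n m : ℕ) (hJ : J ≤ n) (D l : ℕ → ℝ) (hD : ∀ j, 0 ≤ D j) (hl : ∀ j, 1 ≤ l j)
    (hstep : ∀ j, D (j + 1) ≤ l j ^ 4 * (1 + 2 * D j) ^ (4 * m) * D j)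
    (P : ℝ) (hP : ∏ j ∈ Finset.range J, l j ≤ P)
    (hsmall : D 0 * (Real.exp (8 * m) * P ^ 4) * (n + 1) ≤ 1) :
    D J ≤ D 0 * (Real.exp (8 * m) * P ^ 4) := by
  have hn : (0 : ℝ) < n + 1 := by positivity
  have hprodpos : ∀ j, 0 ≤ ∏ i ∈ Finset.range j, l i := fun j =>
    Finset.prod_nonneg fun i _ => by linarith [hl i]
  have hle : ∀ j ≤ J, ∏ i ∈ Finset.range j, l i ≤ P := fun j hj => by
    refine le_trans ?_ hP
    induction J, hj using Nat.le_induction with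
    | base => exact le_rfl
    | succ J hj ih =>
      refine (ih (by omega) ?_).trans ?_
      · refine le_trans ?_ hP
        rw [Finset.prod_range_succ]
        exact le_mul_of_one_le_right (hprodpos J) (hl J)
      · rw [Finset.prod_range_succ]
        exact le_mul_of_one_le_right (hprodpos J) (hl J)
  have main : ∀ j ≤ J, D j ≤
      D 0 * (Real.exp (8 * m * (j / (n + 1))) * (∏ i ∈ Finset.range j, l i) ^ 4) := by
    intro j
    induction j with
    | zero => intro _; simp
    | succ j ih =>
      intro hj
      have h1 := ih (by omega)
      have h2 : D j ≤ D 0 * (Real.exp (8 * m) * P ^ 4) := by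
        refine h1.trans ?_
        have : (j : ℝ) / (n + 1) ≤ 1 := by
          rw [div_le_one hn]
          have : (j : ℝ) ≤ n := by exact_mod_cast (by omega : j ≤ n)
          linarith
        have h3 : 8 * (m : ℝ) * (j / (n + 1)) ≤ 8 * m := by
          have : (0 : ℝ) ≤ 8 * m := by positivity
          nlinarith
        have h4 := hle j (by omega)
        have h5 := hprodpos j
        have h6 := hD 0
        gcongr
      have h3 : D j * (n + 1) ≤ 1 := le_trans (mul_le_mul_of_nonneg_right h2 hn.le) hsmall
      have h4 : D j ≤ 1 / (n + 1) := by rwa [le_div_iff₀ hn]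
      have h5 : (1 + 2 * D j) ^ (4 * m) ≤ Real.exp (8 * m * (1 / (n + 1))) := by
        have h6 : 1 + 2 * D j ≤ Real.exp (2 * D j) := by
          linarith [Real.add_one_le_exp (2 * D j)]
        calc (1 + 2 * D j) ^ (4 * m) ≤ (Real.exp (2 * D j)) ^ (4 * m) :=
              pow_le_pow_left₀ (by linarith [hD j]) h6 _
          _ = Real.exp (8 * m * D j) := by
              rw [← Real.exp_nat_mul]; congr 1; push_cast; ring
          _ ≤ _ := by
              apply Real.exp_le_exp.2
              have : (0 : ℝ) ≤ 8 * m := by positivity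
              exact mul_le_mul_of_nonneg_left h4 this
      have h7 : 0 ≤ l j := by linarith [hl j]
      calc D (j + 1) ≤ l j ^ 4 * (1 + 2 * D j) ^ (4 * m) * D j := hstep j
        _ ≤ l j ^ 4 * Real.exp (8 * m * (1 / (n + 1))) *
            (D 0 * (Real.exp (8 * m * (j / (n + 1))) * (∏ i ∈ Finset.range j, l i) ^ 4)) := by
            have := hD j
            gcongr
        _ = D 0 * ((Real.exp (8 * m * (j / (n + 1))) * Real.exp (8 * m * (1 / (n + 1))))
              * ((∏ i ∈ Finset.range j, l i) * l j) ^ 4) := by ring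
        _ = _ := by
            rw [← Real.exp_add, Finset.prod_range_succ]
            congr 3
            congr 1
            push_cast; ring
  refine (main J le_rfl).trans ?_
  have h3 : 8 * (m : ℝ) * (J / (n + 1)) ≤ 8 * m := by
    have : (J : ℝ) / (n + 1) ≤ 1 := by
      rw [div_le_one hn]
      have : (J : ℝ) ≤ n := by exact_mod_cast hJ
      linarith
    have : (0 : ℝ) ≤ 8 * m := by positivity
    nlinarith
  have h5 := hprodpos J
  have h6 := hD 0
  gcongr

lemma absP_LL_eval_one (m : ℕ) (u : ℕ → ℂ) (n : ℕ) (z : ℂ) (j k : ℕ) :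
    (absP (LL m u n z (j + k))).eval 1 ≤ ((absP (LL m u n z j)).eval 1) ^ (m ^ k) := by
  induction k with
  | zero => simp
  | succ k ih =>
    have h := absP_cstep_eval_one m (n + 1 - (j + k)) (LL m u n z (j + k))
    have h0 : 0 ≤ (absP (LL m u n z (j + k))).eval 1 := by
      rw [eval_one_eq_pr]; exact (NN_absP _).pr_nonneg fun _ => zero_le_one
    refine h.trans ((pow_le_pow_left₀ h0 ih m).trans ?_)
    rw [← pow_mul, pow_succ]

/-- Complexified mass function. -/
def cν (ν : ℕ → ℝ) : ℕ → ℂ := fun x => (ν x : ℂ)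

lemma LL_map (m : ℕ) (ν : ℕ → ℝ) (n : ℕ) (p : ℝ) (j : ℕ) :
    (LL m ν n p j).map Complex.ofRealHom = LL m (cν ν) n (p : ℂ) j := by
  rw [map_LL]; rfl

/-- Perturbation polynomial. -/
def dl (m : ℕ) (ν : ℕ → ℝ) (n : ℕ) (p : ℝ) (z : ℂ) (j : ℕ) : ℂ[X] :=
  LL m (cν ν) n z j - (LL m ν n p j).map Complex.ofRealHom

lemma dl_eval_one (m : ℕ) (ν : ℕ → ℝ) (n : ℕ) (p : ℝ) (z : ℂ) (j : ℕ) :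
    (dl m ν n p z j).eval 1 = 0 := by
  rw [dl, LL_map, eval_sub, eval_one_LL, eval_one_LL, sub_self]

lemma dl_succ (m : ℕ) (ν : ℕ → ℝ) (n : ℕ) (p : ℝ) (z : ℂ) (j : ℕ) :
    dl m ν n p z (j + 1) = cstep m (n + 1 - j) ((LL m ν n p j).map Complex.ofRealHom
      + dl m ν n p z j) - (cstep m (n + 1 - j) (LL m ν n p j)).map Complex.ofRealHom := by
  simp only [dl, LL, add_sub_cancel]

lemma dl_zero_dom (m : ℕ) {ν : ℕ → ℝ} (hν : ∀ x, 0 ≤ ν x) (n : ℕ)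
    (hs1 : ∑ x ∈ Finset.range (n + 1), ν x ≤ 1) (p : ℝ) (z : ℂ) :
    Dom (dl m ν n p z 0) (C ‖z - p‖ * ((∑ x ∈ Finset.range (n + 1), monomial x (ν x)
    + monomial (n + 1) (1 - ∑ x ∈ Finset.range (n + 1), ν x)) + 1)) := by
  set N : ℝ[X] := ∑ x ∈ Finset.range (n + 1), monomial x (ν x)
    + monomial (n + 1) (1 - ∑ x ∈ Finset.range (n + 1), ν x) with hN
  have hNN : NN N := (NN_sum _ _ fun i _ => NN_monomial i (hν i)).add
    (NN_monomial _ (by linarith))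
  have e : dl m ν n p z 0 = C (z - p) * (N.map Complex.ofRealHom + (-1)) := by
    rw [dl, LL_map]
    simp only [LL, L0, hN, Polynomial.map_add, Polynomial.map_sum, map_monomial, cν]
    simp only [C_sub, Complex.ofRealHom_eq_coe, Complex.ofReal_sub, Complex.ofReal_sum,
      Complex.ofReal_one]
    ring
  rw [e]
  refine Dom.mul ?_ ((dom_map hNN).add ?_)
  · intro x; rw [coeff_C, coeff_C]; split_ifs <;> simp
  · intro x; rw [coeff_neg, norm_neg]; exact Dom_one x

lemma Dd_zero_le (m : ℕ) {ν : ℕ → ℝ} (hν : ∀ x, 0 ≤ ν x) (hsum : HasSum ν 1)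
    (n : ℕ) (p : ℝ) (z : ℂ) (t : ℝ) (ht : 1 ≤ t) (hint : Summable fun k : ℕ => ν k * t ^ k) :
    Dd t (dl m ν n p z 0) ≤ ‖z - p‖ * ∑' k, ν k * t ^ k := by
  have hs1 : ∑ x ∈ Finset.range (n + 1), ν x ≤ 1 :=
    sum_le_hasSum _ (fun i _ => hν i) hsum
  refine ((dl_zero_dom m hν n hs1 p z).absP_pr_le (wD_nonneg (by linarith))).trans ?_
  have e : ∀ g : ℝ[X], pr (wD t) (C ‖z - p‖ * g) = ‖z - p‖ * pr (wD t) g := by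
    intro g; rw [← smul_eq_C_mul, map_smul, smul_eq_mul]
  rw [e]
  refine mul_le_mul_of_nonneg_left ?_ (norm_nonneg _)
  rw [map_add, map_add, map_sum, ← C_1, pr_C, pr_monomial]
  simp only [pr_monomial]
  have hw0 : wD t 0 = 0 := by simp [wD]
  have hw1 : ∀ x, wD t x ≤ t ^ x := fun x => by
    unfold wD; split_ifs
    · positivity
    · exact le_rfl
  rw [hw0, mul_zero, add_zero, ← hint.sum_add_tsum_nat_add (n + 1)]
  refine add_le_add (Finset.sum_le_sum fun x _ => mul_le_mul_of_nonneg_left (hw1 x) (hν x)) ?_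
  have h1 : 1 - ∑ x ∈ Finset.range (n + 1), ν x = ∑' x, ν (x + (n + 1)) := by
    rw [← hsum.tsum_eq, ← hsum.summable.sum_add_tsum_nat_add (n + 1)]; ring
  rw [h1, ← tsum_mul_right]
  refine Summable.tsum_le_tsum (fun x => ?_) ?_ ?_
  · refine mul_le_mul_of_nonneg_left ((hw1 _).trans ?_) (hν _)
    exact pow_le_pow_right₀ ht (by omega)
  · exact ((summable_nat_add_iff (n + 1)).2 hsum.summable).mul_right _
  · exact (summable_nat_add_iff (f := fun k => ν k * t ^ k) (n + 1)).2 hint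

lemma absP_eval_one_le {f : ℝ[X]} (hf : NN f) (h1 : f.eval 1 = 1) (d : ℂ[X]) (hd : d.eval 1 = 0)
    (t : ℝ) (ht : 1 ≤ t) :
    (absP (f.map Complex.ofRealHom + d)).eval 1 ≤ 1 + 2 * Dd t d := by
  have h2 := ((dom_map hf).add (dom_absP d)).absP_pr_le (w := fun _ => 1) fun _ => zero_le_one
  rw [← eval_one_eq_pr, ← eval_one_eq_pr, eval_add, h1] at h2
  have h3 := norm_coeff_zero_le ht d hd
  have h4 : pr (wD 1) (absP d) ≤ Dd t d := (NN_absP d).pr_mono fun x => by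
    unfold wD; split_ifs
    · exact le_rfl
    · exact pow_le_pow_left₀ zero_le_one ht x
  rw [pr_wD, coeff_absP] at h4
  linarith

/-- Case A: complex bound. -/
lemma caseA_complex (m : ℕ) (hm : 2 ≤ m) {ν : ℕ → ℝ} (hν0 : ν 0 = 0) (hν : ∀ x, 0 ≤ ν x)
    (hsum : HasSum ν 1) (x0 : ℕ) (hx0 : 2 ≤ x0) (hv : 0 < ν x0)
    (hint : ∀ s : ℝ, 0 ≤ s → s < (m : ℝ) → Summable fun k : ℕ => ν k * s ^ k)
    (ω : ℝ) (hω : 1 < ω) (A : ℕ) (hA : 2 ≤ A) (B : ℝ) (hB : (m : ℝ) ≤ B) :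
    ∃ (Ca : ℝ) (A2 n0 : ℕ), 0 < Ca ∧ 1 ≤ A2 ∧
      ∀ n ≥ n0, ∀ p : ℝ, 0 ≤ p → p ≤ 1 →
        (∀ j ≤ n - n / A, ∀ x, 2 ≤ x → x + j ≤ n - n / A2 →
          tl x (LL m ν n p j) < B / (m : ℝ) ^ x) →
        ∀ z : ℂ, ‖z - p‖ * (Ca * (ω ^ n) ^ 4 * (n + 1) * (m : ℝ) ^ (n / A)) ≤ 1 →
          ‖(LL m (cν ν) n z n).coeff 0‖ ≤ 3 := by
  have hs1 : ∀ n, ∑ x ∈ Finset.range (n + 1), ν x ≤ 1 := fun n =>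
    sum_le_hasSum _ (fun i _ => hν i) hsum
  obtain ⟨C0, η, t, kB, A2, n0, hC0, hη, htη, ht4, htm, hA2, H⟩ :=
    caseA_real m hm hν0 hν hs1 x0 hx0 hv ω hω A hA B hB
  have hm' : (2 : ℝ) ≤ m := by exact_mod_cast hm
  have ht : 3 / 2 ≤ t := by linarith
  have ht1 : 1 ≤ t := by linarith
  have hsmt := hint t (by linarith) htm
  obtain ⟨E, hE⟩ : ∃ E, E = ∑' k, ν k * t ^ k := ⟨_, rfl⟩
  have hE0 : 0 ≤ E := by
    rw [hE]; exact tsum_nonneg fun k => mul_nonneg (hν k) (by positivity)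
  refine ⟨2 * (E + 1) * (Real.exp (8 * m) * C0 ^ 4) * (m : ℝ) ^ (kB + 1), A2, n0, by positivity,
    hA2, ?_⟩
  intro n hn p hp0 hp1 hno z hz
  obtain ⟨hk, H⟩ := H n hn
  have hP := H p hp0 hp1 hno
  obtain ⟨J, hJ⟩ : ∃ J, J = n - n / A - kB - 1 := ⟨_, rfl⟩
  rw [← hJ] at hP
  have hNN : ∀ j, NN (LL m ν n p j) := NN_LL m hν n (hs1 n) hp0 hp1
  have h1 : ∀ j, (LL m ν n p j).eval 1 = 1 := eval_one_LL m ν n p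
  have hD00 := Dd_zero_le m hν hsum n p z t ht1 hsmt
  rw [← hE] at hD00
  have hD0n := Dd_nonneg (by linarith : 0 ≤ t) (dl m ν n p z 0)
  obtain ⟨M, hM⟩ : ∃ M, M = Real.exp (8 * m) * (C0 * ω ^ n) ^ 4 := ⟨_, rfl⟩
  have hM0 : 0 ≤ M := by rw [hM]; positivity
  -- the basic smallness
  obtain ⟨r, hr⟩ : ∃ r, r = n / A := ⟨_, rfl⟩
  have hrn : r ≤ n := hr ▸ Nat.div_le_self _ _
  rw [← hr] at hz hk hJ
  obtain ⟨X, hX⟩ : ∃ X, X = (m : ℝ) ^ (kB + 1 + r) := ⟨_, rfl⟩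
  have hX1 : 1 ≤ X := hX ▸ one_le_pow₀ (by linarith)
  have hnn : (1 : ℝ) ≤ n + 1 := by
    have : (0 : ℝ) ≤ n := Nat.cast_nonneg n
    linarith
  obtain ⟨N, hN⟩ : ∃ N : ℝ, N = n + 1 := ⟨_, rfl⟩
  have hz' : Dd t (dl m ν n p z 0) * M * N * (2 * X) ≤ 1 := by
    refine le_trans ?_ hz
    have e : ‖z - p‖ * (2 * (E + 1) * (Real.exp (8 * m) * C0 ^ 4) * (m : ℝ) ^ (kB + 1) *
        (ω ^ n) ^ 4 * (n + 1) * (m : ℝ) ^ r) = (‖z - p‖ * (E + 1)) * (M * N * (2 * X)) := by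
      rw [hM, hX, hN, pow_add]; ring
    rw [e]
    have h3 : Dd t (dl m ν n p z 0) ≤ ‖z - p‖ * (E + 1) := hD00.trans
            (mul_le_mul_of_nonneg_left (by linarith) (norm_nonneg _))
    have h4 : 0 ≤ M * N * (2 * X) :=
      mul_nonneg (mul_nonneg hM0 (by linarith)) (by linarith)
    have h5 := mul_le_mul_of_nonneg_right h3 h4
    linarith
  have hX0 : 0 ≤ Dd t (dl m ν n p z 0) * M := mul_nonneg hD0n hM0
  have hX00 : 0 ≤ Dd t (dl m ν n p z 0) * M * N := mul_nonneg hX0 (by linarith)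
  have hboot := bootstrap J n m (by omega) (fun j => Dd t (dl m ν n p z j))
    (fun j => lam m η t (LL m ν n p j)) (fun j => Dd_nonneg (by linarith) _)
    (fun j => (one_le_lam m hm t η ht1 hη.le (hNN j) (h1 j)).2)
    (fun j => by
      rw [dl_succ]
      exact D_step m hm _ t η ht hη.le htη (hNN j) (h1 j) _ (dl_eval_one m ν n p z j))
    (C0 * ω ^ n) hP (by
      rw [← hM, ← hN]
      exact (le_mul_of_one_le_right hX00 (by linarith)).trans hz')
  rw [← hM] at hboot
  have hfin : 2 * Dd t (dl m ν n p z J) * (m : ℝ) ^ (n - J) ≤ 1 := by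
    have e : n - J = kB + 1 + r := by omega
    rw [e, ← hX]
    have h3 : Dd t (dl m ν n p z J) ≤ Dd t (dl m ν n p z 0) * M * N :=
      hboot.trans (le_mul_of_one_le_right hX0 (by linarith))
    have h4 := mul_le_mul_of_nonneg_right h3 (by linarith : 0 ≤ 2 * X)
    linarith
  have hLJ : LL m (cν ν) n z J = (LL m ν n p J).map Complex.ofRealHom + dl m ν n p z J := by
    simp [dl]
  have hb1 := absP_eval_one_le (hNN J) (h1 J) (dl m ν n p z J) (dl_eval_one m ν n p z J) t ht1
  rw [← hLJ] at hb1
  have hev := absP_LL_eval_one m (cν ν) n z J (n - J)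
  rw [show J + (n - J) = n by omega] at hev
  have hc : ‖(LL m (cν ν) n z n).coeff 0‖ ≤ (absP (LL m (cν ν) n z n)).eval 1 := by
    rw [← coeff_absP]; exact (NN_absP _).coeff_le_eval_one 0
  have h0 : 0 ≤ (absP (LL m (cν ν) n z J)).eval 1 := by
    rw [eval_one_eq_pr]; exact (NN_absP _).pr_nonneg fun _ => zero_le_one
  calc _ ≤ _ := hc
    _ ≤ _ := hev
    _ ≤ (Real.exp (2 * Dd t (dl m ν n p z J))) ^ (m ^ (n - J)) :=
        pow_le_pow_left₀ h0 (hb1.trans (by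
          linarith [Real.add_one_le_exp (2 * Dd t (dl m ν n p z J))])) _
    _ = Real.exp (2 * Dd t (dl m ν n p z J) * (m : ℝ) ^ (n - J)) := by
        rw [← Real.exp_nat_mul]; congr 1; push_cast; ring
    _ ≤ Real.exp 1 := Real.exp_le_exp.2 hfin
    _ ≤ 3 := by linarith [Real.exp_one_lt_d9]



/-! ### Case B -/

/-- Mass strictly below `x`. -/
def cl (x : ℕ) (f : ℝ[X]) : ℝ := pr (fun y => if y < x then 1 else 0) f

lemma cl_nonneg {f : ℝ[X]} (hf : NN f) (x : ℕ) : 0 ≤ cl x f :=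
  hf.pr_nonneg fun y => by split_ifs <;> norm_num

lemma cl_add_tl (x : ℕ) (f : ℝ[X]) : cl x f + tl x f = f.eval 1 := by
  rw [cl, tl, ← pr_add_w, eval_one_eq_pr]
  congr 2
  ext y
  by_cases h : y < x
  · rw [if_pos h, if_neg (by omega)]; norm_num
  · rw [if_neg h, if_pos (by omega)]; norm_num

lemma cl_step (m c : ℕ) {f : ℝ[X]} (hf : NN f) (x : ℕ) (hx : 2 ≤ x) (hxc : x ≤ c) :
    cl (x - 1) (cstep m c f) ≤ cl x f ^ m := by
  rw [cl, cstep, pr_push]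
  refine ((hf.pow m).pr_mono (w' := fun y => if y < x then 1 else 0) fun S => ?_).trans ?_
  · by_cases h : S < x
    · rw [if_pos h]; split_ifs <;> norm_num
    · rw [if_neg h, if_neg]
      have : x - 1 ≤ min (S - 1) (c - 1) := le_min (by omega) (by omega)
      omega
  · refine pr_pow_le hf ?_ ?_ ?_ m
    · split_ifs <;> norm_num
    · intro y; split_ifs <;> norm_num
    · intro y z
      by_cases h : y + z < x
      · rw [if_pos h, if_pos (by omega), if_pos (by omega)]; norm_num
      · rw [if_neg h]; split_ifs <;> norm_num

lemma cl_iter (m : ℕ) {ν : ℕ → ℝ} (n : ℕ) (p : ℝ) (hNN : ∀ j, NN (LL m ν n p j))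
    (j x : ℕ) (hxj : x + j ≤ n + 1) (k : ℕ) (hk : k + 2 ≤ x) :
    cl (x - k) (LL m ν n p (j + k)) ≤ (cl x (LL m ν n p j)) ^ (m ^ k) := by
  induction k with
  | zero => simp
  | succ k ih =>
    have h := cl_step m (n + 1 - (j + k)) (hNN (j + k)) (x - k) (by omega) (by omega)
    have h2 : x - k - 1 = x - (k + 1) := by omega
    rw [h2] at h
    have h3 : LL m ν n p (j + (k + 1)) = cstep m (n + 1 - (j + k)) (LL m ν n p (j + k)) := rfl
    rw [h3]
    refine h.trans ((pow_le_pow_left₀ (cl_nonneg (hNN _) _) (ih (by omega)) m).trans ?_)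
    rw [← pow_mul, pow_succ]

lemma absP_eval_nonneg (f : ℂ[X]) : 0 ≤ (absP f).eval 1 := by
  rw [eval_one_eq_pr]; exact (NN_absP _).pr_nonneg fun _ => zero_le_one

lemma dl_norm_iter (m : ℕ) {ν : ℕ → ℝ} (n : ℕ) (p : ℝ) (hNN : ∀ j, NN (LL m ν n p j)) (z : ℂ)
    (j : ℕ) : 1 + (absP (dl m ν n p z j)).eval 1 ≤ (1 + (absP (dl m ν n p z 0)).eval 1) ^ (m ^ j) := by
  induction j with
  | zero => simp
  | succ j ih =>
    have h := absP_cstep_sub_pr_le m (n + 1 - j) (hNN j) (dl m ν n p z j) (w := fun _ => 1)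
      fun _ => zero_le_one
    rw [← dl_succ, ← eval_one_eq_pr, ← eval_one_eq_pr, eval_sub, eval_pow, eval_pow, eval_add,
      eval_one_LL, one_pow] at h
    have h0 := absP_eval_nonneg (dl m ν n p z j)
    have h2 := pow_le_pow_left₀ (by linarith) ih m
    rw [← pow_mul, ← pow_succ] at h2
    linarith

lemma dl_zero_norm (m : ℕ) {ν : ℕ → ℝ} (hν : ∀ x, 0 ≤ ν x) (n : ℕ)
    (hs1 : ∑ x ∈ Finset.range (n + 1), ν x ≤ 1) (p : ℝ) (z : ℂ) :
    (absP (dl m ν n p z 0)).eval 1 ≤ 2 * ‖z - p‖ := by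
  have h := (dl_zero_dom m hν n hs1 p z).absP_pr_le (w := fun _ => 1) fun _ => zero_le_one
  rw [← eval_one_eq_pr, ← eval_one_eq_pr] at h
  refine h.trans (le_of_eq ?_)
  simp only [eval_mul, eval_C, eval_add, eval_finsetSum, eval_monomial, eval_one, one_pow, mul_one]
  ring

/-- Weight for case B. -/
def wB (n j x : ℕ) : ℝ := if x < n + 1 - j then (1 / 4) ^ x else 0

lemma wB_nonneg (n j x : ℕ) : 0 ≤ wB n j x := by unfold wB; split_ifs <;> positivity

lemma wB_step (m n : ℕ) (u : ℕ → ℂ) (z : ℂ) (j : ℕ) :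
    pr (wB n (j + 1)) (absP (LL m u n z (j + 1))) ≤ 4 * (pr (wB n j) (absP (LL m u n z j))) ^ m := by
  have h3 : LL m u n z (j + 1) = cstep m (n + 1 - j) (LL m u n z j) := rfl
  rw [h3]
  refine (absP_cstep_pr_le m _ _ (wB_nonneg n (j + 1))).trans ?_
  refine (((NN_absP (LL m u n z j)).pow m).pr_mono (w' := fun S => 4 * wB n j S)
    fun S => ?_).trans ?_
  · show wB n (j + 1) (min (S - 1) (n + 1 - j - 1)) ≤ 4 * wB n j S
    by_cases h : S < n + 1 - j
    · have e : min (S - 1) (n + 1 - j - 1) = S - 1 := min_eq_left (by omega)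
      rw [e]
      have e2 : wB n j S = (1 / 4) ^ S := if_pos h
      rw [e2]
      have h4 : wB n (j + 1) (S - 1) ≤ (1 / 4) ^ (S - 1) := by
        unfold wB; split_ifs
        · exact le_rfl
        · positivity
      refine h4.trans ?_
      rcases Nat.eq_zero_or_pos S with h0 | h0
      · subst h0; norm_num
      · obtain ⟨k, rfl⟩ : ∃ k, S = k + 1 := ⟨S - 1, by omega⟩
        rw [Nat.add_sub_cancel, pow_succ]
        linarith
    · have e : min (S - 1) (n + 1 - j - 1) = n + 1 - j - 1 := min_eq_right (by omega)
      rw [e]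
      have e2 : wB n (j + 1) (n + 1 - j - 1) = 0 := if_neg (by omega)
      rw [e2]
      have := wB_nonneg n j S
      linarith
  · rw [pr_smul_w]
    refine mul_le_mul_of_nonneg_left ?_ (by norm_num)
    refine pr_pow_le (NN_absP _) ?_ (wB_nonneg n j) ?_ m
    · unfold wB; split_ifs <;> norm_num
    · intro x y
      by_cases h : x + y < n + 1 - j
      · have e1 : wB n j (x + y) = (1 / 4) ^ (x + y) := if_pos h
        have e2 : wB n j x = (1 / 4) ^ x := if_pos (by omega)
        have e3 : wB n j y = (1 / 4) ^ y := if_pos (by omega)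
        rw [e1, e2, e3, pow_add]
      · have e1 : wB n j (x + y) = 0 := if_neg h
        rw [e1]
        exact mul_nonneg (wB_nonneg _ _ _) (wB_nonneg _ _ _)

lemma wB_iter (m : ℕ) (hm : 2 ≤ m) (n : ℕ) (u : ℕ → ℂ) (z : ℂ) (j k : ℕ) :
    4 * pr (wB n (j + k)) (absP (LL m u n z (j + k)))
      ≤ (4 * pr (wB n j) (absP (LL m u n z j))) ^ (m ^ k) := by
  induction k with
  | zero => simp
  | succ k ih =>
    have h := wB_step m n u z (j + k)
    have h0 : 0 ≤ pr (wB n (j + k)) (absP (LL m u n z (j + k))) :=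
      (NN_absP _).pr_nonneg (wB_nonneg _ _)
    obtain ⟨T, hT⟩ : ∃ T, T = pr (wB n (j + k)) (absP (LL m u n z (j + k))) := ⟨_, rfl⟩
    rw [← hT] at h h0 ih
    have h2 := pow_le_pow_left₀ (by linarith) ih m
    rw [← pow_mul, ← pow_succ] at h2
    refine le_trans ?_ h2
    have h16 : (4 : ℝ) ^ 2 ≤ 4 ^ m := pow_le_pow_right₀ (by norm_num) hm
    have h5 : (4 : ℝ) ^ 2 * T ^ m ≤ 4 ^ m * T ^ m :=
      mul_le_mul_of_nonneg_right h16 (by positivity)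
    rw [mul_pow]
    have h6 : 4 * pr (wB n (j + (k + 1))) (absP (LL m u n z (j + (k + 1)))) ≤ 4 * (4 * T ^ m) :=
      mul_le_mul_of_nonneg_left h (by norm_num)
    linarith

lemma caseB (m : ℕ) (hm : 2 ≤ m) {ν : ℕ → ℝ} (hν : ∀ x, 0 ≤ ν x) (n : ℕ)
    (hs1 : ∑ x ∈ Finset.range (n + 1), ν x ≤ 1) (p : ℝ) (hp0 : 0 ≤ p) (hp1 : p ≤ 1)
    (j x : ℕ) (hx : 2 ≤ x) (hxj : x + j ≤ n)
    (hviol : 32 * (m : ℝ) ^ 2 / (m : ℝ) ^ x ≤ tl x (LL m ν n p j))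
    (z : ℂ) (hz : ‖z - p‖ * (m : ℝ) ^ n ≤ 1 / 100) :
    ‖(LL m (cν ν) n z n).coeff 0‖ ≤ (1 / 2) ^ (m ^ (n - (j + (x - 2)))) := by
  have hNN : ∀ j, NN (LL m ν n p j) := NN_LL m hν n hs1 hp0 hp1
  have hm' : (2 : ℝ) ≤ m := by exact_mod_cast hm
  obtain ⟨N, hN⟩ : ∃ N, N = j + (x - 2) := ⟨_, rfl⟩
  rw [← hN]
  have hNn : N ≤ n := by omega
  -- real part
  have hcl : cl 2 (LL m ν n p N) ≤ 1 / 32 := by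
    have h := cl_iter m n p hNN j x (by omega) (x - 2) (by omega)
    rw [show x - (x - 2) = 2 by omega, ← hN] at h
    refine h.trans ?_
    have h1 := cl_add_tl x (LL m ν n p j)
    rw [eval_one_LL] at h1
    obtain ⟨τ, hτ⟩ : ∃ τ, τ = tl x (LL m ν n p j) := ⟨_, rfl⟩
    rw [← hτ] at h1 hviol
    have h2 : cl x (LL m ν n p j) ≤ Real.exp (-τ) := by
      linarith [Real.add_one_le_exp (-τ)]
    calc _ ≤ (Real.exp (-τ)) ^ (m ^ (x - 2)) := pow_le_pow_left₀ (cl_nonneg (hNN _) _) h2 _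
      _ = Real.exp (-((m : ℝ) ^ (x - 2) * τ)) := by
          rw [← Real.exp_nat_mul]; congr 1; push_cast; ring
      _ ≤ Real.exp (-32) := by
          apply Real.exp_le_exp.2
          have h3 : (m : ℝ) ^ (x - 2) * (32 * (m : ℝ) ^ 2 / (m : ℝ) ^ x) = 32 := by
            have e : (m : ℝ) ^ x = (m : ℝ) ^ (x - 2) * (m : ℝ) ^ 2 := by
              rw [← pow_add]; congr 1; omega
            rw [e]
            have : (m : ℝ) ≠ 0 := by linarith
            field_simp
          have h4 := mul_le_mul_of_nonneg_left hviol (by positivity : 0 ≤ (m : ℝ) ^ (x - 2))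
          linarith
      _ ≤ 1 / 32 := by
          rw [Real.exp_neg, ← one_div]
          apply one_div_le_one_div_of_le (by norm_num)
          linarith [Real.add_one_le_exp (32 : ℝ)]
  -- perturbation
  have hdl : (absP (dl m ν n p z N)).eval 1 ≤ 1 / 32 := by
    have h := dl_norm_iter m n p hNN z N
    have h0 := dl_zero_norm m hν n hs1 p z
    have h00 := absP_eval_nonneg (dl m ν n p z 0)
    have h1 : 1 + (absP (dl m ν n p z 0)).eval 1 ≤ Real.exp (2 * ‖z - p‖) := by
      linarith [Real.add_one_le_exp (2 * ‖z - p‖)]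
    have h2 : (1 + (absP (dl m ν n p z 0)).eval 1) ^ (m ^ N) ≤ Real.exp (1 / 50) := by
      calc _ ≤ (Real.exp (2 * ‖z - p‖)) ^ (m ^ N) := pow_le_pow_left₀ (by linarith) h1 _
        _ = Real.exp (2 * (‖z - p‖ * (m : ℝ) ^ N)) := by
            rw [← Real.exp_nat_mul]; congr 1; push_cast; ring
        _ ≤ _ := by
            apply Real.exp_le_exp.2
            have h3 : ‖z - p‖ * (m : ℝ) ^ N ≤ ‖z - p‖ * (m : ℝ) ^ n :=
              mul_le_mul_of_nonneg_left (pow_le_pow_right₀ (by linarith) hNn) (norm_nonneg _)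
            linarith
    have h3 : Real.exp (1 / 50) ≤ 33 / 32 := by
      have h4 := Real.add_one_le_exp (-(1 / 50) : ℝ)
      rw [Real.exp_neg] at h4
      have h5 : Real.exp (1 / 50) ≤ (49 / 50 : ℝ)⁻¹ := by
        rw [le_inv_comm₀ (Real.exp_pos _) (by norm_num)]
        linarith
      refine h5.trans (by norm_num)
    linarith
  have hLN : LL m (cν ν) n z N = (LL m ν n p N).map Complex.ofRealHom + dl m ν n p z N := by
    simp [dl]
  have hT : pr (wB n N) (absP (LL m (cν ν) n z N)) ≤ 1 / 8 := by
    rw [hLN]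
    refine (((dom_map (hNN N)).add (dom_absP _)).absP_pr_le (wB_nonneg n N)).trans ?_
    rw [map_add]
    have h1 : pr (wB n N) (absP (dl m ν n p z N)) ≤ 1 / 32 := by
      refine le_trans ?_ hdl
      rw [eval_one_eq_pr]
      refine (NN_absP _).pr_mono fun y => ?_
      unfold wB; split_ifs
      · exact pow_le_one₀ (by norm_num) (by norm_num)
      · exact zero_le_one
    have h2 : pr (wB n N) (LL m ν n p N) ≤ 1 / 32 + 1 / 16 := by
      have h3 : pr (wB n N) (LL m ν n p N) ≤
          pr (fun y => (if y < 2 then (1 : ℝ) else 0) + (1 / 16) * 1) (LL m ν n p N) := by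
        refine (hNN N).pr_mono fun y => ?_
        have h4 : wB n N y ≤ (1 / 4) ^ y := by
          unfold wB; split_ifs
          · exact le_rfl
          · positivity
        refine h4.trans ?_
        split_ifs with hy
        · have : (1 / 4 : ℝ) ^ y ≤ 1 := pow_le_one₀ (by norm_num) (by norm_num)
          linarith
        · have : (1 / 4 : ℝ) ^ y ≤ (1 / 4) ^ 2 :=
            pow_le_pow_of_le_one (by norm_num) (by norm_num) (by omega)
          linarith
      rw [pr_add_w, pr_smul_w, ← eval_one_eq_pr, eval_one_LL] at h3
      change _ ≤ cl 2 _ + _ at h3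
      linarith
    linarith
  have hit := wB_iter m hm n (cν ν) z N (n - N)
  rw [show N + (n - N) = n by omega] at hit
  have hT0 : 0 ≤ pr (wB n N) (absP (LL m (cν ν) n z N)) := (NN_absP _).pr_nonneg (wB_nonneg _ _)
  have hTn : 0 ≤ pr (wB n n) (absP (LL m (cν ν) n z n)) := (NN_absP _).pr_nonneg (wB_nonneg _ _)
  have hw : wB n n = fun y => if y = 0 then 1 else 0 := by
    ext y
    unfold wB
    by_cases h : y = 0
    · subst h; simp
    · rw [if_neg h, if_neg (by omega)]
  have hc : pr (wB n n) (absP (LL m (cν ν) n z n)) = ‖(LL m (cν ν) n z n).coeff 0‖ := by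
    rw [hw, pr_delta, coeff_absP]
  rw [hc] at hit hTn
  have hfin : (4 * pr (wB n N) (absP (LL m (cν ν) n z N))) ^ (m ^ (n - N)) ≤
      (1 / 2) ^ (m ^ (n - N)) := pow_le_pow_left₀ (by linarith) (by linarith) _
  linarith



/-! ### Derivative bounds -/

/-- `P(X_n = 0)` as a polynomial in `p`. -/
def Pn (m : ℕ) (ν : ℕ → ℝ) (n : ℕ) : ℝ[X] := (LL m (fun x => C (ν x)) n X n).coeff 0

lemma eval_Pn (m : ℕ) (ν : ℕ → ℝ) (n : ℕ) (q : ℝ) : (Pn m ν n).eval q = drLaw m ν q n 0 := by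
  have h := map_LL (Polynomial.evalRingHom q) m (fun x => C (ν x)) n X n
  simp only [coe_evalRingHom, eval_C, eval_X] at h
  rw [← coeff_LL_eq_drLaw m ν n q n le_rfl 0 (by omega)]
  have h2 := congrArg (fun f => f.coeff 0) h
  simp only [coeff_map, coe_evalRingHom] at h2
  exact h2

lemma eval_Pn_complex (m : ℕ) (ν : ℕ → ℝ) (n : ℕ) (z : ℂ) :
    ((Pn m ν n).map Complex.ofRealHom).eval z = (LL m (cν ν) n z n).coeff 0 := by
  have h := map_LL (Polynomial.eval₂RingHom Complex.ofRealHom z) m (fun x => C (ν x)) n X n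
  simp only [coe_eval₂RingHom, eval₂_C, eval₂_X] at h
  have h2 := congrArg (fun f => f.coeff 0) h
  simp only [coeff_map, coe_eval₂RingHom] at h2
  rw [eval_map]
  exact h2

lemma iteratedDeriv_eval {𝕜 : Type*} [NontriviallyNormedField 𝕜] (f : 𝕜[X]) (k : ℕ) :
    iteratedDeriv k (fun x => f.eval x) = fun x => (derivative^[k] f).eval x := by
  induction k with
  | zero => simp [iteratedDeriv_zero]
  | succ k ih =>
    rw [iteratedDeriv_succ, ih]
    ext x
    rw [Polynomial.deriv, Function.iterate_succ_apply']

lemma cauchy_poly (f : ℝ[X]) (k : ℕ) (p R M : ℝ) (hR : 0 < R)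
    (hM : ∀ z : ℂ, ‖z - p‖ = R → ‖(f.map Complex.ofRealHom).eval z‖ ≤ M) :
    |(derivative^[k] f).eval p| ≤ k.factorial * M / R ^ k := by
  have h := Complex.norm_iteratedDeriv_le_of_forall_mem_sphere_norm_le (c := (p : ℂ)) (R := R)
    (C := M) (f := fun z => (f.map Complex.ofRealHom).eval z) k hR
    (Polynomial.differentiable _).diffContOnCl
    (fun z hz => hM z (by rwa [mem_sphere_iff_norm] at hz))
  rw [iteratedDeriv_eval, iterate_derivative_map] at h
  have e : ((derivative^[k] f).map Complex.ofRealHom).eval (p : ℂ)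
      = (((derivative^[k] f).eval p : ℝ) : ℂ) := by
    rw [eval_map]
    exact eval₂_at_apply Complex.ofRealHom p
  simp only [e, Complex.norm_real, Real.norm_eq_abs] at h
  exact h

lemma caseB_const (m : ℕ) (hm : 2 ≤ m) (k A2 : ℕ) (hA2 : 1 ≤ A2) :
    ∃ C : ℝ, 0 ≤ C ∧ ∀ n : ℕ, (100 * (m : ℝ) ^ n) ^ k * (1 / 2) ^ (m ^ (n / A2)) ≤ C := by
  have ht := tendsto_pow_const_mul_const_pow_of_abs_lt_one (A2 * k) (r := (1 / 2 : ℝ))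
    (by rw [abs_of_pos] <;> norm_num)
  obtain ⟨C, hC⟩ := ht.bddAbove_range
  have hC' : ∀ y : ℕ, (y : ℝ) ^ (A2 * k) * (1 / 2) ^ y ≤ C := fun y => hC ⟨y, rfl⟩
  have hm' : (2 : ℝ) ≤ m := by exact_mod_cast hm
  have hC0 : 0 ≤ C := le_trans (by positivity) (hC' 0)
  refine ⟨100 ^ k * (m : ℝ) ^ (A2 * k) * C, by positivity, fun n => ?_⟩
  have h1 := hC' (m ^ (n / A2))
  push_cast at h1
  have h2 : ((m : ℝ) ^ n) ^ k ≤ (m : ℝ) ^ (A2 * k) * ((m : ℝ) ^ (n / A2)) ^ (A2 * k) := by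
    rw [← pow_mul, ← pow_mul, ← pow_add]
    refine pow_le_pow_right₀ (by linarith) ?_
    have h3 : n ≤ A2 + n / A2 * A2 := by
      have := Nat.div_add_mod n A2
      have h4 := Nat.mod_lt n (by omega : A2 > 0)
      rw [mul_comm] at this
      omega
    calc n * k ≤ (A2 + n / A2 * A2) * k := Nat.mul_le_mul_right k h3
      _ = _ := by ring
  calc (100 * (m : ℝ) ^ n) ^ k * (1 / 2) ^ (m ^ (n / A2))
      = 100 ^ k * ((m : ℝ) ^ n) ^ k * (1 / 2) ^ (m ^ (n / A2)) := by rw [mul_pow]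
    _ ≤ 100 ^ k * ((m : ℝ) ^ (A2 * k) * ((m : ℝ) ^ (n / A2)) ^ (A2 * k)) *
        (1 / 2) ^ (m ^ (n / A2)) := by gcongr
    _ = 100 ^ k * (m : ℝ) ^ (A2 * k) * (((m : ℝ) ^ (n / A2)) ^ (A2 * k) *
        (1 / 2) ^ (m ^ (n / A2))) := by ring
    _ ≤ _ := mul_le_mul_of_nonneg_left h1 (by positivity)

lemma key (m : ℕ) (hm : 2 ≤ m) {ν : ℕ → ℝ} (hν0 : ν 0 = 0) (hν : ∀ x, 0 ≤ ν x)
    (hsum : HasSum ν 1) (x0 : ℕ) (hx0 : 2 ≤ x0) (hv : 0 < ν x0)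
    (hint : ∀ s : ℝ, 0 ≤ s → s < (m : ℝ) → Summable fun k : ℕ => ν k * s ^ k) (k : ℕ) :
    ∃ (K : ℝ) (n0 : ℕ), 0 ≤ K ∧ ∀ n ≥ n0, ∀ p : ℝ, 0 ≤ p → p ≤ 1 →
      |(derivative^[k] (Pn m ν n ^ m)).eval p| ≤ K * (3 / 2) ^ n := by
  have hm' : (2 : ℝ) ≤ m := by exact_mod_cast hm
  have hs1 : ∀ n, ∑ x ∈ Finset.range (n + 1), ν x ≤ 1 := fun n =>
    sum_le_hasSum _ (fun i _ => hν i) hsum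
  obtain ⟨V, hV⟩ : ∃ V : ℝ, V = 18 * k + 18 := ⟨_, rfl⟩
  have hV0 : 18 ≤ V := by
    have : (0 : ℝ) ≤ k := Nat.cast_nonneg k
    linarith
  obtain ⟨ω, hω⟩ : ∃ ω : ℝ, ω = 1 + 1 / V := ⟨_, rfl⟩
  have hVi : 0 < 1 / V := by positivity
  have hω1 : 1 < ω := by linarith
  have hω6 : ω ^ (6 * k) ≤ 3 / 2 := by
    have h1 : ω ≤ Real.exp (1 / V) := by linarith [Real.add_one_le_exp (1 / V)]
    calc ω ^ (6 * k) ≤ (Real.exp (1 / V)) ^ (6 * k) := pow_le_pow_left₀ (by linarith) h1 _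
      _ = Real.exp ((6 * k : ℕ) * (1 / V)) := by rw [← Real.exp_nat_mul]
      _ ≤ Real.exp (1 / 3) := by
          apply Real.exp_le_exp.2
          rw [mul_one_div, div_le_iff₀ (by linarith), hV]
          push_cast
          linarith
      _ ≤ 3 / 2 := by
          have h4 := Real.add_one_le_exp (-(1 / 3) : ℝ)
          rw [Real.exp_neg] at h4
          have h5 : Real.exp (1 / 3) ≤ (2 / 3 : ℝ)⁻¹ := by
            rw [le_inv_comm₀ (Real.exp_pos _) (by norm_num)]
            linarith
          refine h5.trans (by norm_num)
  have hωn : ∀ n : ℕ, (n : ℝ) + 1 ≤ V * ω ^ n := fun n => by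
    have h3 := one_add_mul_le_pow (a := 1 / V) (by linarith) n
    rw [← hω] at h3
    have h4 := mul_le_mul_of_nonneg_left h3 (by linarith : 0 ≤ V)
    have h5 : V * (1 + n * (1 / V)) = V + n := by
      have : V ≠ 0 := by linarith
      field_simp
    linarith
  obtain ⟨A, hA2', hAm⟩ : ∃ A : ℕ, 2 ≤ A ∧ (m : ℝ) ≤ ω ^ A := by
    obtain ⟨A, hA⟩ := pow_unbounded_of_one_lt (m : ℝ) hω1
    exact ⟨A + 2, by omega, hA.le.trans (pow_le_pow_right₀ hω1.le (by omega))⟩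
  have hmA : ∀ n : ℕ, (m : ℝ) ^ (n / A) ≤ ω ^ n := fun n => by
    calc (m : ℝ) ^ (n / A) ≤ (ω ^ A) ^ (n / A) := pow_le_pow_left₀ (by linarith) hAm _
      _ = ω ^ (A * (n / A)) := by rw [← pow_mul]
      _ ≤ ω ^ n := pow_le_pow_right₀ hω1.le (Nat.mul_div_le n A)
  obtain ⟨Ca, A2, n0, hCa, hA2, H⟩ := caseA_complex m hm hν0 hν hsum x0 hx0 hv hint ω hω1 A hA2'
    (32 * (m : ℝ) ^ 2) (by nlinarith)
  obtain ⟨Cb, hCb0, hCb⟩ := caseB_const m hm k A2 hA2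
  refine ⟨k.factorial * 3 ^ m * (Ca * V) ^ k + k.factorial * Cb, n0, by positivity, ?_⟩
  intro n hn p hp0 hp1
  have h32 : (1 : ℝ) ≤ (3 / 2) ^ n := one_le_pow₀ (by norm_num)
  have hexp : ∀ z : ℂ, ((Pn m ν n ^ m).map Complex.ofRealHom).eval z
      = ((LL m (cν ν) n z n).coeff 0) ^ m := fun z => by
    rw [Polynomial.map_pow, eval_pow, eval_Pn_complex]
  by_cases hno : ∀ j ≤ n - n / A, ∀ x, 2 ≤ x → x + j ≤ n - n / A2 →
          tl x (LL m ν n p j) < 32 * (m : ℝ) ^ 2 / (m : ℝ) ^ x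
  · have HA := H n hn p hp0 hp1 hno
    obtain ⟨Q, hQ⟩ : ∃ Q : ℝ, Q = Ca * (ω ^ n) ^ 4 * (n + 1) * (m : ℝ) ^ (n / A) := ⟨_, rfl⟩
    rw [← hQ] at HA
    have hω0 : 0 < ω := by linarith
    have hQ0 : 0 < Q := by rw [hQ]; positivity
    have hc := cauchy_poly (Pn m ν n ^ m) k p (1 / Q) (3 ^ m) (by positivity) (fun z hz => by
      rw [hexp, norm_pow]
      refine pow_le_pow_left₀ (norm_nonneg _) (HA z ?_) m
      rw [hz]
      exact le_of_eq (by field_simp))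
    refine hc.trans ?_
    have hQle : Q ≤ Ca * V * (ω ^ n) ^ 6 := by
      calc Q ≤ Ca * (ω ^ n) ^ 4 * (V * ω ^ n) * ω ^ n := by
            rw [hQ]
            have := hωn n
            have := hmA n
            gcongr
        _ = _ := by ring
    have hQk : Q ^ k ≤ (Ca * V) ^ k * (3 / 2) ^ n := by
      calc Q ^ k ≤ (Ca * V * (ω ^ n) ^ 6) ^ k := pow_le_pow_left₀ hQ0.le hQle k
        _ = (Ca * V) ^ k * (ω ^ (6 * k)) ^ n := by
            rw [mul_pow, ← pow_mul, ← pow_mul, ← pow_mul]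
            congr 2
            ring
        _ ≤ _ := by gcongr
    have e : (k.factorial : ℝ) * 3 ^ m / (1 / Q) ^ k = k.factorial * 3 ^ m * Q ^ k := by
      rw [one_div, inv_pow, div_inv_eq_mul]
    rw [e]
    have h6 := mul_le_mul_of_nonneg_left hQk
      (by positivity : 0 ≤ (k.factorial : ℝ) * 3 ^ m)
    have h7 : 0 ≤ (k.factorial : ℝ) * Cb * (3 / 2) ^ n := by positivity
    linarith
  · push Not at hno
    obtain ⟨j, hj, x, hx, hxj, hviol⟩ := hno
    have hm0 : (0 : ℝ) < m := by linarith
    have hc := cauchy_poly (Pn m ν n ^ m) k p (1 / (100 * (m : ℝ) ^ n)) ((1 / 2) ^ (m ^ (n / A2)))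
      (by positivity) (fun z hz => by
        rw [hexp, norm_pow]
        have h1 := caseB m hm hν n (hs1 n) p hp0 hp1 j x hx (hxj.trans (Nat.sub_le _ _)) hviol z (by
          rw [hz]
          exact le_of_eq (by field_simp))
        have h2 : (1 / 2 : ℝ) ^ (m ^ (n - (j + (x - 2)))) ≤ (1 / 2) ^ (m ^ (n / A2)) := by
          refine pow_le_pow_of_le_one (by norm_num) (by norm_num) ?_
          refine Nat.pow_le_pow_right (by omega) ?_
          obtain ⟨r, hr⟩ : ∃ r, r = n / A2 := ⟨_, rfl⟩
          have : r ≤ n := hr ▸ Nat.div_le_self _ _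
          rw [← hr] at hxj ⊢
          omega
        have h3 := h1.trans h2
        have h4 : (1 / 2 : ℝ) ^ (m ^ (n / A2)) ≤ 1 := pow_le_one₀ (by norm_num) (by norm_num)
        refine le_trans ?_ h3
        exact pow_le_of_le_one (norm_nonneg _) (h3.trans h4) (by omega))
    refine hc.trans ?_
    have e : (k.factorial : ℝ) * (1 / 2) ^ (m ^ (n / A2)) / (1 / (100 * (m : ℝ) ^ n)) ^ k
        = k.factorial * ((100 * (m : ℝ) ^ n) ^ k * (1 / 2) ^ (m ^ (n / A2))) := by
      rw [one_div (100 * (m : ℝ) ^ n), inv_pow, div_inv_eq_mul]; ring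
    rw [e]
    have h6 := mul_le_mul_of_nonneg_left (hCb n) (by positivity : 0 ≤ (k.factorial : ℝ))
    have h7 : 0 ≤ (k.factorial : ℝ) * 3 ^ m * (Ca * V) ^ k * (3 / 2) ^ n := by positivity
    have h8 : (k.factorial : ℝ) * Cb * 1 ≤ k.factorial * Cb * (3 / 2) ^ n :=
      mul_le_mul_of_nonneg_left h32 (by positivity)
    linarith



/-! ### Limits of derivatives -/

lemma poly_taylor (f : ℝ[X]) (M : ℝ) (hM : 0 ≤ M)
    (hf : ∀ x ∈ Set.Icc (0 : ℝ) 1, |(derivative (derivative f)).eval x| ≤ M)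
    (p q : ℝ) (hp : p ∈ Set.Icc (0 : ℝ) 1) (hq : q ∈ Set.Icc (0 : ℝ) 1) :
    |f.eval q - f.eval p - (q - p) * (derivative f).eval p| ≤ M * |q - p| ^ 2 := by
  have h1 : ∀ x ∈ Set.Icc (0 : ℝ) 1, |(derivative f).eval x - (derivative f).eval p| ≤ M * |x - p| := by
    intro x hx
    have := (convex_Icc (0 : ℝ) 1).norm_image_sub_le_of_norm_hasDerivWithin_le
      (f := fun x => (derivative f).eval x) (f' := fun x => (derivative (derivative f)).eval x)
      (C := M) (fun y _ => ((derivative f).hasDerivAt y).hasDerivWithinAt)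
      (fun y hy => by rw [Real.norm_eq_abs]; exact hf y hy) hp hx
    simpa [Real.norm_eq_abs] using this
  have hsub : Set.uIcc p q ⊆ Set.Icc (0 : ℝ) 1 := by
    rw [← Set.uIcc_of_le (zero_le_one' ℝ)] at hp hq ⊢
    exact Set.uIcc_subset_uIcc hp hq
  have h2 := (convex_uIcc p q).norm_image_sub_le_of_norm_hasDerivWithin_le
      (f := fun x => f.eval x - x * (derivative f).eval p)
      (f' := fun x => (derivative f).eval x - 1 * (derivative f).eval p)
      (C := M * |q - p|)
      (fun y _ => ((f.hasDerivAt y).sub ((hasDerivAt_id y).mul_const _)).hasDerivWithinAt)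
      (fun y hy => by
        rw [Real.norm_eq_abs, one_mul]
        refine (h1 y (hsub hy)).trans (mul_le_mul_of_nonneg_left ?_ hM)
        exact Set.abs_sub_left_of_mem_uIcc hy)
      Set.left_mem_uIcc Set.right_mem_uIcc
  simp only [Real.norm_eq_abs] at h2
  calc _ = |f.eval q - q * (derivative f).eval p - (f.eval p - p * (derivative f).eval p)| := by
        congr 1; ring
    _ ≤ _ := h2
    _ = _ := by ring

lemma poly_limit (Q : ℕ → ℝ[X])
    (h : ∀ k : ℕ, ∃ (K : ℝ) (n0 : ℕ), 0 ≤ K ∧ ∀ n ≥ n0, ∀ p ∈ Set.Icc (0 : ℝ) 1,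
      |(derivative^[k] (Q (n + 1))).eval p - (derivative^[k] (Q n)).eval p| ≤ K * (3 / 4) ^ n)
    (F : ℝ → ℝ) (hF : ∀ p ∈ Set.Icc (0 : ℝ) 1, Tendsto (fun n => (Q n).eval p) atTop (nhds (F p))) :
    ∀ k : ℕ, ∀ p ∈ Set.Icc (0 : ℝ) 1, Tendsto (fun n => (derivative^[k] (Q n)).eval p) atTop
      (nhds (iteratedDerivWithin k F (Set.Icc 0 1) p)) := by
  have hex : ∀ k : ℕ, ∀ p : ℝ, ∃ l : ℝ, p ∈ Set.Icc (0 : ℝ) 1 →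
      Tendsto (fun n => (derivative^[k] (Q n)).eval p) atTop (nhds l) := by
    intro k p
    by_cases hp : p ∈ Set.Icc (0 : ℝ) 1
    · obtain ⟨K, n0, hK, H⟩ := h k
      have hc : CauchySeq (fun n => (derivative^[k] (Q (n + n0))).eval p) := by
        refine cauchySeq_of_le_geometric (3 / 4) K (by norm_num) fun n => ?_
        rw [dist_comm, Real.dist_eq]
        have h1 := H (n + n0) (by omega) p hp
        have h2 : (3 / 4 : ℝ) ^ (n + n0) ≤ (3 / 4) ^ n :=
          pow_le_pow_of_le_one (by norm_num) (by norm_num) (by omega)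
        have h3 := mul_le_mul_of_nonneg_left h2 hK
        rw [show n + 1 + n0 = n + n0 + 1 by omega]
        exact h1.trans h3
      obtain ⟨l, hl⟩ := cauchySeq_tendsto_of_complete hc
      exact ⟨l, fun _ => (tendsto_add_atTop_iff_nat
        (f := fun n => (derivative^[k] (Q n)).eval p) n0).1 hl⟩
    · exact ⟨0, fun hp' => absurd hp' hp⟩
  choose G hG using hex
  have hbd : ∀ k : ℕ, ∃ (M : ℝ) (n0 : ℕ), 0 ≤ M ∧ ∀ n ≥ n0, ∀ p ∈ Set.Icc (0 : ℝ) 1,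
      |(derivative^[k] (Q n)).eval p| ≤ M := by
    intro k
    obtain ⟨K, n0, hK, H⟩ := h k
    obtain ⟨M0, hM0⟩ := isCompact_Icc.exists_bound_of_continuousOn (s := Set.Icc (0 : ℝ) 1)
      (f := fun p => (derivative^[k] (Q n0)).eval p) (Polynomial.continuous _).continuousOn
    simp only [Real.norm_eq_abs] at hM0
    have hM00 : 0 ≤ M0 := (abs_nonneg _).trans (hM0 0 (by simp))
    have hd : ∀ d : ℕ, ∀ p ∈ Set.Icc (0 : ℝ) 1,
        |(derivative^[k] (Q (n0 + d))).eval p| ≤ M0 + K * (4 * (1 - (3 / 4) ^ d)) := by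
      intro d p hp
      induction d with
      | zero => simpa using hM0 p hp
      | succ d ih =>
        have h1 := H (n0 + d) (by omega) p hp
        have h2 : (3 / 4 : ℝ) ^ (n0 + d) ≤ (3 / 4) ^ d :=
          pow_le_pow_of_le_one (by norm_num) (by norm_num) (by omega)
        have h3 := mul_le_mul_of_nonneg_left h2 hK
        rw [show n0 + (d + 1) = n0 + d + 1 by omega]
        have h4 := abs_sub_abs_le_abs_sub ((derivative^[k] (Q (n0 + d + 1))).eval p)
          ((derivative^[k] (Q (n0 + d))).eval p)
        rw [pow_succ]
        linarith
    refine ⟨M0 + K * 4, n0, by positivity, fun n hn p hp => ?_⟩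
    obtain ⟨d, rfl⟩ : ∃ d, n = n0 + d := ⟨n - n0, by omega⟩
    refine (hd d p hp).trans ?_
    have : 0 ≤ K * (3 / 4) ^ d := by positivity
    linarith
  have hder : ∀ k : ℕ, ∀ p ∈ Set.Icc (0 : ℝ) 1,
      HasDerivWithinAt (G k) (G (k + 1) p) (Set.Icc 0 1) p := by
    intro k p hp
    obtain ⟨M, n0, hM, H⟩ := hbd (k + 2)
    have hq : ∀ q ∈ Set.Icc (0 : ℝ) 1,
        |G k q - G k p - (q - p) * G (k + 1) p| ≤ M * |q - p| ^ 2 := by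
      intro q hq
      have ht := (((hG k q hq).sub (hG k p hp)).sub ((hG (k + 1) p hp).const_mul (q - p))).abs
      refine le_of_tendsto ht ?_
      filter_upwards [eventually_ge_atTop n0] with n hn
      have := poly_taylor (derivative^[k] (Q n)) M hM (fun x hx => by
        have := H n hn x hx
        rwa [Function.iterate_succ_apply', Function.iterate_succ_apply'] at this) p q hp hq
      rwa [← Function.iterate_succ_apply' derivative k (Q n)] at this
    rw [hasDerivWithinAt_iff_isLittleO]
    have hb : (fun q => G k q - G k p - (q - p) • G (k + 1) p) =O[nhdsWithin p (Set.Icc 0 1)]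
        fun q => (q - p) ^ 2 := by
      refine Asymptotics.IsBigO.of_bound M ?_
      filter_upwards [self_mem_nhdsWithin] with q hq'
      rw [smul_eq_mul, Real.norm_eq_abs, norm_pow, Real.norm_eq_abs]
      exact hq q hq'
    refine hb.trans_isLittleO ?_
    have h2 : (fun q : ℝ => (q - p) ^ 2) =o[nhds p] fun q => (q - p) := by
      have := (Asymptotics.isLittleO_pow_id (𝕜 := ℝ) (n := 2) (by norm_num)).comp_tendsto
        (k := fun q : ℝ => q - p) (l' := nhds p) (by
          have h3 : Tendsto (fun q : ℝ => q - p) (nhds p) (nhds (p - p)) :=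
            (continuous_id.sub continuous_const).tendsto p
          rwa [sub_self] at h3)
      exact this
    exact h2.mono nhdsWithin_le_nhds
  have hEq : ∀ k : ℕ, ∀ p ∈ Set.Icc (0 : ℝ) 1,
      iteratedDerivWithin k F (Set.Icc 0 1) p = G k p := by
    intro k
    induction k with
    | zero =>
      intro p hp
      rw [iteratedDerivWithin_zero]
      exact tendsto_nhds_unique (hF p hp) (hG 0 p hp)
    | succ k ih =>
      intro p hp
      rw [iteratedDerivWithin_succ, derivWithin_congr (fun q hq => ih q hq) (ih p hp)]
      exact (hder k p hp).derivWithin ((uniqueDiffOn_Icc zero_lt_one) p hp)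
  intro k p hp
  rw [hEq k p hp]
  exact hG k p hp

/-- `E(X_n)/m^n` as a polynomial. -/
def Qn (m : ℕ) (ν : ℕ → ℝ) (n : ℕ) : ℝ[X] :=
  C (∑' j : ℕ, (j : ℝ) * ν j) * X +
    ∑ i ∈ Finset.range n, C (1 / (m : ℝ) ^ (i + 1)) * (Pn m ν i ^ m - 1)

lemma eval_Qn (m : ℕ) (hm : 2 ≤ m) (ν : ℕ → ℝ) (n : ℕ) (q : ℝ) :
    (Qn m ν n).eval q = drE m ν q n / (m : ℝ) ^ n := by
  have hm' : (2 : ℝ) ≤ m := by exact_mod_cast hm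
  have hm0 : (m : ℝ) ≠ 0 := by linarith
  have hm1 : (m : ℝ) - 1 ≠ 0 := by linarith
  have hg : ∀ n : ℕ, ((m : ℝ) ^ n - 1) / ((m : ℝ) - 1) =
      ∑ i ∈ Finset.range n, (m : ℝ) ^ (n - i - 1) := by
    intro n
    rw [← geom_sum_eq (by linarith : (m : ℝ) ≠ 1), ← Finset.sum_range_reflect]
    refine Finset.sum_congr rfl fun i _ => ?_
    congr 1; omega
  rw [drE, hg]
  simp only [Qn, eval_add, eval_mul, eval_C, eval_X, eval_finsetSum, eval_sub, eval_pow, eval_one,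
    eval_Pn]
  rw [eq_div_iff (pow_ne_zero _ hm0), add_mul, Finset.sum_mul, sub_add, ← Finset.sum_sub_distrib,
    sub_eq_add_neg, ← Finset.sum_neg_distrib]
  congr 1
  · ring
  · refine Finset.sum_congr rfl fun i hi => ?_
    rw [Finset.mem_range] at hi
    have e : (m : ℝ) ^ n = (m : ℝ) ^ (n - i - 1) * (m : ℝ) ^ (i + 1) := by
      rw [← pow_add]; congr 1; omega
    rw [e]
    field_simp
    ring

lemma Qn_diff (m : ℕ) (hm : 2 ≤ m) {ν : ℕ → ℝ} (hν0 : ν 0 = 0) (hν : ∀ x, 0 ≤ ν x)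
    (hsum : HasSum ν 1) (x0 : ℕ) (hx0 : 2 ≤ x0) (hv : 0 < ν x0)
    (hint : ∀ s : ℝ, 0 ≤ s → s < (m : ℝ) → Summable fun k : ℕ => ν k * s ^ k) (k : ℕ) :
    ∃ (K : ℝ) (n0 : ℕ), 0 ≤ K ∧ ∀ n ≥ n0, ∀ p ∈ Set.Icc (0 : ℝ) 1,
      |(derivative^[k] (Qn m ν (n + 1))).eval p - (derivative^[k] (Qn m ν n)).eval p|
        ≤ K * (3 / 4) ^ n := by
  obtain ⟨K, n0, hK, H⟩ := key m hm hν0 hν hsum x0 hx0 hv hint k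
  have hm' : (2 : ℝ) ≤ m := by exact_mod_cast hm
  refine ⟨K + 1, n0, by linarith, fun n hn p hp => ?_⟩
  have e : Qn m ν (n + 1) = Qn m ν n + C (1 / (m : ℝ) ^ (n + 1)) * (Pn m ν n ^ m - 1) := by
    rw [Qn, Qn, Finset.sum_range_succ, add_assoc]
  rw [e, iterate_map_add, iterate_derivative_C_mul, iterate_derivative_sub, eval_add,
    add_sub_cancel_left, eval_mul, eval_C, eval_sub]
  have h1 := H n hn p hp.1 hp.2
  have h2 : |(derivative^[k] (1 : ℝ[X])).eval p| ≤ 1 := by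
    cases k with
    | zero => simp
    | succ k => rw [iterate_derivative_one (by omega)]; simp
  have h3 : (1 : ℝ) ≤ (3 / 2) ^ n := one_le_pow₀ (by norm_num)
  have h4 := abs_sub (eval p (derivative^[k] (Pn m ν n ^ m))) ((derivative^[k] (1 : ℝ[X])).eval p)
  have h5 : 1 / (m : ℝ) ^ (n + 1) ≤ (1 / 2) ^ n := by
    rw [one_div_pow]
    apply one_div_le_one_div_of_le (by positivity)
    calc (2 : ℝ) ^ n ≤ (m : ℝ) ^ n := pow_le_pow_left₀ (by norm_num) hm' n
      _ ≤ (m : ℝ) ^ (n + 1) := pow_le_pow_right₀ (by linarith) (by omega)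
  rw [abs_mul, abs_of_nonneg (by positivity)]
  calc _ ≤ (1 / 2 : ℝ) ^ n * ((K + 1) * (3 / 2) ^ n) :=
        mul_le_mul h5 (by linarith) (abs_nonneg _) (by positivity)
    _ = (K + 1) * ((1 / 2) * (3 / 2)) ^ n := by rw [mul_pow]; ring
    _ = _ := by norm_num

end helpers

/-- If `E(s^{X_0^*}) < ∞` for all `0 ≤ s < m` (and `P(X_0^* ≥ 2) > 0`),
then for every `k ≥ 0` and `p ∈ [0,1]`,
`F^{(k)}(p) = lim_{n→∞} dᵏ/dpᵏ (E(X_n)/m^n)`. -/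
theorem free_energy_deriv_limit
    (m : ℕ) (hm : 2 ≤ m) (ν : ℕ → ℝ)
    (hν0 : ν 0 = 0) (hνnn : ∀ k, 0 ≤ ν k) (hνsum : ∑' k, ν k = 1)
    (hc1 : 0 < ∑' k, ν (k + 2))
    (hint : ∀ s : ℝ, 0 ≤ s → s < (m : ℝ) → Summable fun k : ℕ => ν k * s ^ k)
    (F : ℝ → ℝ)
    (hF : ∀ p ∈ Set.Icc (0 : ℝ) 1,
      Tendsto (fun n : ℕ => drE m ν p n / (m : ℝ) ^ n) atTop (nhds (F p))) :
    ∀ k : ℕ, ∀ p ∈ Set.Icc (0 : ℝ) 1,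
      Tendsto (fun n : ℕ => iteratedDeriv k (fun q => drE m ν q n / (m : ℝ) ^ n) p)
        atTop (nhds (iteratedDerivWithin k F (Set.Icc 0 1) p)) := by
  have hsum : HasSum ν 1 := by
    have hs : Summable ν := by
      by_contra hn
      rw [tsum_eq_zero_of_not_summable hn] at hνsum
      exact zero_ne_one hνsum
    exact hνsum ▸ hs.hasSum
  obtain ⟨x0, hx0, hv⟩ : ∃ x0, 2 ≤ x0 ∧ 0 < ν x0 := by
    by_contra hn
    push Not at hn
    have : ∑' k, ν (k + 2) ≤ 0 := tsum_nonpos fun k => hn (k + 2) (by omega)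
    linarith
  intro k p hp
  have h := poly_limit (Qn m ν) (Qn_diff m hm hν0 hνnn hsum x0 hx0 hv hint) F
    (fun p hp => by simpa only [eval_Qn m hm ν] using hF p hp) k p hp
  refine h.congr fun n => ?_
  have e : (fun q => drE m ν q n / (m : ℝ) ^ n) = fun q => (Qn m ν n).eval q := by
    ext q; rw [eval_Qn m hm]
  rw [e, iteratedDeriv_eval]
end
end

section
/- Let n ≥ 0 and k ≥ 1 be integers, and fix values x_v ∈ {0,1,2,...} for every leaf v. Then the k-th derivative in p of P( X(v) = x_v for all leaves v ) equals (k!/(1−p)^k) · Σ_{A ⊆ leaves, |A| = k} E( 1_{{X(v)=0 for all v∈A}} · ∇^A 1_{{X(v)=x_v for all leaves v}} ). -/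
noncomputable section

/-- A configuration `ω` assigns to each leaf `v` a pair `(X_0^*(v), U(v))`.
`cfgWeight m n ν p ω` is its probability weight under the product law where each
`X_0^*(v)` has mass function `ν` and each `U(v)` is Bernoulli(`p`), independently. -/
def cfgWeight (m n : ℕ) (ν : ℕ → ℝ) (p : ℝ) (ω : (Fin n → Fin m) → ℕ × Bool) : ℝ :=
  ∏ v : Fin n → Fin m, (ν (ω v).1 * (if (ω v).2 then p else 1 - p))

/-- The leaf values `X(v) = X_0^*(v)·U(v)` of a configuration. -/
def cfgLeaf {m n : ℕ} (ω : (Fin n → Fin m) → ℕ × Bool) : (Fin n → Fin m) → ℕ :=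
  fun v => if (ω v).2 then (ω v).1 else 0

/-- `Θ^B X`: the leaf configuration equal to `X(v)` off `B` and to `X_0^*(v)` on `B`. -/
def cfgTheta {m n : ℕ} (ω : (Fin n → Fin m) → ℕ × Bool)
    (B : Finset (Fin n → Fin m)) : (Fin n → Fin m) → ℕ :=
  fun v => if v ∈ B then (ω v).1 else cfgLeaf ω v

/-- `∇^A f(X) = Σ_{B ⊆ A} (-1)^{|A|-|B|} f(Θ^B X)` for a function `f` of the leaf
configuration. -/
def cfgNabla {m n : ℕ} (ω : (Fin n → Fin m) → ℕ × Bool)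
    (A : Finset (Fin n → Fin m)) (f : ((Fin n → Fin m) → ℕ) → ℝ) : ℝ :=
  ∑ B ∈ A.powerset, (-1 : ℝ) ^ (A.card - B.card) * f (cfgTheta ω B)

theorem HasSum.congr_aux {β : Type} {f g : β → ℝ} {a : ℝ} (h : HasSum f a)
    (hfg : ∀ b, g b = f b) : HasSum g a := by
  rw [funext hfg]
  exact h

theorem hasSum_fin_aux {α : Type} : ∀ (N : ℕ) (f : Fin N → α → ℝ) (s : Fin N → ℝ)
    (_ : ∀ i, HasSum (f i) (s i)),
    HasSum (fun ω : Fin N → α => ∏ i, f i (ω i)) (∏ i, s i) := by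
  intro N
  induction N with
  | zero =>
    intro f s h
    simp
  | succ N ih =>
    intro f s h
    have h1 := ih (fun i => f i.succ) (fun i => s i.succ) (fun i => h _)
    have h3 : Summable (fun y : α × (Fin N → α) => f 0 y.1 * ∏ i : Fin N, f i.succ (y.2 i)) :=
      summable_mul_of_summable_norm (f := f 0)
        (g := fun ω : Fin N → α => ∏ i : Fin N, f i.succ (ω i)) (h 0).summable.norm
        h1.summable.norm
    have h2 := HasSum.mul (h 0) h1 h3
    rw [Fin.prod_univ_succ]
    rw [← (Fin.consEquiv (fun _ : Fin (N + 1) => α)).hasSum_iff]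
    refine h2.congr_aux ?_
    intro ω
    simp [Fin.prod_univ_succ, Fin.consEquiv]

theorem hasSum_pi_aux {α : Type} (ι : Type) [Fintype ι] (f : ι → α → ℝ) (s : ι → ℝ)
    (h : ∀ i, HasSum (f i) (s i)) :
    HasSum (fun ω : ι → α => ∏ i, f i (ω i)) (∏ i, s i) := by
  have e := (Fintype.equivFin ι).symm
  have h1 := hasSum_fin_aux (Fintype.card ι) (fun i => f (e i)) (fun i => s (e i))
    (fun i => h (e i))
  rw [e.prod_comp s, ← (Equiv.arrowCongr e.symm (Equiv.refl α)).hasSum_iff] at h1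
  refine h1.congr_aux ?_
  intro ω
  simp only [Function.comp]
  rw [← e.prod_comp]
  simp [Equiv.arrowCongr]

theorem hasSum_prod_bool_aux (F : ℕ × Bool → ℝ) (s t : ℝ)
    (hs : HasSum (fun j => F (j, true)) s) (ht : HasSum (fun j => F (j, false)) t) :
    HasSum F (s + t) := by
  have h1 : HasSum (fun a : ℕ × Bool => if a.2 then F a else 0) s := by
    rw [← Function.Injective.hasSum_iff (g := fun j : ℕ => (j, true))]
    · simpa [Function.comp_def] using hs
    · intro a b hab
      simpa using hab
    · rintro ⟨j, b⟩ hb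
      cases b <;> simp at hb ⊢
  have h2 : HasSum (fun a : ℕ × Bool => if a.2 then 0 else F a) t := by
    rw [← Function.Injective.hasSum_iff (g := fun j : ℕ => (j, false))]
    · simpa [Function.comp_def] using ht
    · intro a b hab
      simpa using hab
    · rintro ⟨j, b⟩ hb
      cases b <;> simp at hb ⊢
  convert h1.add h2 using 1
  funext ⟨j, b⟩
  cases b <;> simp

theorem hasSum_g_aux (ν : ℕ → ℝ) (hν : HasSum ν 1) (q : ℝ) (y : ℕ) :
    HasSum (fun a : ℕ × Bool => (ν a.1 * (if a.2 then q else 1 - q)) *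
      (if (if a.2 then a.1 else 0) = y then (1 : ℝ) else 0))
      (q * ν y + (1 - q) * (if 0 = y then 1 else 0)) := by
  apply hasSum_prod_bool_aux
  · convert hasSum_ite_eq y (q * ν y) using 1
    funext j
    by_cases h : j = y
    · subst h; simp [mul_comm]
    · simp [h]
  · have := hν.mul_right ((1 - q) * (if 0 = y then 1 else 0))
    rw [one_mul] at this
    refine this.congr_aux ?_
    intro j
    simp [mul_assoc]

theorem hasSum_h_aux (ν : ℕ → ℝ) (hν : HasSum ν 1) (q : ℝ) (y : ℕ) :
    HasSum (fun a : ℕ × Bool => (ν a.1 * (if a.2 then q else 1 - q)) *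
      ((if (if a.2 then a.1 else 0) = 0 then (1 : ℝ) else 0) *
      ((if a.1 = y then (1 : ℝ) else 0) - (if (if a.2 then a.1 else 0) = y then (1 : ℝ) else 0))))
      ((1 - q) * (ν y - (if 0 = y then 1 else 0))) := by
  rw [← zero_add ((1 - q) * _)]
  apply hasSum_prod_bool_aux
  · convert hasSum_zero using 1
    funext j
    simp
  · have := (hasSum_ite_eq y ((1 - q) * ν y)).sub
      (hν.mul_right ((1 - q) * (if 0 = y then 1 else 0)))
    rw [one_mul, ← mul_sub] at this
    refine this.congr_aux ?_
    intro j
    by_cases h : j = y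
    · subst h; simp; split_ifs <;> ring
    · simp [h]

theorem iteratedDeriv_pow_aux (k j : ℕ) (p : ℝ) :
    iteratedDeriv k (fun q : ℝ => (q - p) ^ j) p = if j = k then (k.factorial : ℝ) else 0 := by
  rw [iteratedDeriv_comp_sub_const k (fun q : ℝ => q ^ j) p]
  simp only [sub_self]
  rw [iteratedDeriv_fun_pow_zero]
  by_cases h : j = k
  · subst h; simp
  · have h' : k ≠ j := fun e => h e.symm
    simp [h, h']

theorem iteratedDeriv_prod_aux {ι : Type} [Fintype ι] [DecidableEq ι] (g d : ι → ℝ)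
    (k : ℕ) (p : ℝ) :
    iteratedDeriv k (fun q : ℝ => ∏ i, ((q - p) * d i + g i)) p =
      (k.factorial : ℝ) * ∑ A ∈ Finset.powersetCard k (Finset.univ : Finset ι),
        (∏ i ∈ A, d i) * ∏ i ∈ Finset.univ \ A, g i := by
  have h : (fun q : ℝ => ∏ i, ((q - p) * d i + g i)) = fun q => ∑ A ∈ (Finset.univ : Finset ι).powerset,
      ((∏ i ∈ A, d i) * ∏ i ∈ Finset.univ \ A, g i) * (q - p) ^ A.card := by
    funext q
    rw [Finset.prod_add]
    refine Finset.sum_congr rfl fun A _ => ?_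
    rw [Finset.prod_mul_distrib, Finset.prod_const]
    ring
  rw [h, iteratedDeriv_fun_sum (fun A _ => by fun_prop)]
  rw [Finset.mul_sum, Finset.powersetCard_eq_filter, Finset.sum_filter]
  refine Finset.sum_congr rfl fun A _ => ?_
  rw [iteratedDeriv_const_mul_field, iteratedDeriv_pow_aux]
  split_ifs <;> ring

theorem cfgNabla_aux {m n : ℕ} (ω : (Fin n → Fin m) → ℕ × Bool)
    (A : Finset (Fin n → Fin m)) (x : (Fin n → Fin m) → ℕ) :
    cfgNabla ω A (fun g => if ∀ v, g v = x v then (1 : ℝ) else 0) =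
      (∏ v ∈ A, ((if (ω v).1 = x v then (1 : ℝ) else 0) - (if cfgLeaf ω v = x v then (1 : ℝ) else 0)))
      * ∏ v ∈ Finset.univ \ A, (if cfgLeaf ω v = x v then (1 : ℝ) else 0) := by
  unfold cfgNabla
  simp_rw [sub_eq_add_neg]
  rw [Finset.prod_add, Finset.sum_mul]
  refine Finset.sum_congr rfl fun B hB => ?_
  rw [Finset.mem_powerset] at hB
  have h1 : (if ∀ v, cfgTheta ω B v = x v then (1 : ℝ) else 0)
      = ∏ v, if cfgTheta ω B v = x v then (1 : ℝ) else 0 := by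
    rw [Finset.prod_ite_zero]; simp
  rw [h1, ← Finset.prod_sdiff (Finset.subset_univ A), ← Finset.prod_sdiff hB, Finset.prod_neg,
    Finset.card_sdiff_of_subset hB]
  have e1 : ∏ v ∈ B, (if cfgTheta ω B v = x v then (1 : ℝ) else 0)
      = ∏ v ∈ B, (if (ω v).1 = x v then (1 : ℝ) else 0) :=
    Finset.prod_congr rfl fun v hv => by simp [cfgTheta, hv]
  have e2 : ∏ v ∈ A \ B, (if cfgTheta ω B v = x v then (1 : ℝ) else 0)
      = ∏ v ∈ A \ B, (if cfgLeaf ω v = x v then (1 : ℝ) else 0) :=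
    Finset.prod_congr rfl fun v hv => by simp [cfgTheta, (Finset.mem_sdiff.1 hv).2]
  have e3 : ∏ v ∈ Finset.univ \ A, (if cfgTheta ω B v = x v then (1 : ℝ) else 0)
      = ∏ v ∈ Finset.univ \ A, (if cfgLeaf ω v = x v then (1 : ℝ) else 0) :=
    Finset.prod_congr rfl fun v hv => by
      have : v ∉ B := fun h => (Finset.mem_sdiff.1 hv).2 (hB h)
      simp [cfgTheta, this]
  rw [e1, e2, e3]
  ring

/-- Lemma 3.1. For `n ≥ 0`, `k ≥ 1` and prescribed leaf values
`x_v`, the `k`-th derivative in `p` of `P(X(v) = x_v ∀ leaves v)` equals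
`(k!/(1-p)^k) Σ_{|A|=k} E(1_{X|_A = 0} ∇^A 1_{X(v)=x_v ∀ v})`. -/
theorem deriv_leaf_probability
    (m : ℕ) (hm : 2 ≤ m) (n : ℕ) (ν : ℕ → ℝ)
    (hν0 : ν 0 = 0) (hνnn : ∀ j, 0 ≤ ν j) (hνsum : ∑' j, ν j = 1)
    (p : ℝ) (hp : p ∈ Set.Ioo (0 : ℝ) 1)
    (k : ℕ) (hk : 1 ≤ k)
    (x : (Fin n → Fin m) → ℕ) :
    iteratedDeriv k
        (fun q => ∑' ω : (Fin n → Fin m) → ℕ × Bool,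
          cfgWeight m n ν q ω * (if ∀ v, cfgLeaf ω v = x v then (1 : ℝ) else 0)) p =
      ((k.factorial : ℝ) / (1 - p) ^ k) *
        ∑ A ∈ Finset.powersetCard k (Finset.univ : Finset (Fin n → Fin m)),
          ∑' ω : (Fin n → Fin m) → ℕ × Bool,
            cfgWeight m n ν p ω * (if ∀ v ∈ A, cfgLeaf ω v = 0 then (1 : ℝ) else 0) *
              cfgNabla ω A (fun g => if ∀ v, g v = x v then (1 : ℝ) else 0) := by
  have hν : HasSum ν 1 := by
    have : Summable ν := by
      by_contra h
      rw [tsum_eq_zero_of_not_summable h] at hνsum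
      norm_num at hνsum
    rw [← hνsum]
    exact this.hasSum
  have hp1 : (1 - p) ≠ 0 := by have := hp.2; linarith
  have hP : (fun q => ∑' ω : (Fin n → Fin m) → ℕ × Bool,
          cfgWeight m n ν q ω * (if ∀ v, cfgLeaf ω v = x v then (1 : ℝ) else 0)) =
      fun q => ∏ v, ((q - p) * (ν (x v) - (if 0 = x v then 1 else 0)) +
        (p * ν (x v) + (1 - p) * (if 0 = x v then 1 else 0))) := by
    funext q
    have := hasSum_pi_aux (Fin n → Fin m) _ _ (fun v => hasSum_g_aux ν hν q (x v))
    refine HasSum.tsum_eq ?_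
    convert this using 1
    · funext ω
      rw [Finset.prod_mul_distrib, Finset.prod_ite_zero]
      simp only [cfgWeight, cfgLeaf, Finset.mem_univ, true_imp_iff, Finset.prod_const_one]
      congr!
    · exact Finset.prod_congr rfl fun v _ => by ring
  rw [hP, iteratedDeriv_prod_aux, Finset.mul_sum, Finset.mul_sum]
  refine Finset.sum_congr rfl fun A hA => ?_
  have hcard := (Finset.mem_powersetCard.1 hA).2
  have hE : HasSum (fun ω : (Fin n → Fin m) → ℕ × Bool =>
            cfgWeight m n ν p ω * (if ∀ v ∈ A, cfgLeaf ω v = 0 then (1 : ℝ) else 0) *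
              cfgNabla ω A (fun g => if ∀ v, g v = x v then (1 : ℝ) else 0))
      ((∏ v ∈ A, ((1 - p) * (ν (x v) - (if 0 = x v then 1 else 0)))) *
        ∏ v ∈ Finset.univ \ A, (p * ν (x v) + (1 - p) * (if 0 = x v then 1 else 0))) := by
    have := hasSum_pi_aux (Fin n → Fin m)
      (fun v (a : ℕ × Bool) => (ν a.1 * (if a.2 then p else 1 - p)) * (if v ∈ A then
        ((if (if a.2 then a.1 else 0) = 0 then (1 : ℝ) else 0) *
      ((if a.1 = x v then (1 : ℝ) else 0) -
        (if (if a.2 then a.1 else 0) = x v then (1 : ℝ) else 0)))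
        else (if (if a.2 then a.1 else 0) = x v then (1 : ℝ) else 0)))
      (fun v => if v ∈ A then ((1 - p) * (ν (x v) - (if 0 = x v then 1 else 0))) else
        (p * ν (x v) + (1 - p) * (if 0 = x v then 1 else 0)))
      (fun v => by
        by_cases hv : v ∈ A
        · simp only [hv, if_true]; exact hasSum_h_aux ν hν p (x v)
        · simp only [hv, if_false]; exact hasSum_g_aux ν hν p (x v))
    have split : ∀ a b : (Fin n → Fin m) → ℝ, (∏ v, if v ∈ A then a v else b v) =
        (∏ v ∈ A, a v) * ∏ v ∈ Finset.univ \ A, b v := by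
      intro a b
      rw [← Finset.prod_sdiff (Finset.subset_univ A), mul_comm]
      congr 1
      · exact Finset.prod_congr rfl fun v hv => by simp [hv]
      · exact Finset.prod_congr rfl fun v hv => by simp [(Finset.mem_sdiff.1 hv).2]
    rw [split] at this
    convert this using 1
    funext ω
    have hz : (if ∀ v ∈ A, cfgLeaf ω v = 0 then (1 : ℝ) else 0) =
        ∏ v ∈ A, if (if (ω v).2 then (ω v).1 else 0) = 0 then (1 : ℝ) else 0 := by
      rw [Finset.prod_ite_zero]
      simp only [cfgLeaf, Finset.prod_const_one]
      congr!
    rw [Finset.prod_mul_distrib, split, Finset.prod_mul_distrib (s := A), cfgNabla_aux, hz]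
    simp only [cfgWeight, cfgLeaf, mul_assoc]
    congr!
  rw [hE.tsum_eq, Finset.prod_mul_distrib, Finset.prod_const, hcard]
  field_simp
end
end

section
/- Fix an integer λ ≥ 2 and a real θ > 0. Let (X_n)_{n≥0} be a Derrida–Retaux system whose initial variable X_0 satisfies X_0 ≤ λ almost surely and E( ((m−1)X_0 − 1)·m^{X_0} ) ≥ θ. Then there exist a positive integer K_2 = K_2(m, λ, θ) and a constant K_3 = K_3(m, λ, θ) > 0 such that P(X_{K_2 + n} = 0) ≤ exp(−K_3 · m^n) for every integer n ≥ 0. -/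
noncomputable section

open Polynomial in
/-- Polynomial form of the step. -/
def drT (m : ℕ) (P : Polynomial ℝ) : Polynomial ℝ := divX (P ^ m) + C (P.coeff 0 ^ m)

open Polynomial in
/-- The functional `(m-1) s G'(s) - G(s)`. -/
def drD (m : ℕ) (P : Polynomial ℝ) (s : ℝ) : ℝ :=
  ((m : ℝ) - 1) * (s * (derivative P).eval s) - P.eval s

/-- Partial sums of coefficients. -/
def drA (k : ℕ) (P : Polynomial ℝ) : ℝ := ∑ j ∈ Finset.range (k + 1), P.coeff j

open Polynomial

lemma dr_coeff_pow (m : ℕ) (P : Polynomial ℝ) (n : ℕ) :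
    (P ^ m).coeff n = ∑ x ∈ Fintype.piFinset (fun _ : Fin m => Finset.range (P.natDegree + 1)),
      if ∑ i, x i = n then ∏ i, P.coeff (x i) else 0 := by
  have h1 : P ^ m = ∏ _i : Fin m, ∑ j ∈ Finset.range (P.natDegree + 1), monomial j (P.coeff j) := by
    rw [← P.as_sum_range]; simp
  rw [h1, Finset.prod_univ_sum, finsetSum_coeff]
  refine Finset.sum_congr rfl fun x _ => ?_
  have : ∏ i, monomial (x i) (P.coeff (x i)) = monomial (∑ i, x i) (∏ i, P.coeff (x i)) := by
    induction (Finset.univ : Finset (Fin m)) using Finset.induction_on with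
    | empty => simp
    | insert a s ha ih =>
      rw [Finset.prod_insert ha, Finset.sum_insert ha, Finset.prod_insert ha, ih,
        monomial_mul_monomial]
  rw [this, coeff_monomial]

lemma drStep_coeff (m : ℕ) (P : Polynomial ℝ) : drStep m P.coeff = (drT m P).coeff := by
  funext j
  unfold drStep
  rw [tsum_eq_sum (s := Fintype.piFinset (fun _ : Fin m => Finset.range (P.natDegree + 1)))]
  · have h0 : P.coeff 0 ^ m = (P ^ m).coeff 0 := by
      simp [coeff_zero_eq_eval_zero]
    unfold drT
    rw [coeff_add, coeff_divX, coeff_C, h0, dr_coeff_pow, dr_coeff_pow]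
    by_cases hj : j = 0
    · subst hj
      rw [if_pos rfl, ← Finset.sum_add_distrib]
      refine Finset.sum_congr rfl fun x _ => ?_
      rcases Nat.lt_trichotomy (∑ i, x i) 1 with h | h | h
      · have : ∑ i, x i = 0 := by omega
        simp only [this]; simp
      · simp only [h]; simp
      · rw [if_neg (by omega), if_neg (by omega), if_neg (by omega)]; simp
    · rw [if_neg hj, add_zero]
      refine Finset.sum_congr rfl fun x _ => ?_
      have : ((∑ i, x i) - 1 = j) ↔ (∑ i, x i = j + 1) := by omega
      simp only [this]
  · intro x hx
    rw [Fintype.mem_piFinset] at hx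
    push Not at hx
    obtain ⟨i, hi⟩ := hx
    have : P.coeff (x i) = 0 := by
      apply coeff_eq_zero_of_natDegree_lt
      rw [Finset.mem_range, not_lt] at hi
      omega
    rw [Finset.prod_eq_zero (Finset.mem_univ i) this]; simp

lemma drStep_iter (m : ℕ) (P : Polynomial ℝ) (n : ℕ) :
    (drStep m)^[n] P.coeff = ((drT m)^[n] P).coeff := by
  induction n with
  | zero => rfl
  | succ n ih => rw [Function.iterate_succ_apply', Function.iterate_succ_apply', ih, drStep_coeff]

/-- Nonnegative coefficients of total mass one. -/
def drProb (P : Polynomial ℝ) : Prop := (∀ j, 0 ≤ P.coeff j) ∧ P.eval 1 = 1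

lemma drT_id (m : ℕ) (P : Polynomial ℝ) :
    drT m P * X = P ^ m + (X - 1) * C (P.coeff 0 ^ m) := by
  have h0 : (P ^ m).coeff 0 = P.coeff 0 ^ m := by
      simp [coeff_zero_eq_eval_zero]
  have := divX_mul_X_add (P ^ m)
  rw [h0] at this
  unfold drT
  linear_combination this

lemma drT_eval (m : ℕ) (P : Polynomial ℝ) (s : ℝ) :
    (drT m P).eval s * s = P.eval s ^ m + (s - 1) * P.coeff 0 ^ m := by
  simpa using congrArg (eval s) (drT_id m P)

lemma drT_deriv (m : ℕ) (P : Polynomial ℝ) (s : ℝ) :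
    (derivative (drT m P)).eval s * s + (drT m P).eval s
      = m * P.eval s ^ (m - 1) * (derivative P).eval s + P.coeff 0 ^ m := by
  have := congrArg (fun Q => eval s (derivative Q)) (drT_id m P)
  simpa [derivative_pow, derivative_mul] using this

lemma drD_step (m : ℕ) (hm : 2 ≤ m) (P : Polynomial ℝ) (s : ℝ) :
    s * drD m (drT m P) s = m * P.eval s ^ (m - 1) * drD m P s + P.coeff 0 ^ m * (m - s) := by
  obtain ⟨k, rfl⟩ : ∃ k, m = k + 1 := ⟨m - 1, by omega⟩
  have h1 := drT_eval (k+1) P s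
  have h2 := drT_deriv (k+1) P s
  unfold drD
  simp only [Nat.add_sub_cancel] at *
  push_cast at *
  rw [pow_succ (eval s P)] at h1
  linear_combination (k * s) * h2 - (k + 1 : ℝ) * h1

lemma coeff_pow_nonneg (m : ℕ) (P : Polynomial ℝ) (h : ∀ j, 0 ≤ P.coeff j) (j : ℕ) :
    0 ≤ (P ^ m).coeff j := by
  rw [dr_coeff_pow]
  refine Finset.sum_nonneg fun x _ => ?_
  split_ifs
  · exact Finset.prod_nonneg fun i _ => h _
  · exact le_rfl

lemma drProb_step (m : ℕ) (P : Polynomial ℝ) (h : drProb P) : drProb (drT m P) := by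
  refine ⟨fun j => ?_, ?_⟩
  · unfold drT
    rw [coeff_add, coeff_divX, coeff_C]
    have := coeff_pow_nonneg m P h.1 (j+1)
    have h0 := pow_nonneg (h.1 0) m
    split_ifs <;> linarith
  · have := drT_eval m P 1
    rw [h.2] at this
    simpa using this

lemma drProb_iter (m : ℕ) (P : Polynomial ℝ) (h : drProb P) (n : ℕ) :
    drProb ((drT m)^[n] P) := by
  induction n with
  | zero => exact h
  | succ n ih => rw [Function.iterate_succ_apply']; exact drProb_step m _ ih

lemma drT_deg (m : ℕ) (P : Polynomial ℝ) : (drT m P).natDegree ≤ m * P.natDegree := by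
  unfold drT
  refine (natDegree_add_le _ _).trans ?_
  rw [natDegree_C]
  simp only [zero_le, sup_of_le_left]
  refine le_trans ?_ (natDegree_pow_le (p := P) (n := m))
  rw [natDegree_divX_eq_natDegree_tsub_one]; omega

lemma drT_deg_iter (m : ℕ) (P : Polynomial ℝ) (L : ℕ) (h : P.natDegree ≤ L) (n : ℕ) :
    ((drT m)^[n] P).natDegree ≤ L * m ^ n := by
  induction n with
  | zero => simpa using h
  | succ n ih =>
    rw [Function.iterate_succ_apply']
    calc _ ≤ m * _ := drT_deg m _
      _ ≤ m * (L * m ^ n) := Nat.mul_le_mul_left _ ih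
      _ = _ := by ring

lemma dr_eval_sum (P : Polynomial ℝ) (B : ℕ) (h : P.natDegree ≤ B) (s : ℝ) :
    P.eval s = ∑ j ∈ Finset.range (B + 1), P.coeff j * s ^ j :=
  eval_eq_sum_range' (by omega) s

lemma dr_deriv_sum (P : Polynomial ℝ) (B : ℕ) (h : P.natDegree ≤ B) (s : ℝ) :
    s * (derivative P).eval s = ∑ j ∈ Finset.range (B + 1), j * (P.coeff j * s ^ j) := by
  rw [derivative_eval, sum_over_range' _ (by simp) (B+1) (by omega), Finset.mul_sum]
  refine Finset.sum_congr rfl fun j _ => ?_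
  cases j with
  | zero => simp
  | succ j => simp; ring

lemma drD_sum (m : ℕ) (P : Polynomial ℝ) (B : ℕ) (h : P.natDegree ≤ B) (s : ℝ) :
    drD m P s = ∑ j ∈ Finset.range (B + 1), (((m : ℝ) - 1) * j - 1) * s ^ j * P.coeff j := by
  unfold drD
  rw [dr_deriv_sum P B h, dr_eval_sum P B h, Finset.mul_sum, ← Finset.sum_sub_distrib]
  exact Finset.sum_congr rfl fun j _ => by ring

lemma drA_nonneg (k : ℕ) (P : Polynomial ℝ) (h : ∀ j, 0 ≤ P.coeff j) : 0 ≤ drA k P :=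
  Finset.sum_nonneg fun j _ => h j

lemma drA_mul (k : ℕ) (P Q : Polynomial ℝ) (hP : ∀ j, 0 ≤ P.coeff j) (hQ : ∀ j, 0 ≤ Q.coeff j) :
    drA k (P * Q) ≤ drA k P * drA k Q := by
  unfold drA
  rw [Finset.sum_mul_sum, ← Finset.sum_product']
  simp only [coeff_mul]
  rw [Finset.sum_sigma']
  refine le_trans (le_of_eq ?_) (Finset.sum_le_sum_of_subset_of_nonneg
    (s := (Finset.range (k+1) ×ˢ Finset.range (k+1)).filter (fun x => x.1 + x.2 ≤ k))
    (Finset.filter_subset _ _) ?_)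
  · refine Finset.sum_bij' (fun x _ => x.2) (fun x _ => ⟨x.1 + x.2, x⟩) ?_ ?_ ?_ ?_ ?_
    · rintro ⟨a, b, c⟩ h; simp at h ⊢; omega
    · rintro ⟨b, c⟩ h; simp at h ⊢; omega
    · rintro ⟨a, b, c⟩ h; simp at h ⊢; omega
    · rintro ⟨b, c⟩ h; rfl
    · rintro ⟨a, b, c⟩ h; rfl
  · intro x _ _; exact mul_nonneg (hP _) (hQ _)

lemma drA_pow (k m : ℕ) (P : Polynomial ℝ) (hP : ∀ j, 0 ≤ P.coeff j) :
    drA k (P ^ m) ≤ drA k P ^ m := by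
  induction m with
  | zero =>
    simp [drA, coeff_one]
  | succ m ih =>
    rw [pow_succ, pow_succ]
    exact (drA_mul k _ _ (coeff_pow_nonneg m P hP) hP).trans
      (mul_le_mul_of_nonneg_right ih (drA_nonneg k P hP))

lemma drA_step (k m : ℕ) (P : Polynomial ℝ) (hP : ∀ j, 0 ≤ P.coeff j) :
    drA k (drT m P) ≤ drA (k + 1) P ^ m := by
  refine le_trans (le_of_eq ?_) (drA_pow (k+1) m P hP)
  have h0 : P.coeff 0 ^ m = (P ^ m).coeff 0 := by
      simp [coeff_zero_eq_eval_zero]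
  unfold drA drT
  rw [Finset.sum_range_succ' _ (k+1), h0]
  simp only [coeff_add, coeff_divX, coeff_C, Finset.sum_add_distrib]
  simp

lemma drA_iter (m : ℕ) (P : Polynomial ℝ) (h : drProb P) (l k : ℕ) :
    drA k ((drT m)^[l] P) ≤ drA (k + l) P ^ (m ^ l) := by
  induction l generalizing k with
  | zero => simp
  | succ l ih =>
    rw [Function.iterate_succ_apply']
    refine (drA_step k m _ (drProb_iter m P h l).1).trans ?_
    refine (pow_le_pow_left₀ (drA_nonneg _ _ (drProb_iter m P h l).1) (ih (k+1)) m).trans ?_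
    rw [← pow_mul, ← pow_succ, show k + 1 + l = k + (l + 1) by ring]

lemma one_le_eval (P : Polynomial ℝ) (h : drProb P) (s : ℝ) (hs : 1 ≤ s) : 1 ≤ P.eval s := by
  rw [← h.2, dr_eval_sum P _ le_rfl, dr_eval_sum P _ le_rfl s]
  refine Finset.sum_le_sum fun j _ => mul_le_mul_of_nonneg_left ?_ (h.1 j)
  rw [one_pow]; exact one_le_pow₀ hs

lemma drD_grow (m : ℕ) (hm : 2 ≤ m) (P : Polynomial ℝ) (h : drProb P) (s : ℝ) (hs : 1 ≤ s)
    (hsm : s ≤ m) (hD : 0 ≤ drD m P s) : m * drD m P s ≤ s * drD m (drT m P) s := by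
  rw [drD_step m hm]
  have h1 : 1 ≤ P.eval s ^ (m-1) := one_le_pow₀ (one_le_eval P h s hs)
  have h2 : 0 ≤ P.coeff 0 ^ m * (m - s) := mul_nonneg (pow_nonneg (h.1 0) m) (by linarith)
  have h3 : 0 ≤ (m:ℝ) * drD m P s := by positivity
  nlinarith

lemma drD_grow_iter (m : ℕ) (hm : 2 ≤ m) (P : Polynomial ℝ) (h : drProb P) (r : ℝ) (hr : 0 < r)
    (hs : 1 ≤ r * m) (hsm : r ≤ 1) (η : ℝ) (hη : 0 < η) (hD : η ≤ drD m P (r * m)) (n : ℕ) :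
    η ≤ r ^ n * drD m ((drT m)^[n] P) (r * m) := by
  have hm0 : (0:ℝ) < m := by positivity
  induction n with
  | zero => simpa using hD
  | succ n ih =>
    rw [Function.iterate_succ_apply']
    have hpos : 0 ≤ drD m ((drT m)^[n] P) (r * m) := by
      by_contra hc
      push Not at hc
      nlinarith [pow_pos hr n]
    have := drD_grow m hm _ (drProb_iter m P h n) (r * m) hs (by nlinarith) hpos
    have h2 : drD m ((drT m)^[n] P) (r * m) ≤ r * drD m (drT m ((drT m)^[n] P)) (r * m) := by
      have : m * drD m ((drT m)^[n] P) (r * m)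
        ≤ m * (r * drD m (drT m ((drT m)^[n] P)) (r * m)) := by linarith
      exact le_of_mul_le_mul_left this hm0
    calc η ≤ _ := ih
      _ ≤ _ := mul_le_mul_of_nonneg_left h2 (pow_pos hr n).le
      _ = _ := by ring

lemma drE_persist (m : ℕ) (hm : 2 ≤ m) (P : Polynomial ℝ) (h : drProb P)
    (hD : 1 ≤ drD m P 1) (n : ℕ) : 1 ≤ drD m ((drT m)^[n] P) 1 := by
  have hm0 : (2:ℝ) ≤ m := by exact_mod_cast hm
  induction n with
  | zero => simpa using hD
  | succ n ih =>
    rw [Function.iterate_succ_apply']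
    have := drD_grow m hm _ (drProb_iter m P h n) 1 le_rfl (by linarith) (by linarith)
    nlinarith

/-- Choice of `r`. -/
lemma dr_exists_r (L : ℕ) (θ : ℝ) (hθ : 0 < θ) :
    ∃ r : ℝ, 1 / 2 ≤ r ∧ r < 1 ∧ 0 < r ^ L * (1 + θ) - 1 := by
  have hc : Filter.Tendsto (fun r : ℝ => r ^ L * (1 + θ) - 1) (nhdsWithin 1 (Set.Iio 1))
      (nhds ((1:ℝ) ^ L * (1 + θ) - 1)) := by
    apply Filter.Tendsto.mono_left _ nhdsWithin_le_nhds
    exact (by fun_prop : Continuous fun r : ℝ => r ^ L * (1 + θ) - 1).tendsto 1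
  have h1 := hc.eventually (lt_mem_nhds (a := 0) (by simpa using hθ))
  have h2 : ∀ᶠ r : ℝ in nhdsWithin 1 (Set.Iio 1), r < 1 := self_mem_nhdsWithin
  have h3 : ∀ᶠ r : ℝ in nhdsWithin 1 (Set.Iio 1), 1/2 < r :=
    nhdsWithin_le_nhds (lt_mem_nhds (by norm_num))
  obtain ⟨r, hr⟩ := (h1.and (h2.and h3)).exists
  exact ⟨r, hr.2.2.le, hr.2.1, hr.1⟩

lemma coeff0_le_one (P : Polynomial ℝ) (h : drProb P) (j : ℕ) : P.coeff j ≤ 1 := by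
  by_cases hj : j ≤ P.natDegree
  · rw [← h.2, dr_eval_sum P _ le_rfl]
    have := Finset.single_le_sum (f := fun j => P.coeff j * (1:ℝ) ^ j)
      (s := Finset.range (P.natDegree + 1)) (fun i _ => by simpa using h.1 i)
      (a := j) (by simp; omega)
    simpa using this
  · rw [coeff_eq_zero_of_natDegree_lt (by omega)]; norm_num

lemma drD_init (m : ℕ) (hm : 2 ≤ m) (P : Polynomial ℝ) (h : drProb P) (L : ℕ)
    (hL : P.natDegree ≤ L) (θ : ℝ) (hD : θ ≤ drD m P m) (r : ℝ) (hr : 0 < r) (hr1 : r ≤ 1) :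
    r ^ L * (1 + θ) - 1 ≤ drD m P (r * m) := by
  have hm0 : (2:ℝ) ≤ m := by exact_mod_cast hm
  have key : r ^ L * (drD m P m + P.coeff 0) - P.coeff 0 ≤ drD m P (r * m) := by
    rw [drD_sum m P L hL, drD_sum m P L hL, Finset.sum_range_succ', Finset.sum_range_succ']
    simp only [Nat.cast_zero, mul_zero, pow_zero, mul_one, zero_sub, neg_mul, one_mul,
      neg_add_cancel_right]
    rw [Finset.mul_sum, sub_eq_add_neg]
    refine add_le_add (Finset.sum_le_sum fun j hj => ?_) le_rfl
    have hjL : j + 1 ≤ L := by simpa using hj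
    have h1 : r ^ L ≤ r ^ (j+1) := pow_le_pow_of_le_one hr.le hr1 hjL
    have h2 : 0 ≤ ((m:ℝ) - 1) * (j+1 : ℕ) - 1 := by
      push_cast
      have : (0:ℝ) ≤ j := by positivity
      nlinarith
    have h3 : 0 ≤ (((m:ℝ) - 1) * (j+1 : ℕ) - 1) * (m:ℝ) ^ (j+1) * P.coeff (j+1) :=
      mul_nonneg (mul_nonneg h2 (by positivity)) (h.1 _)
    rw [mul_pow]
    nlinarith
  have h0 := coeff0_le_one P h 0
  have hrL : r ^ L ≤ 1 := pow_le_one₀ hr.le hr1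
  have hrL0 : 0 ≤ r ^ L := by positivity
  have := h.1 0
  nlinarith

lemma drD_bound (m : ℕ) (hm : 2 ≤ m) (P : Polynomial ℝ) (h : drProb P)
    (r : ℝ) (hr : 0 < r) (hr1 : r < 1) (hc : ∀ k, P.coeff k * (m:ℝ) ^ k ≤ (m:ℝ) ^ 4) :
    drD m P (r * m) ≤ (m : ℝ) ^ 5 * ∑' k : ℕ, (k : ℝ) * r ^ k := by
  have hm0 : (2:ℝ) ≤ m := by exact_mod_cast hm
  have hs : Summable (fun k : ℕ => (k : ℝ) * r ^ k) := by
    simpa using summable_pow_mul_geometric_of_norm_lt_one 1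
      (r := r) (by rw [Real.norm_of_nonneg hr.le]; exact hr1)
  calc drD m P (r * m) ≤ m * (∑ j ∈ Finset.range (P.natDegree + 1), j * (P.coeff j * (r * m) ^ j)) := by
        unfold drD
        rw [dr_deriv_sum P _ le_rfl]
        have h1 : 0 ≤ P.eval (r * m) := by
          rw [dr_eval_sum P _ le_rfl]
          exact Finset.sum_nonneg fun j _ => mul_nonneg (h.1 j) (by positivity)
        have h2 : 0 ≤ ∑ j ∈ Finset.range (P.natDegree + 1), j * (P.coeff j * (r * m) ^ j) :=
          Finset.sum_nonneg fun j _ => mul_nonneg (by positivity) (mul_nonneg (h.1 j) (by positivity))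
        nlinarith
    _ ≤ m * (∑ j ∈ Finset.range (P.natDegree + 1), (m:ℝ)^4 * (j * r ^ j)) := by
        refine mul_le_mul_of_nonneg_left (Finset.sum_le_sum fun j _ => ?_) (by positivity)
        have := mul_le_mul_of_nonneg_left (hc j) (by positivity : (0:ℝ) ≤ j * r ^ j)
        rw [mul_pow]
        linarith
    _ = (m : ℝ) ^ 5 * ∑ j ∈ Finset.range (P.natDegree + 1), (j * r ^ j) := by
        rw [← Finset.mul_sum]; ring
    _ ≤ _ := by
        gcongr
        exact hs.sum_le_tsum _ (fun i _ => by positivity)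

lemma drA_coeff (P : Polynomial ℝ) (h : drProb P) (k : ℕ) :
    drA k P + P.coeff (k+1) ≤ 1 := by
  rw [← h.2, dr_eval_sum P (max P.natDegree (k+1)) (le_max_left _ _)]
  unfold drA
  rw [← Finset.sum_range_succ]
  simp only [one_pow, mul_one]
  refine Finset.sum_le_sum_of_subset_of_nonneg ?_ (fun i _ _ => h.1 i)
  intro x; simp; omega

lemma drA_mean (m : ℕ) (hm : 2 ≤ m) (P : Polynomial ℝ) (h : drProb P) (hA : drA 3 P ≤ 1 / 2) :
    1 ≤ drD m P 1 := by
  have hm0 : (2:ℝ) ≤ m := by exact_mod_cast hm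
  have hB : P.natDegree ≤ P.natDegree + 3 := by omega
  have hev := h.2
  rw [dr_eval_sum P _ hB] at hev
  unfold drD
  rw [h.2, dr_deriv_sum P _ hB]
  simp only [one_pow, mul_one] at *
  have hk : 4 * (1 - drA 3 P) ≤ ∑ j ∈ Finset.range (P.natDegree + 3 + 1), (j:ℝ) * P.coeff j := by
    rw [← hev]
    have : drA 3 P = ∑ j ∈ Finset.range (P.natDegree + 3 + 1), if j < 4 then P.coeff j else 0 := by
      unfold drA
      rw [← Finset.sum_filter]
      congr 1
      ext x; simp; omega
    rw [this, ← Finset.sum_sub_distrib, Finset.mul_sum]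
    refine Finset.sum_le_sum fun j _ => ?_
    have := h.1 j
    split_ifs with hj
    · simp; positivity
    · have : (4:ℝ) ≤ j := by exact_mod_cast (not_lt.mp hj)
      nlinarith
  nlinarith

lemma dr_exists_mean (m : ℕ) (hm : 2 ≤ m) (P : Polynomial ℝ) (h : drProb P) (k : ℕ)
    (hk : (m:ℝ)^4 < P.coeff k * (m:ℝ) ^ k) : ∃ l ≤ k, 1 ≤ drD m ((drT m)^[l] P) 1 := by
  have hm0 : (2:ℝ) ≤ m := by exact_mod_cast hm
  have hk4 : 4 ≤ k := by
    by_contra hc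
    have h1 : (m:ℝ) ^ k ≤ (m:ℝ)^4 := pow_le_pow_right₀ (by linarith) (by omega)
    have h2 := coeff0_le_one P h k
    have : (0:ℝ) < (m:ℝ)^k := by positivity
    nlinarith
  obtain ⟨l, rfl⟩ : ∃ l, k = 3 + l + 1 := ⟨k - 4, by
    omega⟩
  refine ⟨l, by omega, drA_mean m hm _ (drProb_iter m P h l) ?_⟩
  refine (drA_iter m P h l 3).trans ?_
  have h1 := drA_coeff P h (3 + l)
  have h2 : 1 ≤ P.coeff (3 + l + 1) * (m:ℝ) ^ l := by
    rw [show 3 + l + 1 = l + 4 by ring, pow_add, ← mul_assoc] at hk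
    have h4 : (0:ℝ) < (m:ℝ)^4 := by positivity
    rw [show 3 + l + 1 = l + 4 by ring]
    by_contra hc
    push Not at hc
    nlinarith
  set c := P.coeff (3 + l + 1)
  calc drA (3 + l) P ^ (m ^ l) ≤ (Real.exp (-c)) ^ (m ^ l) := by
        apply pow_le_pow_left₀ (drA_nonneg _ _ h.1)
        have := Real.add_one_le_exp (-c)
        linarith
    _ = Real.exp (-(c * (m:ℝ) ^ l)) := by
        rw [← Real.exp_nat_mul]; push_cast; ring_nf
    _ ≤ Real.exp (-1) := Real.exp_le_exp.mpr (by linarith)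
    _ ≤ 1 / 2 := by
        rw [Real.exp_neg, one_div]
        apply inv_anti₀ (by norm_num)
        have := Real.add_one_le_exp (1:ℝ)
        linarith

lemma dr_final (m : ℕ) (hm : 2 ≤ m) (B : ℕ) (hB : 1 ≤ B) :
    ∃ K3 : ℝ, 0 < K3 ∧ ∀ P : Polynomial ℝ, drProb P → P.natDegree ≤ B → 1 ≤ drD m P 1 →
      ∀ n : ℕ, ((drT m)^[n] P).coeff 0 ≤ Real.exp (-K3 * (m : ℝ) ^ n) := by
  have hm0 : (2:ℝ) ≤ m := by exact_mod_cast hm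
  have hB0 : (1:ℝ) ≤ B := by exact_mod_cast hB
  obtain ⟨d, rfl⟩ : ∃ d, m = d + 1 := ⟨m - 1, by omega⟩
  have hd : 1 ≤ d := by omega
  have hd0 : (1:ℝ) ≤ d := by exact_mod_cast hd
  set ε : ℝ := 1 / (2 * d * B ^ 2) with hε
  have hε0 : 0 < ε := by positivity
  have hεB : d * ε * B ^ 2 = 1 / 2 := by rw [hε]; field_simp
  have hεB1 : ε * B ≤ 1 := by
    have : ε * B ≤ d * ε * B ^ 2 := by
      have : 0 < ε * B := by positivity
      have h2 : 1 ≤ (d:ℝ) * B := by nlinarith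
      nlinarith
    linarith
  refine ⟨ε / 2 / d, by positivity, fun P h hdeg hD n => ?_⟩
  set s := Real.exp (-ε) with hs
  have hs0 : 0 < s := Real.exp_pos _
  have hs1 : s ≤ 1 := Real.exp_le_one_iff.mpr (by linarith)
  -- generating function at s
  have hG : P.eval s ≤ 1 - 2 * ε / d + ε ^ 2 * B ^ 2 := by
    have hmean : 2 ≤ d * (∑ j ∈ Finset.range (B + 1), (j:ℝ) * P.coeff j) := by
      unfold drD at hD
      rw [h.2, dr_deriv_sum P B hdeg] at hD
      simp only [one_pow, mul_one] at hD
      push_cast at hD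
      linarith
    have hmass := h.2
    rw [dr_eval_sum P B hdeg] at hmass
    simp only [one_pow, mul_one] at hmass
    have h1 : P.eval s ≤ ∑ j ∈ Finset.range (B + 1), (P.coeff j * (1 + ε ^ 2 * B ^ 2)
        - ε * (j * P.coeff j)) := by
      rw [dr_eval_sum P B hdeg]
      refine Finset.sum_le_sum fun j hj => ?_
      have hjB : (j:ℝ) ≤ B := by
        have : j ≤ B := by simp at hj; omega
        exact_mod_cast this
      have hj0 : (0:ℝ) ≤ j := by positivity
      have hsj : s ^ j = Real.exp (-(ε * j)) := by
        rw [hs, ← Real.exp_nat_mul]; ring_nf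
      have hle : ε * j ≤ 1 := by nlinarith
      have hx := Real.abs_exp_sub_one_sub_id_le (x := -(ε * j)) (by
        rw [abs_neg, abs_of_nonneg (by positivity)]; exact hle)
      have hx2 := (abs_le.mp hx).2
      have hsq : (ε * j) ^ 2 ≤ ε ^ 2 * B ^ 2 := by
        rw [← mul_pow]; gcongr
      have : s ^ j ≤ 1 + ε ^ 2 * B ^ 2 - ε * j := by rw [hsj]; nlinarith
      have := mul_le_mul_of_nonneg_left this (h.1 j)
      linarith
    rw [Finset.sum_sub_distrib, ← Finset.sum_mul, ← Finset.mul_sum, hmass] at h1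
    have h2 : 2 / (d:ℝ) ≤ ∑ j ∈ Finset.range (B + 1), (j:ℝ) * P.coeff j := by
      rw [div_le_iff₀ (by positivity)]; linarith
    have h3 := mul_le_mul_of_nonneg_left h2 hε0.le
    have h4 : 2 * ε / d = ε * (2 / d) := by ring
    linarith
  have hev0 : ∀ Q : Polynomial ℝ, drProb Q → 0 ≤ Q.coeff 0 ∧ Q.coeff 0 ≤ Q.eval s := by
    intro Q hQ
    refine ⟨hQ.1 0, ?_⟩
    rw [dr_eval_sum Q _ le_rfl, Finset.sum_range_succ']
    have : 0 ≤ ∑ k ∈ Finset.range Q.natDegree, Q.coeff (k + 1) * s ^ (k + 1) :=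
      Finset.sum_nonneg fun j _ => mul_nonneg (hQ.1 _) (by positivity)
    simpa using this
  have hGd : P.eval s ^ d ≤ s * Real.exp (-(ε / 2)) := by
    have h0 : 0 ≤ P.eval s := (hev0 P h).1.trans (hev0 P h).2
    calc P.eval s ^ d ≤ (Real.exp (- 2 * ε / d + ε ^ 2 * B ^ 2)) ^ d := by
          apply pow_le_pow_left₀ h0
          have := Real.add_one_le_exp (- 2 * ε / d + ε ^ 2 * B ^ 2)
          have h4 : - 2 * ε / d = - (2 * ε / d) := by ring
          linarith
      _ = s * Real.exp (-(ε / 2)) := by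
          rw [hs, ← Real.exp_nat_mul, ← Real.exp_add]
          congr 1
          have : (d:ℝ) * (- 2 * ε / d) = - 2 * ε := by field_simp
          linear_combination this + ε * hεB
  have hiter : ∀ n : ℕ, ((drT (d+1))^[n] P).eval s ^ d ≤ s * Real.exp (-(ε / 2)) ^ ((d + 1) ^ n) := by
    intro n
    induction n with
    | zero => simpa using hGd
    | succ n ih =>
      rw [Function.iterate_succ_apply']
      set Q := (drT (d+1))^[n] P
      have hQ : drProb Q := drProb_iter _ P h n
      have hTQ := drProb_step (d+1) Q hQ
      have h0 : 0 ≤ Q.eval s := (hev0 Q hQ).1.trans (hev0 Q hQ).2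
      have hT0 := (hev0 _ hTQ).1.trans (hev0 _ hTQ).2
      have h1 : (drT (d+1) Q).eval s * s ≤ Q.eval s ^ (d+1) := by
        rw [drT_eval]
        have := pow_nonneg (hQ.1 0) (d+1)
        nlinarith
      have h2 : ((drT (d+1) Q).eval s * s) ^ d ≤ (Q.eval s ^ (d+1)) ^ d :=
        pow_le_pow_left₀ (by positivity) h1 d
      have h3 : (Q.eval s ^ (d+1)) ^ d ≤ (s * Real.exp (-(ε / 2)) ^ ((d + 1) ^ n)) ^ (d+1) := by
        rw [← pow_mul, mul_comm (d+1) d, pow_mul]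
        exact pow_le_pow_left₀ (by positivity) ih _
      have h4 : (s * Real.exp (-(ε / 2)) ^ ((d + 1) ^ n)) ^ (d+1)
          = (s * Real.exp (-(ε / 2)) ^ ((d + 1) ^ (n+1))) * s ^ d := by
        rw [mul_pow, ← pow_mul, ← pow_succ]; ring
      have h5 : (drT (d+1) Q).eval s ^ d * s ^ d
          ≤ (s * Real.exp (-(ε / 2)) ^ ((d + 1) ^ (n+1))) * s ^ d := by
        rw [← mul_pow, ← h4]; exact h2.trans h3
      exact le_of_mul_le_mul_right h5 (by positivity)
  have hQ := drProb_iter (d+1) P h n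
  have h1 := hev0 _ hQ
  have h2 := (pow_le_pow_left₀ h1.1 h1.2 d).trans (hiter n)
  refine le_of_pow_le_pow_left₀ (n := d) (by omega) (Real.exp_pos _).le ?_
  refine h2.trans ?_
  rw [← Real.exp_nat_mul, ← Real.exp_nat_mul]
  refine (mul_le_of_le_one_left (Real.exp_pos _).le hs1).trans (le_of_eq ?_)
  congr 1
  push_cast
  field_simp

/-- Lemma 4.2. Fix `λ ≥ 2` and `θ > 0`. For any Derrida–Retaux
system with `X_0 ≤ λ` a.s. and `E(((m-1)X_0 - 1)m^{X_0}) ≥ θ`, there are `K_2 ∈ ℕ⁺`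
and `K_3 > 0`, depending only on `(m, λ, θ)`, with
`P(X_{K_2+n} = 0) ≤ exp(-K_3 m^n)` for all `n ≥ 0`. -/
theorem bounded_supercritical_doubly_exponential
    (m : ℕ) (hm : 2 ≤ m) (lam : ℕ) (hlam : 2 ≤ lam) (θ : ℝ) (hθ : 0 < θ) :
    ∃ K2 : ℕ, 0 < K2 ∧ ∃ K3 : ℝ, 0 < K3 ∧
      ∀ μ : ℕ → ℝ, (∀ j, 0 ≤ μ j) → (∑' j, μ j) = 1 → (∀ j, lam < j → μ j = 0) →
        θ ≤ ∑ j ∈ Finset.range (lam + 1),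
              (((m : ℝ) - 1) * j - 1) * (m : ℝ) ^ j * μ j →
        ∀ n : ℕ, ((drStep m)^[K2 + n] μ) 0 ≤ Real.exp (-K3 * (m : ℝ) ^ n) := by
  have hm0 : (2:ℝ) ≤ m := by exact_mod_cast hm
  obtain ⟨r, hr, hr1, hη⟩ := dr_exists_r lam θ hθ
  have hr0 : 0 < r := by linarith
  set η := r ^ lam * (1 + θ) - 1 with hηdef
  set M := (m : ℝ) ^ 5 * ∑' k : ℕ, (k : ℝ) * r ^ k with hM
  have hM0 : 0 ≤ M := mul_nonneg (by positivity) (tsum_nonneg fun k => by positivity)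
  obtain ⟨N0, hN0⟩ : ∃ N0 : ℕ, r ^ N0 < η / (M + 1) :=
    exists_pow_lt_of_lt_one (by positivity) hr1
  have hN0' : r ^ N0 * M < η := by
    rw [lt_div_iff₀ (by positivity)] at hN0
    nlinarith [pow_pos hr0 N0]
  set B := lam * m ^ N0 with hBdef
  have hBpos : 0 < B := by positivity
  set N := N0 + B with hN
  obtain ⟨K3, hK3, hfin⟩ := dr_final m hm (lam * m ^ N) (by
    have : 0 < lam * m ^ N := by positivity
    omega)
  refine ⟨N, by omega, K3, hK3, fun μ hμ hsum hsupp hΔ n => ?_⟩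
  set P : Polynomial ℝ := ∑ j ∈ Finset.range (lam + 1), monomial j (μ j) with hP
  have hcoeff : P.coeff = μ := by
    funext j
    rw [hP, finsetSum_coeff]
    simp only [coeff_monomial]
    rw [Finset.sum_ite_eq' (Finset.range (lam+1)) j]
    split_ifs with hj
    · rfl
    · rw [hsupp j (by simp at hj; omega)]
  have hdeg : P.natDegree ≤ lam := by
    rw [natDegree_le_iff_coeff_eq_zero]
    intro j hj
    rw [hcoeff]; exact hsupp j hj
  have hprob : drProb P := by
    refine ⟨fun j => by rw [hcoeff]; exact hμ j, ?_⟩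
    rw [dr_eval_sum P lam hdeg, hcoeff]
    simp only [one_pow, mul_one]
    rw [← hsum, tsum_eq_sum]
    intro j hj
    exact hsupp j (by simp at hj; omega)
  have hD : θ ≤ drD m P m := by rw [drD_sum m P lam hdeg, hcoeff]; exact hΔ
  have hDr : η ≤ drD m P (r * m) := drD_init m hm P hprob lam hdeg θ hD r hr0 hr1.le
  have hgrow := drD_grow_iter m hm P hprob r hr0 (by nlinarith) hr1.le η hη hDr N0
  have hex : ∃ k, (m:ℝ)^4 < ((drT m)^[N0] P).coeff k * (m:ℝ) ^ k := by
    by_contra hc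
    push Not at hc
    have := drD_bound m hm _ (drProb_iter m P hprob N0) r hr0 hr1 hc
    have := mul_le_mul_of_nonneg_left this (pow_pos hr0 N0).le
    linarith
  obtain ⟨k, hk⟩ := hex
  have hkB : k ≤ B := by
    by_contra hc
    rw [coeff_eq_zero_of_natDegree_lt
      (lt_of_le_of_lt (drT_deg_iter m P lam hdeg N0) (not_le.mp hc)), zero_mul] at hk
    have : (0:ℝ) < (m:ℝ)^4 := by positivity
    linarith
  obtain ⟨l, hl, hmean⟩ := dr_exists_mean m hm _ (drProb_iter m P hprob N0) k hk
  have hmeanN : 1 ≤ drD m ((drT m)^[N] P) 1 := by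
    have := drE_persist m hm _ (drProb_iter m _ (drProb_iter m P hprob N0) l) hmean (B - l)
    rw [← Function.iterate_add_apply, ← Function.iterate_add_apply] at this
    rwa [show B - l + l + N0 = N by omega] at this
  have := hfin _ (drProb_iter m P hprob N) (drT_deg_iter m P lam hdeg N) hmeanN n
  rw [← Function.iterate_add_apply] at this
  rw [← hcoeff, drStep_iter, add_comm]
  exact this
end
end
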